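/- Let n ≥ 5, a ≥ 0 and p > 1, and suppose that either 1 < p ≤ (n+4+2a)/(n-4), or p > (n+4+2a)/(n-4) together with p·ℓ₁ > n(n-4)/2 and p·ℓ₂ > n²(n-4)²/16. If u is a smooth stable solution of Δ²u = |x|^a |u|^{p-1} u on all of ℝ^n, then u ≡ 0. -/

import Mathlib

open MeasureTheory Metric Set Filter
open scoped RealInnerProductSpace Topology

noncomputable section

/-- The Laplacian of `u : ℝⁿ → ℝ` at `x`, as the sum of the pure second
partial derivatives in the coordinate directions. -/
def lap (n : ℕ) (u : EuclideanSpace ℝ (Fin n) → ℝ) (x : EuclideanSpace ℝ (Fin n)) : ℝ :=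
  ∑ i : Fin n, iteratedFDeriv ℝ 2 u x ![EuclideanSpace.single i 1, EuclideanSpace.single i 1]

/-- `u` solves `Δ²u = |x|^a |u|^(p-1) u` pointwise on `Ω`. -/
def IsSolutionOn (n : ℕ) (a p : ℝ) (u : EuclideanSpace ℝ (Fin n) → ℝ)
    (Ω : Set (EuclideanSpace ℝ (Fin n))) : Prop :=
  ∀ x ∈ Ω, lap n (lap n u) x = ‖x‖ ^ a * |u x| ^ (p - 1) * u x

/-- `u` is a stable solution on `Ω`:
`p ∫ |x|^a |u|^(p-1) ψ² ≤ ∫ (Δψ)²` for every test function `ψ ∈ C_c^∞(Ω)`. -/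
def StableOn (n : ℕ) (a p : ℝ) (u : EuclideanSpace ℝ (Fin n) → ℝ)
    (Ω : Set (EuclideanSpace ℝ (Fin n))) : Prop :=
  ∀ ψ : EuclideanSpace ℝ (Fin n) → ℝ, ContDiff ℝ (⊤ : ℕ∞) ψ → HasCompactSupport ψ →
    tsupport ψ ⊆ Ω →
    p * ∫ x, ‖x‖ ^ a * |u x| ^ (p - 1) * ψ x ^ 2 ≤ ∫ x, lap n ψ x ^ 2

/-- Surface integral of `f` over the sphere `∂B_r(x)`, with respect to the
`(n-1)`-dimensional Hausdorff measure. -/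
def sphInt (n : ℕ) (x : EuclideanSpace ℝ (Fin n)) (r : ℝ)
    (f : EuclideanSpace ℝ (Fin n) → ℝ) : ℝ :=
  ∫ y in sphere x r, f y ∂(Measure.hausdorffMeasure ((n : ℝ) - 1))

/-- Radial derivative of `u` at `y`, relative to the center `x`. -/
def radDeriv (n : ℕ) (x : EuclideanSpace ℝ (Fin n))
    (u : EuclideanSpace ℝ (Fin n) → ℝ) (y : EuclideanSpace ℝ (Fin n)) : ℝ :=
  ⟪gradient u y, ‖y - x‖⁻¹ • (y - x)⟫

/-- `ℓ₁ = (β+2)(n-4-β) + β(n-2-β)` with `β = (4+a)/(p-1)`. -/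
def ell1 (n : ℕ) (a p : ℝ) : ℝ :=
  let β : ℝ := (4 + a) / (p - 1)
  (β + 2) * ((n : ℝ) - 4 - β) + β * ((n : ℝ) - 2 - β)

/-- `ℓ₂ = β(β+2)(n-4-β)(n-2-β)` with `β = (4+a)/(p-1)`. -/
def ell2 (n : ℕ) (a p : ℝ) : ℝ :=
  let β : ℝ := (4 + a) / (p - 1)
  β * (β + 2) * ((n : ℝ) - 4 - β) * ((n : ℝ) - 2 - β)

/-- The constant `c(n,p,a) = 2(ρ - γ - 1)`, `ρ = n-1-2β`, `γ = β(β-n+2)`. -/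
def cConst (n : ℕ) (a p : ℝ) : ℝ :=
  let β : ℝ := (4 + a) / (p - 1)
  2 * (((n : ℝ) - 1 - 2 * β) - β * (β - (n : ℝ) + 2) - 1)

/-- The rescaled energy `E(r; x, u)` from the monotonicity formula. -/
def energyE (n : ℕ) (a p : ℝ) (u : EuclideanSpace ℝ (Fin n) → ℝ)
    (x : EuclideanSpace ℝ (Fin n)) (r : ℝ) : ℝ :=
  let β : ℝ := (4 + a) / (p - 1)
  r ^ (2 * β + 4 - (n : ℝ)) *
      (∫ y in ball x r,
        (1 / 2) * lap n u y ^ 2 - (1 / (p + 1)) * ‖y‖ ^ a * |u y| ^ (p + 1))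
    + β / 2 * ((n : ℝ) - 2 - β) *
        deriv (fun ρ : ℝ => ρ ^ (2 * β + 1 - (n : ℝ)) * sphInt n x ρ fun y => u y ^ 2) r
    + β / 2 * ((n : ℝ) - 2 - β) *
        deriv (fun ρ : ℝ => ρ ^ (2 * β + 2 - (n : ℝ)) * sphInt n x ρ fun y => u y ^ 2) r
    + r ^ 3 / 2 *
        deriv (fun ρ : ℝ => ρ ^ (2 * β + 1 - (n : ℝ)) *
          sphInt n x ρ fun y => (β * ρ⁻¹ * u y + radDeriv n x u y) ^ 2) r
    + 1 / 2 *
        deriv (fun ρ : ℝ => ρ ^ (2 * β + 4 - (n : ℝ)) *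
          sphInt n x ρ fun y => ‖gradient u y‖ ^ 2 - radDeriv n x u y ^ 2) r
    + 1 / 2 * r ^ (2 * β + 3 - (n : ℝ)) *
        (sphInt n x r fun y => ‖gradient u y‖ ^ 2 - radDeriv n x u y ^ 2)

end

noncomputable section

/-- The real functions on `ℝⁿ` that are smooth on the punctured space `ℝⁿ \ {0}`, with no condition
on the value at the origin. -/
def PSmooth (n : ℕ) : Subalgebra ℝ (EuclideanSpace ℝ (Fin n) → ℝ) where
  carrier := {f | ContDiffOn ℝ (⊤ : ℕ∞) f {0}ᶜ}
  mul_mem' hf hg := ContDiffOn.mul hf hg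
  add_mem' hf hg := ContDiffOn.add hf hg
  algebraMap_mem' _ := contDiffOn_const

namespace PSmooth

variable {n : ℕ}

lemma contDiffAt (f : PSmooth n) {x : EuclideanSpace ℝ (Fin n)} (hx : x ≠ 0) :
    ContDiffAt ℝ (⊤ : ℕ∞) (f : EuclideanSpace ℝ (Fin n) → ℝ) x :=
  ContDiffOn.contDiffAt f.2 (isOpen_compl_singleton.mem_nhds hx)

lemma differentiableAt (f : PSmooth n) {x : EuclideanSpace ℝ (Fin n)} (hx : x ≠ 0) :
    DifferentiableAt ℝ (f : EuclideanSpace ℝ (Fin n) → ℝ) x :=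
  (contDiffAt f hx).differentiableAt (by simp)

lemma differentiableAt_fderiv (f : PSmooth n) {x : EuclideanSpace ℝ (Fin n)} (hx : x ≠ 0) :
    DifferentiableAt ℝ (fderiv ℝ (f : EuclideanSpace ℝ (Fin n) → ℝ)) x :=
  ((contDiffAt f hx).fderiv_right (m := 1) (by norm_cast)).differentiableAt
    (by simp)

/-- The derivation of `PSmooth n` along the linear vector field `x ↦ A x`. -/
def linDer (A : EuclideanSpace ℝ (Fin n) →L[ℝ] EuclideanSpace ℝ (Fin n)) :
    Derivation ℝ (PSmooth n) (PSmooth n) :=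
  Derivation.mk'
    { toFun := fun f => ⟨fun x => fderiv ℝ (f : EuclideanSpace ℝ (Fin n) → ℝ) x (A x), by
        have h : ContDiffOn ℝ (⊤ : ℕ∞) (fderiv ℝ (f : EuclideanSpace ℝ (Fin n) → ℝ)) {0}ᶜ :=
          ContDiffOn.fderiv_of_isOpen f.2 isOpen_compl_singleton (by simp)
        exact h.clm_apply A.contDiff.contDiffOn⟩
      map_add' := fun f g => by
        ext x
        rcases eq_or_ne x 0 with rfl | hx
        · simp
        · simp only [Subalgebra.coe_add, Pi.add_apply]
          rw [fderiv_add (differentiableAt f hx) (differentiableAt g hx)]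
          simp
      map_smul' := fun c f => by
        ext x
        rcases eq_or_ne x 0 with rfl | hx
        · simp
        · simp only [Subalgebra.coe_smul, RingHom.id_apply, Pi.smul_apply]
          rw [fderiv_const_smul (differentiableAt f hx)]
          simp }
    (fun f g => by
      ext x
      rcases eq_or_ne x 0 with rfl | hx
      · simp
      · simp only [LinearMap.coe_mk, AddHom.coe_mk, Subalgebra.coe_mul, Subalgebra.coe_add,
          smul_eq_mul, Pi.add_apply, Pi.mul_apply]
        rw [fderiv_mul (differentiableAt f hx) (differentiableAt g hx)]
        simp)

lemma linDer_apply (A : EuclideanSpace ℝ (Fin n) →L[ℝ] EuclideanSpace ℝ (Fin n))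
    (f : PSmooth n) (x : EuclideanSpace ℝ (Fin n)) :
    (linDer A f : EuclideanSpace ℝ (Fin n) → ℝ) x =
      fderiv ℝ (f : EuclideanSpace ℝ (Fin n) → ℝ) x (A x) := rfl

lemma linDer_zero (A : EuclideanSpace ℝ (Fin n) →L[ℝ] EuclideanSpace ℝ (Fin n))
    (f : PSmooth n) : (linDer A f : EuclideanSpace ℝ (Fin n) → ℝ) 0 = 0 := by
  simp [linDer_apply]

lemma linDer_linDer_apply (A B : EuclideanSpace ℝ (Fin n) →L[ℝ] EuclideanSpace ℝ (Fin n))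
    (f : PSmooth n) {x : EuclideanSpace ℝ (Fin n)} (hx : x ≠ 0) :
    (linDer B (linDer A f) : EuclideanSpace ℝ (Fin n) → ℝ) x =
      fderiv ℝ (fderiv ℝ (f : EuclideanSpace ℝ (Fin n) → ℝ)) x (B x) (A x) +
        fderiv ℝ (f : EuclideanSpace ℝ (Fin n) → ℝ) x (A (B x)) := by
  have h1 : HasFDerivAt (linDer A f : EuclideanSpace ℝ (Fin n) → ℝ) _ x :=
    (differentiableAt_fderiv f hx).hasFDerivAt.clm_apply A.hasFDerivAt
  rw [linDer_apply, h1.fderiv]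
  simp [add_comm]

lemma fderiv_fderiv_comm (f : PSmooth n) {x : EuclideanSpace ℝ (Fin n)} (hx : x ≠ 0)
    (v w : EuclideanSpace ℝ (Fin n)) :
    fderiv ℝ (fderiv ℝ (f : EuclideanSpace ℝ (Fin n) → ℝ)) x v w =
      fderiv ℝ (fderiv ℝ (f : EuclideanSpace ℝ (Fin n) → ℝ)) x w v :=
  ((contDiffAt f hx).isSymmSndFDerivAt (by simp; norm_cast)).eq v w

lemma linDer_congr (A : EuclideanSpace ℝ (Fin n) →L[ℝ] EuclideanSpace ℝ (Fin n))
    {f g : PSmooth n}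
    (h : ∀ x ≠ 0, (f : EuclideanSpace ℝ (Fin n) → ℝ) x = (g : EuclideanSpace ℝ (Fin n) → ℝ) x) :
    linDer A f = linDer A g := by
  ext x
  rcases eq_or_ne x 0 with rfl | hx
  · simp [linDer_zero]
  · have : (f : EuclideanSpace ℝ (Fin n) → ℝ) =ᶠ[𝓝 x] (g : EuclideanSpace ℝ (Fin n) → ℝ) :=
      eventually_of_mem (isOpen_compl_singleton.mem_nhds hx) h
    rw [linDer_apply, linDer_apply, this.fderiv_eq]

/-- The Euler derivation `f ↦ x · ∇ f`. -/
def euler : Derivation ℝ (PSmooth n) (PSmooth n) := linDer (ContinuousLinearMap.id ℝ _)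

/-- The generator `x ↦ x_i e_j - x_j e_i` of the rotations in a coordinate plane. -/
def rotGen (i j : Fin n) : EuclideanSpace ℝ (Fin n) →L[ℝ] EuclideanSpace ℝ (Fin n) :=
  (EuclideanSpace.proj i).smulRight (EuclideanSpace.single j (1 : ℝ)) -
    (EuclideanSpace.proj j).smulRight (EuclideanSpace.single i (1 : ℝ))

lemma rotGen_apply (i j : Fin n) (x : EuclideanSpace ℝ (Fin n)) :
    rotGen i j x = x i • EuclideanSpace.single j (1 : ℝ) - x j • EuclideanSpace.single i (1 : ℝ) :=
  rfl

/-- The angular derivation `f ↦ x_i ∂_j f - x_j ∂_i f`. -/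
def rot (i j : Fin n) : Derivation ℝ (PSmooth n) (PSmooth n) := linDer (rotGen i j)

/-- The spherical Laplacian `½ ∑ (x_i ∂_j - x_j ∂_i)²`. -/
def sphLap : PSmooth n →ₗ[ℝ] PSmooth n where
  toFun f := (1 / 2 : ℝ) • ∑ i, ∑ j, rot i j (rot i j f)
  map_add' f g := by simp only [map_add, Finset.sum_add_distrib, smul_add]
  map_smul' c f := by
    simp only [Derivation.map_smul, ← Finset.smul_sum, RingHom.id_apply]
    exact smul_comm _ _ _

lemma sphLap_eq (f : PSmooth n) :
    sphLap f = (1 / 2 : ℝ) • ∑ i, ∑ j, rot i j (rot i j f) := rfl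

/-- The inner product of spherical gradients, `½ ∑ (x_i ∂_j f - x_j ∂_i f)(x_i ∂_j g - x_j ∂_i g)`. -/
def sphGrad : PSmooth n →ₗ[ℝ] PSmooth n →ₗ[ℝ] PSmooth n :=
  LinearMap.mk₂ ℝ (fun f g => (1 / 2 : ℝ) • ∑ i, ∑ j, rot i j f * rot i j g)
    (fun f f' g => by simp only [map_add, add_mul, Finset.sum_add_distrib, smul_add])
    (fun c f g => by
      simp only [Derivation.map_smul, smul_mul_assoc, ← Finset.smul_sum]
      exact smul_comm _ _ _)
    (fun f g g' => by simp only [map_add, mul_add, Finset.sum_add_distrib, smul_add])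
    (fun c f g => by
      simp only [Derivation.map_smul, mul_smul_comm, ← Finset.smul_sum]
      exact smul_comm _ _ _)

lemma sphGrad_eq (f g : PSmooth n) :
    sphGrad f g = (1 / 2 : ℝ) • ∑ i, ∑ j, rot i j f * rot i j g := rfl

lemma sphGrad_comm (f g : PSmooth n) : sphGrad f g = sphGrad g f := by
  simp only [sphGrad_eq, mul_comm]

lemma coe_sum_apply {ι : Type*} (s : Finset ι) (f : ι → PSmooth n)
    (x : EuclideanSpace ℝ (Fin n)) :
    ((∑ i ∈ s, f i : PSmooth n) : EuclideanSpace ℝ (Fin n) → ℝ) x =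
      ∑ i ∈ s, (f i : EuclideanSpace ℝ (Fin n) → ℝ) x := by
  rw [AddSubmonoidClass.coe_finsetSum, Finset.sum_apply]

lemma sphGrad_apply (f g : PSmooth n) (x : EuclideanSpace ℝ (Fin n)) :
    (sphGrad f g : EuclideanSpace ℝ (Fin n) → ℝ) x =
      1 / 2 * ∑ i, ∑ j, (rot i j f : EuclideanSpace ℝ (Fin n) → ℝ) x *
        (rot i j g : EuclideanSpace ℝ (Fin n) → ℝ) x := by
  simp [sphGrad_eq]

lemma sphGrad_self_nonneg (f : PSmooth n) (x : EuclideanSpace ℝ (Fin n)) :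
    0 ≤ (sphGrad f f : EuclideanSpace ℝ (Fin n) → ℝ) x := by
  rw [sphGrad_apply]
  exact mul_nonneg (by norm_num)
    (Finset.sum_nonneg fun i _ => Finset.sum_nonneg fun j _ => mul_self_nonneg _)

/-- A function annihilated by all angular derivations. -/
def IsRadial (g : PSmooth n) : Prop := ∀ i j, rot i j g = 0

lemma IsRadial.mul {g h : PSmooth n} (hg : IsRadial g) (hh : IsRadial h) : IsRadial (g * h) :=
  fun i j => by simp [hg i j, hh i j]

lemma IsRadial.pow {g : PSmooth n} (hg : IsRadial g) (k : ℕ) : IsRadial (g ^ k) :=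
  fun i j => by simp [Derivation.leibniz_pow, hg i j]

lemma rot_euler (i j : Fin n) (f : PSmooth n) : rot i j (euler f) = euler (rot i j f) := by
  ext x
  rcases eq_or_ne x 0 with rfl | hx
  · simp [euler, rot, linDer_zero]
  · rw [rot, euler, linDer_linDer_apply _ _ _ hx, linDer_linDer_apply _ _ _ hx,
      fderiv_fderiv_comm f hx]
    simp

lemma IsRadial.euler {g : PSmooth n} (hg : IsRadial g) : IsRadial (euler g) :=
  fun i j => by rw [rot_euler, hg i j, map_zero]

lemma euler_sphLap (f : PSmooth n) : euler (sphLap f) = sphLap (euler f) := by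
  simp [sphLap_eq, rot_euler]

lemma euler_sphGrad (f g : PSmooth n) :
    euler (sphGrad f g) = sphGrad (euler f) g + sphGrad f (euler g) := by
  rw [sphGrad_eq, sphGrad_eq, sphGrad_eq, Derivation.map_smul, ← smul_add, map_sum,
    ← Finset.sum_add_distrib]
  congr 1
  refine Finset.sum_congr rfl fun i _ => ?_
  rw [map_sum, ← Finset.sum_add_distrib]
  refine Finset.sum_congr rfl fun j _ => ?_
  rw [Derivation.leibniz, rot_euler, rot_euler, smul_eq_mul, smul_eq_mul]
  ring

lemma sphLap_radial_mul {g : PSmooth n} (hg : IsRadial g) (f : PSmooth n) :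
    sphLap (g * f) = g * sphLap f := by
  simp [sphLap_eq, hg _ _, Finset.mul_sum]

lemma sphGrad_radial_mul_left {g : PSmooth n} (hg : IsRadial g) (f h : PSmooth n) :
    sphGrad (g * f) h = g * sphGrad f h := by
  simp [sphGrad_eq, hg _ _, Finset.mul_sum, mul_assoc]

lemma sphGrad_radial_mul_right {g : PSmooth n} (hg : IsRadial g) (f h : PSmooth n) :
    sphGrad f (g * h) = g * sphGrad f h := by
  rw [sphGrad_comm, sphGrad_radial_mul_left hg, sphGrad_comm]

lemma mul_sphLap_add_sphGrad (f g : PSmooth n) :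
    f * sphLap g + sphGrad f g = (1 / 2 : ℝ) • ∑ i, ∑ j, rot i j (f * rot i j g) := by
  simp only [sphLap_eq, sphGrad_eq, Derivation.leibniz, smul_eq_mul, mul_smul_comm, ← smul_add,
    Finset.mul_sum, ← Finset.sum_add_distrib]
  congr 1
  exact Finset.sum_congr rfl fun i _ => Finset.sum_congr rfl fun j _ => by ring

lemma abs_sphGrad_le (f g : PSmooth n) (x : EuclideanSpace ℝ (Fin n)) :
    |(sphGrad f g : EuclideanSpace ℝ (Fin n) → ℝ) x| ≤
      ((sphGrad f f : EuclideanSpace ℝ (Fin n) → ℝ) x +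
        (sphGrad g g : EuclideanSpace ℝ (Fin n) → ℝ) x) / 2 := by
  have h1 := sphGrad_self_nonneg (f + g) x
  have h2 := sphGrad_self_nonneg (f - g) x
  have h3 : sphGrad g f = sphGrad f g := sphGrad_comm _ _
  simp only [map_add, map_sub, LinearMap.add_apply, LinearMap.sub_apply, Subalgebra.coe_add,
    AddSubgroupClass.coe_sub, Pi.add_apply, Pi.sub_apply, h3] at h1 h2
  rw [abs_le]
  constructor <;> linarith

end PSmooth

end

noncomputable section

namespace PSmooth

variable {n : ℕ}

instance : CoeFun (PSmooth n) fun _ => EuclideanSpace ℝ (Fin n) → ℝ := ⟨Subtype.val⟩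

lemma linDer_of_eq_comp_norm_sq (A : EuclideanSpace ℝ (Fin n) →L[ℝ] EuclideanSpace ℝ (Fin n))
    (f : PSmooth n) {H : ℝ → ℝ} {H' : ℝ} {x : EuclideanSpace ℝ (Fin n)} (hx : x ≠ 0)
    (hf : ∀ y ≠ 0, f y = H (‖y‖ ^ 2))
    (hH : HasDerivAt H H' (‖x‖ ^ 2)) :
    (linDer A f : PSmooth n) x = H' * (2 * ⟪x, A x⟫) := by
  have h1 : HasFDerivAt (fun y : EuclideanSpace ℝ (Fin n) => H (‖y‖ ^ 2)) _ x :=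
    hH.comp_hasFDerivAt x (hasStrictFDerivAt_norm_sq x).hasFDerivAt
  have h2 : (f : EuclideanSpace ℝ (Fin n) → ℝ) =ᶠ[𝓝 x] fun y => H (‖y‖ ^ 2) :=
    eventually_of_mem (isOpen_compl_singleton.mem_nhds hx) hf
  rw [linDer_apply, h2.fderiv_eq, h1.fderiv]
  simp

lemma inner_rotGen (i j : Fin n) (x : EuclideanSpace ℝ (Fin n)) : ⟪x, rotGen i j x⟫ = 0 := by
  simp [rotGen_apply, inner_sub_right, inner_smul_right, EuclideanSpace.inner_single_right,
    mul_comm]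

/-- The radial function `x ↦ h (log ‖x‖)`. -/
def rad (h : ℝ → ℝ) (hh : ContDiff ℝ (⊤ : ℕ∞) h) : PSmooth n :=
  ⟨fun x => h (Real.log ‖x‖), fun x hx =>
    (hh.contDiffAt.comp x ((contDiffAt_norm ℝ hx).log (norm_ne_zero_iff.2 hx))).contDiffWithinAt⟩

lemma rad_apply (h : ℝ → ℝ) (hh : ContDiff ℝ (⊤ : ℕ∞) h) (x : EuclideanSpace ℝ (Fin n)) :
    (rad h hh : PSmooth n) x = h (Real.log ‖x‖) := rfl

lemma linDer_rad (A : EuclideanSpace ℝ (Fin n) →L[ℝ] EuclideanSpace ℝ (Fin n))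
    (h : ℝ → ℝ) (hh : ContDiff ℝ (⊤ : ℕ∞) h)
    {x : EuclideanSpace ℝ (Fin n)} (hx : x ≠ 0) :
    (linDer A (rad h hh) : PSmooth n) x =
      deriv h (Real.log ‖x‖) * (‖x‖ ^ 2)⁻¹ * ⟪x, A x⟫ := by
  have hn : ‖x‖ ^ 2 ≠ 0 := by simpa using hx
  have e : ∀ y : EuclideanSpace ℝ (Fin n), Real.log ‖y‖ = 1 / 2 * Real.log (‖y‖ ^ 2) := by
    intro y; rw [Real.log_pow]; push_cast; ring
  have h1 : HasDerivAt h (deriv h (Real.log ‖x‖)) (1 / 2 * Real.log (‖x‖ ^ 2)) := by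
    rw [← e]; exact (hh.differentiable (by simp)).differentiableAt.hasDerivAt
  have h2 := h1.comp (‖x‖ ^ 2) ((Real.hasDerivAt_log hn).const_mul (1 / 2))
  rw [linDer_of_eq_comp_norm_sq A _ hx (fun y _ => by rw [rad_apply, e]; rfl) h2]
  ring

lemma euler_rad_apply (h : ℝ → ℝ) (hh : ContDiff ℝ (⊤ : ℕ∞) h)
    {x : EuclideanSpace ℝ (Fin n)} (hx : x ≠ 0) :
    (euler (rad h hh) : PSmooth n) x = deriv h (Real.log ‖x‖) := by
  have hn : ‖x‖ ≠ 0 := by simpa using hx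
  rw [euler, linDer_rad _ _ _ hx]
  simp [hn]

lemma isRadial_rad (h : ℝ → ℝ) (hh : ContDiff ℝ (⊤ : ℕ∞) h) :
    IsRadial (rad h hh : PSmooth n) := by
  intro i j
  ext x
  rcases eq_or_ne x 0 with rfl | hx
  · simp [rot, linDer_zero]
  · rw [rot, linDer_rad _ _ _ hx, inner_rotGen]
    simp

/-- The power `x ↦ ‖x‖ ^ s`. -/
def npow (s : ℝ) : PSmooth n :=
  ⟨fun x => ‖x‖ ^ s, fun _ hx =>
    ((contDiffAt_norm ℝ hx).rpow_const_of_ne (norm_ne_zero_iff.2 hx)).contDiffWithinAt⟩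

lemma npow_apply (s : ℝ) (x : EuclideanSpace ℝ (Fin n)) :
    (npow s : PSmooth n) x = ‖x‖ ^ s := rfl

lemma linDer_npow (A : EuclideanSpace ℝ (Fin n) →L[ℝ] EuclideanSpace ℝ (Fin n)) (s : ℝ)
    {x : EuclideanSpace ℝ (Fin n)} (hx : x ≠ 0) :
    (linDer A (npow s) : PSmooth n) x =
      s * (‖x‖ ^ s * (‖x‖ ^ 2)⁻¹) * ⟪x, A x⟫ := by
  have hn : 0 < ‖x‖ := norm_pos_iff.2 hx
  have e : ∀ y : EuclideanSpace ℝ (Fin n), ‖y‖ ^ s = (‖y‖ ^ 2) ^ (s / 2) := by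
    intro y
    rw [← Real.rpow_natCast ‖y‖ 2, ← Real.rpow_mul (norm_nonneg _)]
    congr 1; push_cast; ring
  rw [linDer_of_eq_comp_norm_sq A _ hx (fun y _ => by rw [npow_apply, e])
    (Real.hasDerivAt_rpow_const (Or.inl (pow_pos hn 2).ne')), Real.rpow_sub (pow_pos hn 2),
    ← e, Real.rpow_one]
  field_simp

lemma euler_npow (s : ℝ) : euler (npow s : PSmooth n) = s • npow s := by
  ext x
  rcases eq_or_ne x 0 with rfl | hx
  · rcases eq_or_ne s 0 with rfl | hs
    · simp [euler, linDer_zero]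
    · simp [euler, linDer_zero, npow_apply, Real.zero_rpow hs]
  · have hn : ‖x‖ ≠ 0 := by simpa using hx
    rw [euler, linDer_npow _ _ hx]
    simp only [ContinuousLinearMap.coe_id', id_eq, real_inner_self_eq_norm_sq, Subalgebra.coe_smul,
      Pi.smul_apply, npow_apply, smul_eq_mul]
    field_simp

lemma isRadial_npow (s : ℝ) : IsRadial (npow s : PSmooth n) := by
  intro i j
  ext x
  rcases eq_or_ne x 0 with rfl | hx
  · simp [rot, linDer_zero]
  · rw [rot, linDer_npow _ _ hx, inner_rotGen]
    simp

/-- The functions vanishing outside some annulus `r ≤ ‖x‖ ≤ R` with `0 < r`. -/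
def annular (n : ℕ) : Ideal (PSmooth n) where
  carrier := {f | ∃ r > 0, ∃ R, ∀ x ≠ 0, f x ≠ 0 →
    r ≤ ‖x‖ ∧ ‖x‖ ≤ R}
  zero_mem' := ⟨1, one_pos, 1, fun x _ h => absurd rfl h⟩
  add_mem' := by
    rintro f g ⟨r, hr, R, hf⟩ ⟨r', hr', R', hg⟩
    refine ⟨min r r', lt_min hr hr', max R R', fun x hx h => ?_⟩
    by_cases hfx : f x = 0
    · have hgx : g x ≠ 0 := fun h' => h (by simp [hfx, h'])
      exact ⟨(min_le_right _ _).trans (hg x hx hgx).1, (hg x hx hgx).2.trans (le_max_right _ _)⟩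
    · exact ⟨(min_le_left _ _).trans (hf x hx hfx).1, (hf x hx hfx).2.trans (le_max_left _ _)⟩
  smul_mem' := by
    rintro c f ⟨r, hr, R, hf⟩
    exact ⟨r, hr, R, fun x hx h => hf x hx fun h' => h (by simp [h'])⟩

lemma smul_mem_annular (c : ℝ) {f : PSmooth n} (hf : f ∈ annular n) : c • f ∈ annular n :=
  Submodule.smul_of_tower_mem _ c hf

lemma linDer_mem_annular (A : EuclideanSpace ℝ (Fin n) →L[ℝ] EuclideanSpace ℝ (Fin n))
    {f : PSmooth n} (hf : f ∈ annular n) : linDer A f ∈ annular n := by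
  obtain ⟨r, hr, R, hf⟩ := hf
  refine ⟨r, hr, R, fun x hx h => ?_⟩
  by_contra hc
  apply h
  have hcl : IsClosed {y : EuclideanSpace ℝ (Fin n) | r ≤ ‖y‖ ∧ ‖y‖ ≤ R} :=
    (isClosed_le continuous_const continuous_norm).inter
      (isClosed_le continuous_norm continuous_const)
  have ho : IsOpen ({0}ᶜ ∩ {y : EuclideanSpace ℝ (Fin n) | r ≤ ‖y‖ ∧ ‖y‖ ≤ R}ᶜ) :=
    isOpen_compl_singleton.inter hcl.isOpen_compl
  have : (f : EuclideanSpace ℝ (Fin n) → ℝ) =ᶠ[𝓝 x] fun _ => 0 := by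
    filter_upwards [ho.mem_nhds ⟨hx, hc⟩] with y hy
    by_contra h'
    exact hy.2 (hf y hy.1 h')
  rw [linDer_apply, this.fderiv_eq]
  simp

lemma euler_mem_annular {f : PSmooth n} (hf : f ∈ annular n) : euler f ∈ annular n :=
  linDer_mem_annular _ hf

lemma rot_mem_annular (i j : Fin n) {f : PSmooth n} (hf : f ∈ annular n) :
    rot i j f ∈ annular n :=
  linDer_mem_annular _ hf

lemma sphLap_mem_annular {f : PSmooth n} (hf : f ∈ annular n) : sphLap f ∈ annular n :=
  smul_mem_annular _ (Ideal.sum_mem _ fun i _ => Ideal.sum_mem _ fun j _ =>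
    rot_mem_annular i j (rot_mem_annular i j hf))

lemma sphGrad_mem_annular {f : PSmooth n} (hf : f ∈ annular n) (g : PSmooth n) :
    sphGrad f g ∈ annular n :=
  smul_mem_annular _ (Ideal.sum_mem _ fun i _ => Ideal.sum_mem _ fun j _ =>
    Ideal.mul_mem_right _ _ (rot_mem_annular i j hf))

lemma hasCompactSupport_of_mem_annular {f : PSmooth n} (hf : f ∈ annular n) :
    HasCompactSupport (f : EuclideanSpace ℝ (Fin n) → ℝ) := by
  obtain ⟨r, hr, R, hf⟩ := hf
  refine HasCompactSupport.of_support_subset_isCompact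
    (isCompact_closedBall (0 : EuclideanSpace ℝ (Fin n)) (max R 0)) fun x hx => ?_
  rw [mem_closedBall_zero_iff]
  rcases eq_or_ne x 0 with rfl | h0
  · simp
  · exact (hf x h0 hx).2.trans (le_max_left _ _)

lemma contDiff_of_mem_annular {f : PSmooth n} (hf : f ∈ annular n)
    (h0 : f 0 = 0) :
    ContDiff ℝ (⊤ : ℕ∞) (f : EuclideanSpace ℝ (Fin n) → ℝ) := by
  obtain ⟨r, hr, R, hf⟩ := hf
  rw [contDiff_iff_contDiffAt]
  intro x
  rcases eq_or_ne x 0 with rfl | hx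
  · have : (f : EuclideanSpace ℝ (Fin n) → ℝ) =ᶠ[𝓝 0] fun _ => 0 := by
      filter_upwards [ball_mem_nhds (0 : EuclideanSpace ℝ (Fin n)) hr] with y hy
      rcases eq_or_ne y 0 with rfl | hy0
      · exact h0
      · by_contra h'
        exact absurd (hf y hy0 h').1 (not_le.2 (mem_ball_zero_iff.1 hy))
    exact contDiffAt_const.congr_of_eventuallyEq this
  · exact contDiffAt f hx

lemma integral_coord_mul_fderiv {g : EuclideanSpace ℝ (Fin n) → ℝ} (hg : ContDiff ℝ 1 g)
    (hc : HasCompactSupport g) (i j : Fin n) :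
    ∫ x, x i * fderiv ℝ g x (EuclideanSpace.single j 1) =
      -((if i = j then 1 else 0) * ∫ x, g x) := by
  have hcoord : ∀ x : EuclideanSpace ℝ (Fin n),
      HasFDerivAt (fun y : EuclideanSpace ℝ (Fin n) => y i)
        (EuclideanSpace.proj i : EuclideanSpace ℝ (Fin n) →L[ℝ] ℝ) x :=
    fun x => (EuclideanSpace.proj i : EuclideanSpace ℝ (Fin n) →L[ℝ] ℝ).hasFDerivAt
  have hcont : Continuous fun y : EuclideanSpace ℝ (Fin n) => y i :=
    (EuclideanSpace.proj i : EuclideanSpace ℝ (Fin n) →L[ℝ] ℝ).continuous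
  have hd : Continuous fun x => fderiv ℝ g x (EuclideanSpace.single j 1) :=
    (hg.continuous_fderiv (by simp)).clm_apply continuous_const
  have hdc : HasCompactSupport fun x => fderiv ℝ g x (EuclideanSpace.single j 1) :=
    hc.fderiv_apply (𝕜 := ℝ) _
  have hone : ∀ x : EuclideanSpace ℝ (Fin n),
      fderiv ℝ (fun y : EuclideanSpace ℝ (Fin n) => y i) x (EuclideanSpace.single j 1) =
        if i = j then 1 else 0 := by
    intro x
    rw [(hcoord x).fderiv]
    simp
  rw [integral_mul_fderiv_eq_neg_fderiv_mul_of_integrable (f := fun y : EuclideanSpace ℝ (Fin n)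
    => y i)]
  · simp only [hone]
    rw [integral_const_mul]
  · simp only [hone]
    exact (hg.continuous.integrable_of_hasCompactSupport hc).const_mul _
  · exact (hcont.mul hd).integrable_of_hasCompactSupport hdc.mul_left
  · exact (hcont.mul hg.continuous).integrable_of_hasCompactSupport hc.mul_left
  · exact fun x _ => (hcoord x).differentiableAt
  · exact fun x _ => hg.differentiable (by simp) x

lemma integrable_coord_mul_fderiv {g : EuclideanSpace ℝ (Fin n) → ℝ} (hg : ContDiff ℝ 1 g)
    (hc : HasCompactSupport g) (i j : Fin n) :
    Integrable fun x => x i * fderiv ℝ g x (EuclideanSpace.single j 1) := by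
  have hcont : Continuous fun y : EuclideanSpace ℝ (Fin n) => y i :=
    (EuclideanSpace.proj i : EuclideanSpace ℝ (Fin n) →L[ℝ] ℝ).continuous
  have hd : Continuous fun x => fderiv ℝ g x (EuclideanSpace.single j 1) :=
    (hg.continuous_fderiv (by simp)).clm_apply continuous_const
  have hdc : HasCompactSupport fun x => fderiv ℝ g x (EuclideanSpace.single j 1) :=
    hc.fderiv_apply (𝕜 := ℝ) _
  exact (hcont.mul hd).integrable_of_hasCompactSupport hdc.mul_left

lemma eq_sum_single (x : EuclideanSpace ℝ (Fin n)) :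
    x = ∑ i, x i • EuclideanSpace.single i (1 : ℝ) := by
  ext j
  simp [Pi.single_apply]

lemma integral_fderiv_self {g : EuclideanSpace ℝ (Fin n) → ℝ} (hg : ContDiff ℝ 1 g)
    (hc : HasCompactSupport g) : ∫ x, fderiv ℝ g x x = -(n * ∫ x, g x) := by
  have h : ∀ x, fderiv ℝ g x x = ∑ i, x i * fderiv ℝ g x (EuclideanSpace.single i 1) := by
    intro x
    conv_lhs => rw [eq_sum_single x, map_sum]
    rw [← eq_sum_single x]
    simp
  simp only [h]
  rw [integral_finsetSum _ fun i _ => integrable_coord_mul_fderiv hg hc i i]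
  simp [integral_coord_mul_fderiv hg hc]

lemma integral_fderiv_rotGen {g : EuclideanSpace ℝ (Fin n) → ℝ} (hg : ContDiff ℝ 1 g)
    (hc : HasCompactSupport g) (i j : Fin n) : ∫ x, fderiv ℝ g x (rotGen i j x) = 0 := by
  simp only [rotGen_apply, map_sub, map_smul, smul_eq_mul]
  rw [integral_sub (integrable_coord_mul_fderiv hg hc i j) (integrable_coord_mul_fderiv hg hc j i),
    integral_coord_mul_fderiv hg hc, integral_coord_mul_fderiv hg hc]
  simp [eq_comm]

end PSmooth

end

noncomputable section

namespace PSmooth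

variable {n : ℕ}

/-- The integral against the dilation-invariant measure `‖x‖ ^ (-n) dx`. -/
def pInt (f : PSmooth n) : ℝ := ∫ x, ‖x‖ ^ (-(n : ℝ)) * f x

lemma pInt_smul (c : ℝ) (f : PSmooth n) : pInt (c • f) = c * pInt f := by
  rw [pInt, pInt, ← integral_const_mul]
  simp [mul_left_comm]

section Integral

variable [NeZero n]

lemma npow_neg_dim_mul_zero (f : PSmooth n) : (npow (-(n : ℝ)) * f : PSmooth n) 0 = 0 := by
  have hn : -(n : ℝ) ≠ 0 := by simpa using NeZero.ne n
  simp [npow_apply, Real.zero_rpow hn]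

lemma contDiff_npow_mul {f : PSmooth n} (hf : f ∈ annular n) :
    ContDiff ℝ (⊤ : ℕ∞) (npow (-(n : ℝ)) * f : PSmooth n) :=
  contDiff_of_mem_annular (Ideal.mul_mem_left _ _ hf) (npow_neg_dim_mul_zero f)

lemma integrable_of_mem_annular {f : PSmooth n} (hf : f ∈ annular n) :
    Integrable fun x => ‖x‖ ^ (-(n : ℝ)) * f x :=
  (contDiff_npow_mul hf).continuous.integrable_of_hasCompactSupport
    (hasCompactSupport_of_mem_annular (Ideal.mul_mem_left _ _ hf))

lemma pInt_add {f g : PSmooth n} (hf : f ∈ annular n) (hg : g ∈ annular n) :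
    pInt (f + g) = pInt f + pInt g := by
  rw [pInt, pInt, pInt,
    ← integral_add (integrable_of_mem_annular hf) (integrable_of_mem_annular hg)]
  simp [mul_add]

lemma pInt_mono {f g : PSmooth n} (hf : f ∈ annular n) (hg : g ∈ annular n)
    (h : ∀ x ≠ 0, f x ≤ g x) : pInt f ≤ pInt g := by
  refine integral_mono (integrable_of_mem_annular hf) (integrable_of_mem_annular hg) fun x => ?_
  rcases eq_or_ne x 0 with rfl | hx
  · have hn : -(n : ℝ) ≠ 0 := by simpa using NeZero.ne n
    simp [Real.zero_rpow hn]
  · exact mul_le_mul_of_nonneg_left (h x hx) (Real.rpow_nonneg (norm_nonneg _) _)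

lemma pInt_nonneg {f : PSmooth n} (hf : f ∈ annular n) (h : ∀ x ≠ 0, 0 ≤ f x) :
    0 ≤ pInt f := by
  have := pInt_mono (Ideal.zero_mem _) hf (fun x hx => by simpa using h x hx)
  simpa [pInt] using this

lemma eq_zero_of_pInt_eq_zero {f : PSmooth n} (hf : f ∈ annular n) (h : ∀ x ≠ 0, 0 ≤ f x)
    (h0 : pInt f = 0) {x : EuclideanSpace ℝ (Fin n)} (hx : x ≠ 0) : f x = 0 := by
  by_contra hne
  have hpos : ∀ y, 0 ≤ (npow (-(n : ℝ)) * f : PSmooth n) y := by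
    intro y
    rcases eq_or_ne y 0 with rfl | hy
    · exact (npow_neg_dim_mul_zero f).ge
    · exact mul_nonneg (Real.rpow_nonneg (norm_nonneg _) _) (h y hy)
  have := Continuous.integral_pos_of_hasCompactSupport_nonneg_nonzero (μ := volume)
    (x := x) (contDiff_npow_mul hf).continuous
    (hasCompactSupport_of_mem_annular (Ideal.mul_mem_left _ _ hf)) hpos
    (mul_ne_zero (Real.rpow_pos_of_pos (norm_pos_iff.2 hx) _).ne' hne)
  exact this.ne' h0

lemma pInt_euler {f : PSmooth n} (hf : f ∈ annular n) : pInt (euler f) = 0 := by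
  have hm : npow (-(n : ℝ)) * f ∈ annular n := Ideal.mul_mem_left _ _ hf
  have h := integral_fderiv_self ((contDiff_npow_mul hf).of_le (by norm_cast))
    (hasCompactSupport_of_mem_annular hm)
  have e : euler (npow (-(n : ℝ)) * f) =
      npow (-(n : ℝ)) * euler f + (-(n : ℝ)) • (npow (-(n : ℝ)) * f) := by
    rw [Derivation.leibniz, euler_npow]
    simp only [smul_eq_mul, mul_smul_comm]
    rw [mul_comm f]
  have h1 : ∫ x, fderiv ℝ (npow (-(n : ℝ)) * f : PSmooth n) x x =
      ∫ x, (euler (npow (-(n : ℝ)) * f) : PSmooth n) x := rfl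
  have h2 : ∫ x, (euler (npow (-(n : ℝ)) * f) : PSmooth n) x =
      pInt (euler f) + (-(n : ℝ)) * pInt f := by
    rw [← pInt_smul, ← pInt_add (euler_mem_annular hf) (smul_mem_annular _ hf), e, pInt]
    simp [npow_apply, mul_add, mul_left_comm]
  have h3 : ∫ x, (npow (-(n : ℝ)) * f : PSmooth n) x = pInt f := rfl
  rw [h1, h2, h3] at h
  linarith

lemma pInt_rot (i j : Fin n) {f : PSmooth n} (hf : f ∈ annular n) : pInt (rot i j f) = 0 := by
  have hm : npow (-(n : ℝ)) * f ∈ annular n := Ideal.mul_mem_left _ _ hf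
  have h := integral_fderiv_rotGen ((contDiff_npow_mul hf).of_le (by norm_cast))
    (hasCompactSupport_of_mem_annular hm) i j
  have e : rot i j (npow (-(n : ℝ)) * f) = npow (-(n : ℝ)) * rot i j f := by
    simp [isRadial_npow _ i j]
  have h1 : ∫ x, fderiv ℝ (npow (-(n : ℝ)) * f : PSmooth n) x (rotGen i j x) =
      ∫ x, (rot i j (npow (-(n : ℝ)) * f) : PSmooth n) x := rfl
  rw [h1, e] at h
  exact h

variable (n) in
/-- The annular functions whose integral vanishes. -/
def null : Submodule ℝ (PSmooth n) where
  carrier := {f | f ∈ annular n ∧ pInt f = 0}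
  zero_mem' := ⟨Ideal.zero_mem _, by simp [pInt]⟩
  add_mem' hf hg := ⟨Ideal.add_mem _ hf.1 hg.1, by rw [pInt_add hf.1 hg.1, hf.2, hg.2, add_zero]⟩
  smul_mem' c _ hf := ⟨smul_mem_annular c hf.1, by rw [pInt_smul, hf.2, mul_zero]⟩

lemma euler_mem_null {f : PSmooth n} (hf : f ∈ annular n) : euler f ∈ null n :=
  ⟨euler_mem_annular hf, pInt_euler hf⟩

lemma mul_sphLap_add_sphGrad_mem_null {f : PSmooth n} (hf : f ∈ annular n) (g : PSmooth n) :
    f * sphLap g + sphGrad f g ∈ null n := by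
  rw [mul_sphLap_add_sphGrad]
  refine Submodule.smul_mem _ _ (Submodule.sum_mem _ fun i _ => Submodule.sum_mem _ fun j _ => ?_)
  have h : f * rot i j g ∈ annular n := Ideal.mul_mem_right _ _ hf
  exact ⟨rot_mem_annular i j h, pInt_rot i j h⟩

lemma pInt_le_of_le_add_null {f g z : PSmooth n} (hf : f ∈ annular n) (hg : g ∈ annular n)
    (hz : z ∈ null n) (h : ∀ x ≠ 0, f x ≤ g x + z x) : pInt f ≤ pInt g := by
  have := pInt_mono hf (Ideal.add_mem _ hg hz.1) h
  rwa [pInt_add hg hz.1, hz.2, add_zero] at this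

end Integral

/-- The operator `D² + b D + c + Λ` with `D` the Euler derivation, `Λ` the spherical Laplacian. -/
def op (b c : ℝ) : PSmooth n →ₗ[ℝ] PSmooth n where
  toFun f := euler (euler f) + b • euler f + c • f + sphLap f
  map_add' f g := by simp only [map_add, smul_add]; abel
  map_smul' r f := by
    simp only [Derivation.map_smul, map_smul, smul_add, RingHom.id_apply, smul_comm r]

lemma op_eq (b c : ℝ) (f : PSmooth n) :
    op b c f = euler (euler f) + b • euler f + c • f + sphLap f := rfl

lemma op_npow_mul (b c s : ℝ) (f : PSmooth n) :
    op b c (npow s * f) = npow s * op (b + 2 * s) (c + b * s + s ^ 2) f := by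
  ext x
  simp only [op_eq, sphLap_radial_mul (isRadial_npow s), Derivation.leibniz, euler_npow,
    Derivation.map_smul, smul_eq_mul, map_add]
  simp
  ring

lemma op_mem_annular (b c : ℝ) {f : PSmooth n} (hf : f ∈ annular n) : op b c f ∈ annular n :=
  Ideal.add_mem _ (Ideal.add_mem _ (Ideal.add_mem _ (euler_mem_annular (euler_mem_annular hf))
    (smul_mem_annular _ (euler_mem_annular hf))) (smul_mem_annular _ hf)) (sphLap_mem_annular hf)

lemma op_apply (b c : ℝ) (f : PSmooth n) (x : EuclideanSpace ℝ (Fin n)) :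
    op b c f x = euler (euler f) x + b * euler f x + c * f x + sphLap f x := rfl

lemma bilin_eq_sum (H : EuclideanSpace ℝ (Fin n) →L[ℝ] EuclideanSpace ℝ (Fin n) →L[ℝ] ℝ)
    (x : EuclideanSpace ℝ (Fin n)) :
    H x x = ∑ i, ∑ j, x i * x j *
      H (EuclideanSpace.single i 1) (EuclideanSpace.single j 1) := by
  conv_lhs => rw [eq_sum_single x]
  simp only [map_sum, map_smul, sum_apply, smul_apply,
    smul_eq_mul, Finset.mul_sum]
  rw [Finset.sum_comm]
  exact Finset.sum_congr rfl fun i _ => Finset.sum_congr rfl fun j _ => by ring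

lemma op_eq_norm_sq_mul_lap (f : PSmooth n) {x : EuclideanSpace ℝ (Fin n)} (hx : x ≠ 0) :
    op (n - 2) 0 f x = ‖x‖ ^ 2 * lap n f x := by
  set H := fderiv ℝ (fderiv ℝ f.1) x with hH
  set L := fderiv ℝ f.1 x with hL
  set e : Fin n → EuclideanSpace ℝ (Fin n) := fun i => EuclideanSpace.single i 1 with he
  have hsymm : ∀ v w, H v w = H w v := fun v w => fderiv_fderiv_comm f hx v w
  have h1 : euler (euler f) x = H x x + L x := by
    rw [euler, linDer_linDer_apply _ _ _ hx]; rfl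
  have h2 : euler f x = L x := rfl
  have hLx : L x = ∑ i, x i * L (e i) := by
    conv_lhs => rw [eq_sum_single x]
    simp [he]
  have h3 : ∀ i j, rot i j (rot i j f) x =
      (x i ^ 2 * H (e j) (e j) + x j ^ 2 * H (e i) (e i) - 2 * (x i * x j * H (e i) (e j))) +
        ((if i = j then x i * L (e j) + x j * L (e i) else 0) - (x j * L (e j) + x i * L (e i))) := by
    intro i j
    rw [rot, linDer_linDer_apply _ _ _ hx]
    simp only [rotGen_apply, map_sub, map_smul, sub_apply,
      smul_apply, smul_eq_mul]
    rw [← hH, ← hL, hsymm (EuclideanSpace.single j 1) (EuclideanSpace.single i 1)]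
    split_ifs with hij
    · subst hij; simp; ring
    · simp [hij, Ne.symm hij, he]; ring
  have hsq : ‖x‖ ^ 2 = ∑ i, x i ^ 2 := by
    rw [EuclideanSpace.norm_sq_eq]; simp
  have h4 : sphLap f x = ‖x‖ ^ 2 * (∑ i, H (e i) (e i)) - H x x + (L x - n * L x) := by
    have s1 : ∑ i, ∑ j, x i ^ 2 * H (e j) (e j) = ‖x‖ ^ 2 * ∑ i, H (e i) (e i) := by
      rw [hsq, Finset.sum_mul_sum]
    have s2 : ∑ i, ∑ j, x j ^ 2 * H (e i) (e i) = ‖x‖ ^ 2 * ∑ i, H (e i) (e i) := by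
      rw [Finset.sum_comm, s1]
    have s3 : ∑ i, ∑ j, 2 * (x i * x j * H (e i) (e j)) = 2 * H x x := by
      rw [bilin_eq_sum H x]
      simp only [Finset.mul_sum, he]
    have s4 : ∑ i, ∑ j, (if i = j then x i * L (e j) + x j * L (e i) else 0) = 2 * L x := by
      simp only [Finset.sum_ite_eq, Finset.mem_univ, if_true, hLx, Finset.mul_sum, two_mul]
    have s5 : ∑ i : Fin n, ∑ j : Fin n, x j * L (e j) = n * L x := by
      simp [hLx]
    have s6 : ∑ i : Fin n, ∑ j : Fin n, x i * L (e i) = n * L x := by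
      rw [Finset.sum_comm, s5]
    have s : ∑ i, ∑ j, rot i j (rot i j f) x =
        (‖x‖ ^ 2 * (∑ i, H (e i) (e i)) + ‖x‖ ^ 2 * (∑ i, H (e i) (e i)) - 2 * H x x) +
          (2 * L x - (n * L x + n * L x)) := by
      rw [← s3, ← s4]
      nth_rw 1 [← s1]
      rw [← s2]
      nth_rw 1 [← s5]
      rw [← s6]
      simp only [h3, Finset.sum_add_distrib, Finset.sum_sub_distrib]
    rw [sphLap_eq]
    simp only [Subalgebra.coe_smul, Pi.smul_apply, coe_sum_apply, s, smul_eq_mul]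
    ring
  have h5 : lap n f x = ∑ i, H (e i) (e i) := by
    simp [lap, iteratedFDeriv_two_apply, hH, he]
  rw [op_apply, h1, h2, h4, h5]
  ring

lemma lap_npow_mul (s : ℝ) (f : PSmooth n) {x : EuclideanSpace ℝ (Fin n)} (hx : x ≠ 0) :
    lap n (npow (-s) * f : PSmooth n) x =
      (npow (-(s + 2)) * op (n - 2 - 2 * s) (-(s * (n - 2 - s))) f : PSmooth n) x := by
  have h := op_eq_norm_sq_mul_lap (npow (-s) * f) hx
  have hn : 0 < ‖x‖ := norm_pos_iff.2 hx
  rw [op_npow_mul] at h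
  have e : ‖x‖ ^ (-s) = ‖x‖ ^ 2 * ‖x‖ ^ (-(s + 2)) := by
    rw [← Real.rpow_natCast ‖x‖ 2, ← Real.rpow_add hn]; congr 1; push_cast; ring
  simp only [Subalgebra.coe_mul, Pi.mul_apply, npow_apply] at h ⊢
  rw [e, mul_assoc] at h
  rw [← mul_left_cancel₀ (pow_pos hn 2).ne' h]
  congr 3
  ring_nf

lemma lap_congr {f g : EuclideanSpace ℝ (Fin n) → ℝ} {x : EuclideanSpace ℝ (Fin n)}
    (h : f =ᶠ[𝓝 x] g) : lap n f x = lap n g x := by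
  simp only [lap, (Filter.EventuallyEq.iteratedFDeriv ℝ h 2).eq_of_nhds]

lemma lap_lap_npow_mul (s : ℝ) (f : PSmooth n) {x : EuclideanSpace ℝ (Fin n)} (hx : x ≠ 0) :
    lap n (lap n (npow (-s) * f : PSmooth n)) x =
      (npow (-(s + 4)) * op (n - 6 - 2 * s) (-((s + 2) * (n - 4 - s)))
        (op (n - 2 - 2 * s) (-(s * (n - 2 - s))) f) : PSmooth n) x := by
  have h : lap n (npow (-s) * f : PSmooth n) =ᶠ[𝓝 x]
      (npow (-(s + 2)) * op (n - 2 - 2 * s) (-(s * (n - 2 - s))) f : PSmooth n) :=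
    eventually_of_mem (isOpen_compl_singleton.mem_nhds hx) fun y hy => lap_npow_mul s f hy
  rw [lap_congr h, lap_npow_mul _ _ hx]
  ring_nf

end PSmooth

end

noncomputable section

namespace PSmooth

variable {n : ℕ}

lemma euler_pow_apply (f : PSmooth n) (k : ℕ) (x : EuclideanSpace ℝ (Fin n)) :
    euler (f ^ (k + 1)) x = (k + 1) * f x ^ k * euler f x := by
  rw [Derivation.leibniz_pow]
  simp
  ring

lemma euler_euler_pow_apply (f : PSmooth n) (k : ℕ) (x : EuclideanSpace ℝ (Fin n)) :
    euler (euler (f ^ (k + 2))) x =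
      (k + 2) * ((k + 1) * f x ^ k * euler f x ^ 2 + f x ^ (k + 1) * euler (euler f) x) := by
  rw [Derivation.leibniz_pow]
  simp only [map_nsmul, smul_eq_mul, Derivation.leibniz, show k + 2 - 1 = k + 1 from rfl]
  simp [show (2 : PSmooth n) x = 2 from rfl]
  ring

lemma op_mul_apply {g : PSmooth n} (hg : IsRadial g) (b c : ℝ) (f : PSmooth n)
    (x : EuclideanSpace ℝ (Fin n)) :
    op b c (g * f) x = g x * op b c f x + 2 * euler g x * euler f x +
      (euler (euler g) x + b * euler g x) * f x := by
  simp only [op_apply, sphLap_radial_mul hg, Derivation.leibniz, smul_eq_mul, map_add]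
  simp
  ring

/-- The quadratic expression `(D²f)² + |∇_S Df|² + (Λf)² + (Df)² + |∇_S f|² + f²`. -/
def energy (f : PSmooth n) : PSmooth n :=
  euler (euler f) ^ 2 + sphGrad (euler f) (euler f) + sphLap f ^ 2 + euler f ^ 2 +
    sphGrad f f + f ^ 2

lemma energy_apply (f : PSmooth n) (x : EuclideanSpace ℝ (Fin n)) :
    energy f x = euler (euler f) x ^ 2 + sphGrad (euler f) (euler f) x + sphLap f x ^ 2 +
      euler f x ^ 2 + sphGrad f f x + f x ^ 2 := rfl

lemma energy_nonneg (f : PSmooth n) (x : EuclideanSpace ℝ (Fin n)) : 0 ≤ energy f x := by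
  rw [energy_apply]
  have := sphGrad_self_nonneg f x
  have := sphGrad_self_nonneg (euler f) x
  positivity

lemma pow_mem_annular {f : PSmooth n} (hf : f ∈ annular n) {k : ℕ} (hk : 0 < k) :
    f ^ k ∈ annular n := Ideal.pow_mem_of_mem _ hf k hk

lemma energy_mem_annular {f : PSmooth n} (hf : f ∈ annular n) : energy f ∈ annular n := by
  have h := euler_mem_annular hf
  exact add_mem (add_mem (add_mem (add_mem (add_mem
    (pow_mem_annular (euler_mem_annular h) two_pos) (sphGrad_mem_annular h _))
    (pow_mem_annular (sphLap_mem_annular hf) two_pos)) (pow_mem_annular h two_pos))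
    (sphGrad_mem_annular hf _)) (pow_mem_annular hf two_pos)

variable [NeZero n]

lemma mul_sphLap_add_sphGrad_mem_null' (f : PSmooth n) {g : PSmooth n} (hg : g ∈ annular n) :
    f * sphLap g + sphGrad f g ∈ null n := by
  rw [mul_sphLap_add_sphGrad]
  refine Submodule.smul_mem _ _ (Submodule.sum_mem _ fun i _ => Submodule.sum_mem _ fun j _ => ?_)
  have h : f * rot i j g ∈ annular n := Ideal.mul_mem_left _ _ (rot_mem_annular i j hg)
  exact ⟨rot_mem_annular i j h, pInt_rot i j h⟩

lemma mul_op_sub_mul_op_mem_null (b c : ℝ) {f : PSmooth n} (hf : f ∈ annular n) (g : PSmooth n) :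
    g * op b c f - f * op (-b) c g ∈ null n := by
  have h1 : euler (g * euler f - f * euler g) ∈ null n :=
    euler_mem_null (Ideal.sub_mem _ (Ideal.mul_mem_left _ _ (euler_mem_annular hf))
      (Ideal.mul_mem_right _ _ hf))
  have h2 : euler (f * g) ∈ null n := euler_mem_null (Ideal.mul_mem_right _ _ hf)
  have h3 := mul_sphLap_add_sphGrad_mem_null hf g
  have h4 := mul_sphLap_add_sphGrad_mem_null' g hf
  have : g * op b c f - f * op (-b) c g =
      euler (g * euler f - f * euler g) + b • euler (f * g) +
        ((g * sphLap f + sphGrad g f) - (f * sphLap g + sphGrad f g)) := by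
    rw [sphGrad_comm g f, op_eq, op_eq]
    ext x
    simp
    ring
  rw [this]
  exact add_mem (add_mem h1 (Submodule.smul_mem _ _ h2)) (sub_mem h4 h3)

lemma pInt_op_sq {c : ℝ} {f : PSmooth n} (hf : f ∈ annular n) :
    pInt (op 2 (-c) f ^ 2) = pInt (euler (euler f) ^ 2 + (2 : ℝ) • sphGrad (euler f) (euler f) +
      sphLap f ^ 2 + (2 * c + 4) • euler f ^ 2 + (2 * c) • sphGrad f f + c ^ 2 • f ^ 2) := by
  have hf1 := euler_mem_annular hf
  have hf2 := euler_mem_annular hf1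
  have n1 : euler (euler f ^ 2) ∈ null n := euler_mem_null (pow_mem_annular hf1 two_pos)
  have n2 : euler (f * euler f) ∈ null n := euler_mem_null (Ideal.mul_mem_right _ _ hf)
  have n3 := mul_sphLap_add_sphGrad_mem_null hf2 f
  have n4 : euler (sphGrad (euler f) f) ∈ null n := euler_mem_null (sphGrad_mem_annular hf1 f)
  have n5 : euler (f ^ 2) ∈ null n := euler_mem_null (pow_mem_annular hf two_pos)
  have n6 := mul_sphLap_add_sphGrad_mem_null hf1 f
  have n7 : euler (sphGrad f f) ∈ null n := euler_mem_null (sphGrad_mem_annular hf f)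
  have n8 := mul_sphLap_add_sphGrad_mem_null hf f
  have e : op 2 (-c) f ^ 2 = (euler (euler f) ^ 2 + (2 : ℝ) • sphGrad (euler f) (euler f) +
      sphLap f ^ 2 + (2 * c + 4) • euler f ^ 2 + (2 * c) • sphGrad f f + c ^ 2 • f ^ 2) +
      ((2 : ℝ) • euler (euler f ^ 2) - (2 * c) • euler (f * euler f) +
        (2 : ℝ) • (euler (euler f) * sphLap f + sphGrad (euler (euler f)) f) -
        (2 : ℝ) • euler (sphGrad (euler f) f) - (2 * c) • euler (f ^ 2) +
        (4 : ℝ) • (euler f * sphLap f + sphGrad (euler f) f) -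
        (2 : ℝ) • euler (sphGrad f f) - (2 * c) • (f * sphLap f + sphGrad f f)) := by
    rw [euler_sphGrad, euler_sphGrad, sphGrad_comm f (euler f), op_eq]
    ext x
    simp [pow_two]
    ring
  have hA : euler (euler f) ^ 2 + (2 : ℝ) • sphGrad (euler f) (euler f) +
      sphLap f ^ 2 + (2 * c + 4) • euler f ^ 2 + (2 * c) • sphGrad f f + c ^ 2 • f ^ 2
        ∈ annular n :=
    add_mem (add_mem (add_mem (add_mem (add_mem (pow_mem_annular hf2 two_pos)
      (smul_mem_annular _ (sphGrad_mem_annular hf1 _)))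
      (pow_mem_annular (sphLap_mem_annular hf) two_pos))
      (smul_mem_annular _ (pow_mem_annular hf1 two_pos)))
      (smul_mem_annular _ (sphGrad_mem_annular hf _)))
      (smul_mem_annular _ (pow_mem_annular hf two_pos))
  have hz : _ ∈ null n := (sub_mem (sub_mem (add_mem (sub_mem (sub_mem (add_mem (sub_mem
    (Submodule.smul_mem _ (2 : ℝ) n1) (Submodule.smul_mem _ (2 * c) n2))
    (Submodule.smul_mem _ (2 : ℝ) n3)) (Submodule.smul_mem _ (2 : ℝ) n4))
    (Submodule.smul_mem _ (2 * c) n5)) (Submodule.smul_mem _ (4 : ℝ) n6))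
    (Submodule.smul_mem _ (2 : ℝ) n7)) (Submodule.smul_mem _ (2 * c) n8))
  rw [e, pInt_add hA hz.1, hz.2, add_zero]

lemma pInt_energy_le {c : ℝ} (hc : 1 ≤ c) {f : PSmooth n} (hf : f ∈ annular n) :
    pInt (energy f) ≤ pInt (op 2 (-c) f ^ 2) := by
  have hf1 := euler_mem_annular hf
  have hf2 := euler_mem_annular hf1
  rw [pInt_op_sq hf]
  refine pInt_mono (energy_mem_annular hf) ?_ fun x _ => ?_
  · exact add_mem (add_mem (add_mem (add_mem (add_mem (pow_mem_annular hf2 two_pos)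
      (smul_mem_annular _ (sphGrad_mem_annular hf1 _)))
      (pow_mem_annular (sphLap_mem_annular hf) two_pos))
      (smul_mem_annular _ (pow_mem_annular hf1 two_pos)))
      (smul_mem_annular _ (sphGrad_mem_annular hf _)))
      (smul_mem_annular _ (pow_mem_annular hf two_pos))
  · have h1 := sphGrad_self_nonneg f x
    have h2 := sphGrad_self_nonneg (euler f) x
    have h3 : 0 ≤ (c - 1) * sphGrad f f x := mul_nonneg (by linarith) h1
    have h4 : 0 ≤ (c - 1) * euler f x ^ 2 := mul_nonneg (by linarith) (sq_nonneg _)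
    have h5 : 0 ≤ (c ^ 2 - 1) * f x ^ 2 := mul_nonneg (by nlinarith) (sq_nonneg _)
    rw [energy_apply]
    simp
    nlinarith [sq_nonneg (euler f x)]

end PSmooth

end

noncomputable section

namespace PSmooth

variable {n : ℕ}

/-- A radial cutoff function with values in `[0, 1]`, supported in an annulus, whose first two Euler
derivatives are bounded by `d`. -/
structure IsCutoff (d : ℝ) (χ : PSmooth n) : Prop where
  isRadial : IsRadial χ
  mem_annular : χ ∈ annular n
  nonneg : ∀ x ≠ 0, 0 ≤ χ x
  le_one : ∀ x ≠ 0, χ x ≤ 1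
  abs_euler_le : ∀ x ≠ 0, |euler χ x| ≤ d
  abs_euler_euler_le : ∀ x ≠ 0, |euler (euler χ) x| ≤ d

lemma commutator_bound {K X X1 X2 a b d A W ε : ℝ} (hK : 1 ≤ K) (hX0 : 0 ≤ X) (hX1 : X ≤ 1)
    (hd0 : 0 ≤ d) (hd1 : d ≤ 1) (h1 : |X1| ≤ d) (h2 : |X2| ≤ d) (hε : 0 < ε)
    (hW : W = 2 * K * X1 * b + K * ((K - 1) * X1 ^ 2 + X * X2 + 2 * X * X1) * a) :
    W ^ 2 - 2 * (K ^ 2 * X1 ^ 2 * a * (A - W)) ≤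
      ε * A ^ 2 + 16 * K ^ 2 * (d ^ 2 * b ^ 2) +
        (4 * K ^ 2 * (K + 2) ^ 2 + K ^ 4 + K ^ 4 / ε) * (d ^ 2 * a ^ 2) := by
  have hX1sq : X1 ^ 2 ≤ d ^ 2 := sq_le_sq' (by linarith [(abs_le.1 h1).1]) (abs_le.1 h1).2
  have hm : |(K - 1) * X1 ^ 2 + X * X2 + 2 * X * X1| ≤ (K + 2) * d := by
    have e1 : |(K - 1) * X1 ^ 2| ≤ (K - 1) * d := by
      rw [abs_mul, abs_of_nonneg (by linarith : 0 ≤ K - 1), abs_of_nonneg (sq_nonneg X1)]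
      exact mul_le_mul_of_nonneg_left (by nlinarith) (by linarith)
    have e2 : |X * X2| ≤ d := by
      rw [abs_mul, abs_of_nonneg hX0]
      nlinarith [abs_nonneg X2]
    have e3 : |2 * X * X1| ≤ 2 * d := by
      rw [abs_mul, abs_mul, abs_of_nonneg hX0, abs_two]
      nlinarith [abs_nonneg X1]
    calc _ ≤ |(K - 1) * X1 ^ 2 + X * X2| + |2 * X * X1| := abs_add_le _ _
      _ ≤ |(K - 1) * X1 ^ 2| + |X * X2| + |2 * X * X1| := by gcongr; exact abs_add_le _ _
      _ ≤ (K + 2) * d := by linarith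
  have hm2 : ((K - 1) * X1 ^ 2 + X * X2 + 2 * X * X1) ^ 2 ≤ ((K + 2) * d) ^ 2 :=
    sq_le_sq' (by linarith [(abs_le.1 hm).1]) (abs_le.1 hm).2
  set m := (K - 1) * X1 ^ 2 + X * X2 + 2 * X * X1
  have hW2 : W ^ 2 ≤ 8 * K ^ 2 * (d ^ 2 * b ^ 2) + 2 * K ^ 2 * (K + 2) ^ 2 * (d ^ 2 * a ^ 2) := by
    have e1 : W ^ 2 ≤ 8 * K ^ 2 * (X1 ^ 2 * b ^ 2) + 2 * K ^ 2 * (m ^ 2 * a ^ 2) := by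
      rw [hW]; nlinarith [sq_nonneg (2 * K * X1 * b - K * m * a)]
    have e2 : X1 ^ 2 * b ^ 2 ≤ d ^ 2 * b ^ 2 := by gcongr
    have e3 : m ^ 2 * a ^ 2 ≤ ((K + 2) * d) ^ 2 * a ^ 2 := by gcongr
    nlinarith [sq_nonneg K]
  have hX14 : X1 ^ 4 * a ^ 2 ≤ d ^ 2 * a ^ 2 := by
    have : X1 ^ 4 ≤ d ^ 2 := by
      have : X1 ^ 2 * X1 ^ 2 ≤ d ^ 2 * 1 :=
        mul_le_mul hX1sq (hX1sq.trans (by nlinarith)) (sq_nonneg _) (sq_nonneg _)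
      linarith [show X1 ^ 4 = X1 ^ 2 * X1 ^ 2 by ring]
    gcongr
  have e4 : -(2 * (K ^ 2 * X1 ^ 2 * a * A)) ≤ ε * A ^ 2 + K ^ 4 / ε * (X1 ^ 4 * a ^ 2) := by
    have : 0 ≤ (ε * A + K ^ 2 * X1 ^ 2 * a) ^ 2 / ε := by positivity
    have e : (ε * A + K ^ 2 * X1 ^ 2 * a) ^ 2 / ε =
      ε * A ^ 2 + 2 * (K ^ 2 * X1 ^ 2 * a * A) + K ^ 4 / ε * (X1 ^ 4 * a ^ 2) := by
      field_simp
      ring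
    linarith
  have e5 : 2 * (K ^ 2 * X1 ^ 2 * a * W) ≤ W ^ 2 + K ^ 4 * (X1 ^ 4 * a ^ 2) := by
    nlinarith [sq_nonneg (W - K ^ 2 * X1 ^ 2 * a)]
  have e6 : K ^ 4 / ε * (X1 ^ 4 * a ^ 2) ≤ K ^ 4 / ε * (d ^ 2 * a ^ 2) := by gcongr
  have e7 : K ^ 4 * (X1 ^ 4 * a ^ 2) ≤ K ^ 4 * (d ^ 2 * a ^ 2) := by gcongr
  linarith

lemma gradient_bound {K X X1 X2 a b d f y z ε : ℝ} (hK : 1 ≤ K) (hX0 : 0 ≤ X) (hX1 : X ≤ 1)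
    (hd0 : 0 ≤ d) (hd1 : d ≤ 1) (h1 : |X1| ≤ d) (h2 : |X2| ≤ d) (hε : 0 < ε)
    (hf : f = y + 2 * K * X1 * b + K * ((K - 1) * X1 ^ 2 + X * X2) * a)
    (hz : z = b ^ 2 + a * y + (2 * K - 2) * X1 * (a * b)) :
    d ^ 2 * b ^ 2 ≤ 2 * (d ^ 2 * z) + 2 * ε * f ^ 2 +
      (1 / (2 * ε) + 20 * K ^ 2) * (d ^ 2 * a ^ 2) := by
  have hd2 : d ^ 2 ≤ 1 := by nlinarith
  have hm : |(K - 1) * X1 ^ 2 + X * X2| ≤ K := by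
    have e1 : |(K - 1) * X1 ^ 2| ≤ K - 1 := by
      have hX1sq : X1 ^ 2 ≤ 1 :=
        (sq_le_sq' (by linarith [(abs_le.1 h1).1]) (abs_le.1 h1).2).trans hd2
      rw [abs_mul, abs_of_nonneg (by linarith : 0 ≤ K - 1), abs_of_nonneg (sq_nonneg X1)]
      nlinarith
    have e2 : |X * X2| ≤ 1 := by
      rw [abs_mul, abs_of_nonneg hX0]
      nlinarith [abs_nonneg X2]
    calc _ ≤ |(K - 1) * X1 ^ 2| + |X * X2| := abs_add_le _ _
      _ ≤ K := by linarith
  set m := (K - 1) * X1 ^ 2 + X * X2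
  have hX1' : |X1| ≤ 1 := h1.trans hd1
  have e0 : b ^ 2 = z - a * f + 2 * X1 * (a * b) + K * m * a ^ 2 := by rw [hz, hf]; ring
  have e1 : 2 * X1 * (a * b) ≤ b ^ 2 / 2 + 2 * a ^ 2 := by
    have h3 : X1 * (a * b) ≤ |a * b| := by
      calc X1 * (a * b) ≤ |X1 * (a * b)| := le_abs_self _
        _ = |X1| * |a * b| := abs_mul _ _
        _ ≤ 1 * |a * b| := by gcongr
        _ = _ := one_mul _
    have h4 : |a * b| ≤ b ^ 2 / 4 + a ^ 2 := by
      rw [abs_le]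
      constructor <;> nlinarith [sq_nonneg (b / 2 - a), sq_nonneg (b / 2 + a)]
    linarith
  have e2 : K * m * a ^ 2 ≤ K ^ 2 * a ^ 2 := by
    have : K * m ≤ K ^ 2 := by nlinarith [(abs_le.1 hm).2]
    gcongr
  have e3 : b ^ 2 ≤ 2 * z - 2 * (a * f) + (4 + 2 * K ^ 2) * a ^ 2 := by linarith
  have e4 : d ^ 2 * b ^ 2 ≤ d ^ 2 * (2 * z - 2 * (a * f) + (4 + 2 * K ^ 2) * a ^ 2) := by gcongr
  have e5 : -(2 * d ^ 2 * (a * f)) ≤ 2 * ε * f ^ 2 + 1 / (2 * ε) * (d ^ 4 * a ^ 2) := by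
    have : 0 ≤ (2 * ε * f + d ^ 2 * a) ^ 2 / (2 * ε) := by positivity
    have e : (2 * ε * f + d ^ 2 * a) ^ 2 / (2 * ε) =
      2 * ε * f ^ 2 + 2 * d ^ 2 * (a * f) + 1 / (2 * ε) * (d ^ 4 * a ^ 2) := by
      field_simp
      ring
    linarith
  have e6 : 1 / (2 * ε) * (d ^ 4 * a ^ 2) ≤ 1 / (2 * ε) * (d ^ 2 * a ^ 2) := by
    have : d ^ 4 ≤ d ^ 2 := by nlinarith [sq_nonneg d]
    gcongr
  have e7 : 0 ≤ (K ^ 2 - 1) * (d ^ 2 * a ^ 2) := mul_nonneg (by nlinarith) (by positivity)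
  nlinarith [mul_nonneg (sq_nonneg d) (sq_nonneg a), e7]

end PSmooth

end

noncomputable section

namespace PSmooth

variable {n : ℕ} [NeZero n]

lemma pInt_op_mul_cutoff_le {k : ℕ} (hk : 0 < k) {c p : ℝ} (hc : 1 ≤ c) (hp : 1 < p) :
    ∃ C, ∀ (v G χ : PSmooth n) (d : ℝ),
      (∀ x ≠ 0, op (-2) (-c) (op 2 (-c) v) x = G x) → 0 ≤ d → d ≤ 1 → IsCutoff d χ →
      p * pInt ((χ ^ (k + 2)) ^ 2 * (G * v)) ≤ pInt (op 2 (-c) (χ ^ (k + 2) * v) ^ 2) →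
      pInt (op 2 (-c) (χ ^ (k + 2) * v) ^ 2) + pInt ((χ ^ (k + 2)) ^ 2 * (G * v)) ≤
        C * (d ^ 2 * pInt ((χ ^ k * v) ^ 2)) := by
  set K : ℝ := k + 2 with hKdef
  have hK : 1 ≤ K := by rw [hKdef]; linarith [(Nat.cast_nonneg k : (0 : ℝ) ≤ k)]
  set M : ℝ := (p + 1) / (p - 1) with hM
  have hp1 : 0 < p - 1 := by linarith
  have hM0 : 0 < M := by positivity
  set ε : ℝ := 1 / (4 * M) with hε
  have hε0 : 0 < ε := by positivity
  set ε' : ℝ := 1 / (128 * K ^ 2 * M) with hε'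
  have hε'0 : 0 < ε' := by positivity
  set C2 : ℝ := 4 * K ^ 2 * (K + 2) ^ 2 + K ^ 4 + K ^ 4 / ε with hC2
  set C3 : ℝ := 1 / (2 * ε') + 20 * K ^ 2 with hC3
  refine ⟨4 * M * (C2 + 16 * K ^ 2 * C3), fun v G χ d hG hd0 hd1 hχ hstab => ?_⟩
  have hχm := hχ.mem_annular
  have hηm : χ ^ (k + 2) ∈ annular n := pow_mem_annular hχm (by omega)
  have hθm : χ ^ k ∈ annular n := pow_mem_annular hχm hk
  have hfm : χ ^ (k + 2) * v ∈ annular n := Ideal.mul_mem_right _ _ hηm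
  have hAm : op 2 (-c) (χ ^ (k + 2) * v) ^ 2 ∈ annular n :=
    pow_mem_annular (op_mem_annular _ _ hfm) two_pos
  have hJm : (χ ^ (k + 2)) ^ 2 * (G * v) ∈ annular n :=
    Ideal.mul_mem_right _ _ (pow_mem_annular hηm two_pos)
  have ham : (χ ^ k * v) ^ 2 ∈ annular n :=
    pow_mem_annular (Ideal.mul_mem_right _ _ hθm) two_pos
  have hbm : (χ ^ (k + 1) * euler v) ^ 2 ∈ annular n :=
    pow_mem_annular (Ideal.mul_mem_right _ _ (pow_mem_annular hχm (by omega))) two_pos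
  have hf2m : euler (euler (χ ^ (k + 2) * v)) ^ 2 ∈ annular n :=
    pow_mem_annular (euler_mem_annular (euler_mem_annular hfm)) two_pos
  have hη1 : ∀ x, euler (χ ^ (k + 2)) x = K * χ x ^ (k + 1) * euler χ x := by
    intro x; rw [euler_pow_apply]; push_cast; ring
  have hη2 : ∀ x, euler (euler (χ ^ (k + 2))) x =
      K * ((K - 1) * χ x ^ k * euler χ x ^ 2 + χ x ^ (k + 1) * euler (euler χ) x) := by
    intro x; rw [euler_euler_pow_apply, hKdef]; ring
  -- the commutator estimate
  have hnull : op 2 (-c) v * op 2 (-c) ((χ ^ (k + 2)) ^ 2 * v) -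
      ((χ ^ (k + 2)) ^ 2 * v) * op (-2) (-c) (op 2 (-c) v) ∈ null n :=
    mul_op_sub_mul_op_mem_null 2 (-c)
      (Ideal.mul_mem_right _ _ (pow_mem_annular hηm two_pos)) _
  have hrad : IsRadial (χ ^ (k + 2)) := hχ.isRadial.pow _
  have step1 : pInt (op 2 (-c) (χ ^ (k + 2) * v) ^ 2) ≤
      pInt ((χ ^ (k + 2)) ^ 2 * (G * v)) + (ε * pInt (op 2 (-c) (χ ^ (k + 2) * v) ^ 2) +
        16 * K ^ 2 * (d ^ 2 * pInt ((χ ^ (k + 1) * euler v) ^ 2)) +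
        C2 * (d ^ 2 * pInt ((χ ^ k * v) ^ 2))) := by
    have := pInt_le_of_le_add_null hAm (g := (χ ^ (k + 2)) ^ 2 * (G * v) +
      (ε • op 2 (-c) (χ ^ (k + 2) * v) ^ 2 +
        (16 * K ^ 2 * d ^ 2) • (χ ^ (k + 1) * euler v) ^ 2 +
        (C2 * d ^ 2) • (χ ^ k * v) ^ 2)) (add_mem hJm (add_mem (add_mem
          (smul_mem_annular _ hAm) (smul_mem_annular _ hbm)) (smul_mem_annular _ ham))) hnull
      fun x hx => ?_
    · rw [pInt_add hJm (add_mem (add_mem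
          (smul_mem_annular _ hAm) (smul_mem_annular _ hbm)) (smul_mem_annular _ ham)),
        pInt_add (add_mem (smul_mem_annular _ hAm) (smul_mem_annular _ hbm))
          (smul_mem_annular _ ham), pInt_add (smul_mem_annular _ hAm) (smul_mem_annular _ hbm),
        pInt_smul, pInt_smul, pInt_smul] at this
      linarith
    · have hb := commutator_bound (K := K) (X := χ x) (X1 := euler χ x)
        (X2 := euler (euler χ) x) (a := χ x ^ k * v x) (b := χ x ^ (k + 1) * euler v x)
        (A := op 2 (-c) (χ ^ (k + 2) * v) x) (d := d) hK (hχ.nonneg x hx) (hχ.le_one x hx) hd0 hd1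
        (hχ.abs_euler_le x hx) (hχ.abs_euler_euler_le x hx) hε0 rfl
      have e1 := op_mul_apply hrad 2 (-c) v x
      have e2 := op_mul_apply (hrad.pow 2) 2 (-c) v x
      rw [hη1, hη2] at e1
      rw [euler_pow_apply _ 1, euler_euler_pow_apply _ 0, hη1, hη2] at e2
      have e3 := hG x hx
      simp only [Subalgebra.coe_add, Subalgebra.coe_smul, Subalgebra.coe_mul, Subalgebra.coe_pow,
        AddSubgroupClass.coe_sub, Pi.add_apply, Pi.sub_apply, Pi.mul_apply, Pi.pow_apply,
        Pi.smul_apply, smul_eq_mul, e2, e3] at hb e1 ⊢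
      push_cast at hb e1 ⊢
      rw [← hC2] at hb
      refine le_trans (le_of_eq ?_) (add_le_add (add_le_add le_rfl (hb.trans (le_of_eq ?_))) le_rfl)
      · rw [e1]; ring
      · ring
  -- the gradient estimate
  have hz : euler (χ ^ k * χ ^ (k + 2) * (v * euler v)) ∈ null n :=
    euler_mem_null (Ideal.mul_mem_right _ _ (Ideal.mul_mem_right _ _ hθm))
  have step2 : d ^ 2 * pInt ((χ ^ (k + 1) * euler v) ^ 2) ≤
      2 * ε' * pInt (euler (euler (χ ^ (k + 2) * v)) ^ 2) +
        C3 * (d ^ 2 * pInt ((χ ^ k * v) ^ 2)) := by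
    have := pInt_le_of_le_add_null (f := d ^ 2 • (χ ^ (k + 1) * euler v) ^ 2)
      (g := (2 * ε') • euler (euler (χ ^ (k + 2) * v)) ^ 2 + (C3 * d ^ 2) • (χ ^ k * v) ^ 2)
      (smul_mem_annular _ hbm)
      (add_mem (smul_mem_annular _ hf2m) (smul_mem_annular _ ham))
      (Submodule.smul_mem _ (2 * d ^ 2) hz) fun x hx => ?_
    · rw [pInt_add (smul_mem_annular _ hf2m) (smul_mem_annular _ ham), pInt_smul, pInt_smul,
        pInt_smul] at this
      linarith
    · have e1 : euler (χ ^ k * χ ^ (k + 2) * (v * euler v)) x =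
          (2 * K - 2) * χ x ^ (2 * k + 1) * euler χ x * (v x * euler v x) +
            χ x ^ (2 * k + 2) * (euler v x ^ 2 + v x * euler (euler v) x) := by
        rw [← pow_add, show k + (k + 2) = (2 * k + 1) + 1 by ring, Derivation.leibniz]
        have := euler_pow_apply χ (2 * k + 1) x
        simp only [Derivation.leibniz, Subalgebra.coe_add, smul_eq_mul, Subalgebra.coe_mul,
          Pi.add_apply, Pi.mul_apply, this, Subalgebra.coe_pow, Pi.pow_apply]
        rw [hKdef]
        push_cast
        ring
      have e2 : euler (euler (χ ^ (k + 2) * v)) x = χ x ^ (k + 2) * euler (euler v) x +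
          2 * K * euler χ x * (χ x ^ (k + 1) * euler v x) +
          K * ((K - 1) * euler χ x ^ 2 + χ x * euler (euler χ) x) * (χ x ^ k * v x) := by
        simp only [Derivation.leibniz, map_add, smul_eq_mul, Subalgebra.coe_add,
          Subalgebra.coe_mul, Pi.add_apply, Pi.mul_apply, hη1, hη2, Subalgebra.coe_pow,
          Pi.pow_apply]
        ring
      have hb := gradient_bound (K := K) (X := χ x) (X1 := euler χ x)
        (X2 := euler (euler χ) x) (a := χ x ^ k * v x) (b := χ x ^ (k + 1) * euler v x)
        (d := d) hK (hχ.nonneg x hx) (hχ.le_one x hx) hd0 hd1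
        (hχ.abs_euler_le x hx) (hχ.abs_euler_euler_le x hx) hε'0 e2 rfl
      simp only [Subalgebra.coe_add, Subalgebra.coe_smul, Subalgebra.coe_mul, Subalgebra.coe_pow,
        Pi.add_apply, Pi.mul_apply, Pi.pow_apply, Pi.smul_apply, smul_eq_mul, e1]
      refine hb.trans (le_of_eq ?_)
      rw [hC3]
      ring
  have step3 : pInt (euler (euler (χ ^ (k + 2) * v)) ^ 2) ≤
      pInt (op 2 (-c) (χ ^ (k + 2) * v) ^ 2) := by
    refine le_trans (pInt_mono hf2m (energy_mem_annular hfm) fun x _ => ?_) (pInt_energy_le hc hfm)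
    have h1 := sphGrad_self_nonneg (χ ^ (k + 2) * v) x
    have h2 := sphGrad_self_nonneg (euler (χ ^ (k + 2) * v)) x
    rw [energy_apply, Subalgebra.coe_pow, Pi.pow_apply]
    have h3 := sq_nonneg (sphLap (χ ^ (k + 2) * v) x)
    have h4 := sq_nonneg (euler (χ ^ (k + 2) * v) x)
    have h5 := sq_nonneg ((χ ^ (k + 2) * v : PSmooth n) x)
    linarith
  have hA0 : 0 ≤ pInt (op 2 (-c) (χ ^ (k + 2) * v) ^ 2) :=
    pInt_nonneg hAm fun x _ => by simpa using sq_nonneg _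
  generalize pInt (op 2 (-c) (χ ^ (k + 2) * v) ^ 2) = A at *
  generalize pInt ((χ ^ (k + 2)) ^ 2 * (G * v)) = J at *
  generalize d ^ 2 * pInt ((χ ^ k * v) ^ 2) = B at *
  generalize d ^ 2 * pInt ((χ ^ (k + 1) * euler v) ^ 2) = Z at *
  generalize pInt (euler (euler (χ ^ (k + 2) * v)) ^ 2) = E at *
  have hZ : 16 * K ^ 2 * Z ≤ ε * A + 16 * K ^ 2 * C3 * B := by
    have e : 16 * K ^ 2 * (2 * ε') = ε := by rw [hε', hε]; field_simp; norm_num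
    calc 16 * K ^ 2 * Z ≤ 16 * K ^ 2 * (2 * ε' * A + C3 * B) := by
          gcongr
          exact step2.trans (by gcongr)
      _ = _ := by rw [← e]; ring
  have hE : A ≤ J + (2 * ε * A + (C2 + 16 * K ^ 2 * C3) * B) := by linarith
  set R := 2 * ε * A + (C2 + 16 * K ^ 2 * C3) * B with hR
  have hJR : (p - 1) * J ≤ R := by linarith
  have hJ : A + J ≤ M * R := by
    have h1 : J ≤ R / (p - 1) := by rw [le_div_iff₀ hp1]; linarith
    have h2 : M * R = R + 2 * (R / (p - 1)) := by rw [hM]; field_simp; ring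
    linarith
  have h2 : M * (2 * ε * A) = A / 2 := by rw [hε]; field_simp; norm_num
  rw [hR, mul_add, h2] at hJ
  rcases le_total 0 J with hJ0 | hJ0
  · linarith
  · have hM1 : 1 ≤ M := by rw [hM, le_div_iff₀ hp1]; linarith
    have h3 : 2 * ε * A ≤ A / 2 := by
      rw [← h2]
      exact le_mul_of_one_le_left (by positivity) hM1
    have h4 : (C2 + 16 * K ^ 2 * C3) * B ≤ M * ((C2 + 16 * K ^ 2 * C3) * B) :=
      le_mul_of_one_le_left (by linarith) hM1
    linarith

end PSmooth

end

noncomputable section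

namespace PSmooth

lemma pow_mul_sq_le {p ε : ℝ} (hp : 1 < p) (hε : 0 < ε) {k : ℕ} (hk : 0 < k)
    (hpk : 8 / (p - 1) ≤ 2 * k) {X s : ℝ} (hX0 : 0 ≤ X) (hX1 : X ≤ 1) :
    X ^ (2 * k) * s ^ 2 ≤
      ε * (X ^ (2 * k + 4) * (|s| ^ (p - 1) * s ^ 2)) + (1 / ε) ^ (2 / (p - 1)) := by
  have hp1 : 0 < p - 1 := by linarith
  have hs : 0 ≤ |s| ^ (p - 1) := Real.rpow_nonneg (abs_nonneg s) _
  have hC : 0 ≤ (1 / ε) ^ (2 / (p - 1)) := by positivity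
  rcases hX0.eq_or_lt with rfl | hX
  · simpa [hk.ne'] using hC
  by_cases h : 1 ≤ ε * (X ^ 4 * |s| ^ (p - 1))
  · have : 0 ≤ X ^ (2 * k) * s ^ 2 := by positivity
    calc X ^ (2 * k) * s ^ 2 ≤ X ^ (2 * k) * s ^ 2 * (ε * (X ^ 4 * |s| ^ (p - 1))) :=
          le_mul_of_one_le_right this h
      _ = ε * (X ^ (2 * k + 4) * (|s| ^ (p - 1) * s ^ 2)) := by ring
      _ ≤ _ := by linarith
  · push Not at h
    have h1 : X ^ 4 * |s| ^ (p - 1) ≤ 1 / ε := by rw [le_div_iff₀ hε]; linarith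
    have h2 : X ^ (2 * k) * s ^ 2 ≤ (X ^ 4 * |s| ^ (p - 1)) ^ (2 / (p - 1)) := by
      rw [Real.mul_rpow (by positivity) hs, ← Real.rpow_mul (abs_nonneg s),
        mul_div_cancel₀ _ hp1.ne', ← Real.rpow_natCast X 4, ← Real.rpow_mul hX0,
        Real.rpow_two, sq_abs, ← Real.rpow_natCast X (2 * k)]
      refine mul_le_mul_of_nonneg_right
        (Real.rpow_le_rpow_of_exponent_ge hX hX1 ?_) (sq_nonneg s)
      push_cast
      calc 4 * (2 / (p - 1)) = 8 / (p - 1) := by ring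
        _ ≤ 2 * k := hpk
    calc X ^ (2 * k) * s ^ 2 ≤ (1 / ε) ^ (2 / (p - 1)) :=
          h2.trans (Real.rpow_le_rpow (by positivity) h1 (by positivity))
      _ ≤ _ := le_add_of_nonneg_left (by positivity)

variable {n : ℕ} [NeZero n]

lemma pInt_energy_mul_cutoff_le {k : ℕ} (hk : 0 < k) {c p : ℝ} (hc : 1 ≤ c) (hp : 1 < p)
    (hpk : 8 / (p - 1) ≤ 2 * k) :
    ∃ C, 0 ≤ C ∧ ∀ (q w F χ h : PSmooth n) (d : ℝ),
      (∀ x ≠ 0, F x = |w x| ^ (p - 1) * w x) →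
      (∀ x ≠ 0, op (-2) (-c) (op 2 (-c) (q * w)) x = (q * F) x) →
      (∀ g ∈ annular n, p * pInt ((g * q) ^ 2 * (F * w)) ≤ pInt (op 2 (-c) (g * q * w) ^ 2)) →
      0 ≤ d → d ≤ 1 → IsCutoff d χ → h ∈ annular n → (∀ x ≠ 0, 0 ≤ h x) →
      (∀ x ≠ 0, χ x ≠ 0 → q x ^ 2 ≤ h x ∨ (q x * w x) ^ 2 ≤ h x) →
      pInt (energy (χ ^ (k + 2) * (q * w))) + pInt ((χ ^ (k + 2) * q) ^ 2 * (F * w)) ≤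
        C * (d ^ 2 * pInt h) := by
  obtain ⟨C, hC⟩ := pInt_op_mul_cutoff_le (n := n) hk hc hp
  set C₁ := max C 0 with hC₁
  have hC₁0 : 0 ≤ C₁ := le_max_right _ _
  set ε : ℝ := 1 / (2 * (C₁ + 1)) with hε
  have hε0 : 0 < ε := by positivity
  set D : ℝ := (1 / ε) ^ (2 / (p - 1)) + 1 with hD
  have hY0 : 0 ≤ (1 / ε) ^ (2 / (p - 1)) := by positivity
  have hD0 : 0 ≤ D := by positivity
  refine ⟨2 * C₁ * D, by positivity, fun q w F χ h d hF hG hstab hd0 hd1 hχ hh h0 hqh => ?_⟩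
  have hχm := hχ.mem_annular
  have hηm : χ ^ (k + 2) ∈ annular n := pow_mem_annular hχm (by omega)
  have hfm : χ ^ (k + 2) * (q * w) ∈ annular n := Ideal.mul_mem_right _ _ hηm
  have ham : (χ ^ k * (q * w)) ^ 2 ∈ annular n :=
    pow_mem_annular (Ideal.mul_mem_right _ _ (pow_mem_annular hχm hk)) two_pos
  have hJm : (χ ^ (k + 2) * q) ^ 2 * (F * w) ∈ annular n :=
    Ideal.mul_mem_right _ _ (pow_mem_annular (Ideal.mul_mem_right _ _ hηm) two_pos)
  have hFw : ∀ x ≠ 0, 0 ≤ F x * w x := by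
    intro x hx
    rw [hF x hx, mul_assoc]
    exact mul_nonneg (Real.rpow_nonneg (abs_nonneg _) _) (mul_self_nonneg _)
  have e1 : (χ ^ (k + 2)) ^ 2 * ((q * F) * (q * w)) = (χ ^ (k + 2) * q) ^ 2 * (F * w) := by ring
  have e2 : χ ^ (k + 2) * (q * w) = χ ^ (k + 2) * q * w := by ring
  have h1 := hC (q * w) (q * F) χ d hG hd0 hd1 hχ (by rw [e1, e2]; exact hstab _ hηm)
  rw [e1] at h1
  have h2 : pInt ((χ ^ k * (q * w)) ^ 2) ≤
      ε * pInt ((χ ^ (k + 2) * q) ^ 2 * (F * w)) + D * pInt h := by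
    rw [← pInt_smul, ← pInt_smul, ← pInt_add (smul_mem_annular _ hJm) (smul_mem_annular _ hh)]
    refine pInt_mono ham (add_mem (smul_mem_annular _ hJm) (smul_mem_annular _ hh)) fun x hx => ?_
    have hX0 := hχ.nonneg x hx
    have hX1 := hχ.le_one x hx
    simp only [Subalgebra.coe_add, Subalgebra.coe_smul, Subalgebra.coe_mul, Subalgebra.coe_pow,
      Pi.add_apply, Pi.mul_apply, Pi.pow_apply, Pi.smul_apply, smul_eq_mul]
    have hh0 := h0 x hx
    have hFwx := hFw x hx
    by_cases hX : χ x = 0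
    · rw [hX, zero_pow hk.ne']
      have : 0 ≤ ε * ((0 ^ (k + 2) * q x) ^ 2 * (F x * w x)) + D * h x := by positivity
      simpa using this
    have hJx : 0 ≤ ε * ((χ x ^ (k + 2) * q x) ^ 2 * (F x * w x)) := by positivity
    rcases hqh x hx hX with hq | hq
    · have hy := mul_le_mul_of_nonneg_left
        (pow_mul_sq_le (s := w x) hp hε0 hk hpk hX0 hX1) (sq_nonneg (q x))
      have hl : q x ^ 2 * (1 / ε) ^ (2 / (p - 1)) ≤ h x * D :=
        mul_le_mul hq (by rw [hD]; linarith) hY0 hh0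
      calc (χ x ^ k * (q x * w x)) ^ 2 = q x ^ 2 * (χ x ^ (2 * k) * w x ^ 2) := by ring
        _ ≤ _ := hy
        _ = ε * ((χ x ^ (k + 2) * q x) ^ 2 * (F x * w x)) +
            q x ^ 2 * (1 / ε) ^ (2 / (p - 1)) := by rw [hF x hx]; ring
        _ ≤ _ := by linarith
    · have hk1 : (χ x ^ k) ^ 2 ≤ 1 := pow_le_one₀ (by positivity) (pow_le_one₀ hX0 hX1)
      calc (χ x ^ k * (q x * w x)) ^ 2 = (χ x ^ k) ^ 2 * (q x * w x) ^ 2 := by ring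
        _ ≤ 1 * h x := mul_le_mul hk1 hq (sq_nonneg _) zero_le_one
        _ ≤ D * h x := by gcongr; rw [hD]; linarith
        _ ≤ _ := by linarith
  have hJ0 : 0 ≤ pInt ((χ ^ (k + 2) * q) ^ 2 * (F * w)) :=
    pInt_nonneg hJm fun x hx => by
      have := hFw x hx
      simp only [Subalgebra.coe_mul, Subalgebra.coe_pow, Pi.mul_apply, Pi.pow_apply]
      positivity
  have hI0 : 0 ≤ pInt ((χ ^ k * (q * w)) ^ 2) := pInt_nonneg ham fun x _ => by
    simpa using sq_nonneg _
  have hN := pInt_energy_le hc hfm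
  have hN0 : 0 ≤ pInt (energy (χ ^ (k + 2) * (q * w))) :=
    pInt_nonneg (energy_mem_annular hfm) fun x _ => energy_nonneg _ x
  have hh0 : 0 ≤ pInt h := pInt_nonneg hh h0
  generalize pInt (op 2 (-c) (χ ^ (k + 2) * (q * w)) ^ 2) = A at *
  generalize pInt ((χ ^ (k + 2) * q) ^ 2 * (F * w)) = J at *
  generalize pInt ((χ ^ k * (q * w)) ^ 2) = I at *
  generalize pInt (energy (χ ^ (k + 2) * (q * w))) = N at *
  generalize pInt h = H at *
  have hd2 : d ^ 2 ≤ 1 := pow_le_one₀ hd0 hd1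
  have h3 : C * (d ^ 2 * I) ≤ C₁ * (d ^ 2 * (ε * J + D * H)) := by
    have : C ≤ C₁ := le_max_left _ _
    gcongr
  have h4 : C₁ * (d ^ 2 * (ε * J)) ≤ J / 2 := by
    have : C₁ * ε ≤ 1 / 2 := by
      rw [hε, mul_one_div, div_le_iff₀ (by positivity)]; linarith
    calc C₁ * (d ^ 2 * (ε * J)) = (C₁ * ε) * (d ^ 2 * J) := by ring
      _ ≤ (1 / 2) * (1 * J) := by gcongr
      _ = J / 2 := by ring
  linarith [show C₁ * (d ^ 2 * (ε * J + D * H)) =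
    C₁ * (d ^ 2 * (ε * J)) + C₁ * D * (d ^ 2 * H) by ring,
    show 2 * C₁ * D * (d ^ 2 * H) = 2 * (C₁ * D * (d ^ 2 * H)) by ring]

end PSmooth

end

noncomputable section

namespace PSmooth

/-- A smooth function on `ℝ` which is `1` on `[-1, 1]` and vanishes outside `(-2, 2)`. -/
def stdBump : ContDiffBump (0 : ℝ) := ⟨1, 2, one_pos, one_lt_two⟩

lemma contDiff_stdBump_comp {h : ℝ → ℝ} (hh : ContDiff ℝ (⊤ : ℕ∞) h) (L T : ℝ) :
    ContDiff ℝ (⊤ : ℕ∞) fun t => h ((t - T) / L) :=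
  hh.comp ((contDiff_id.sub contDiff_const).div_const L)

lemma deriv_comp_sub_div {h : ℝ → ℝ} (hh : ContDiff ℝ (⊤ : ℕ∞) h) (L T : ℝ) :
    deriv (fun t => h ((t - T) / L)) = fun t => deriv h ((t - T) / L) * (1 / L) := by
  ext t
  have h1 : HasDerivAt h (deriv h ((t - T) / L)) ((t - T) / L) :=
    (hh.differentiable (by simp)).differentiableAt.hasDerivAt
  exact (h1.comp t (((hasDerivAt_id t).sub_const T).div_const L)).deriv

variable {n : ℕ}

/-- The radial cutoff function `x ↦ ρ ((log ‖x‖ - T) / L)` for the bump function `ρ`. -/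
def cut (L T : ℝ) : PSmooth n :=
  rad (fun t => stdBump ((t - T) / L)) (contDiff_stdBump_comp stdBump.contDiff L T)

lemma cut_apply (L T : ℝ) (x : EuclideanSpace ℝ (Fin n)) :
    (cut L T : PSmooth n) x = stdBump ((Real.log ‖x‖ - T) / L) := rfl

lemma cut_nonneg (L T : ℝ) (x : EuclideanSpace ℝ (Fin n)) : 0 ≤ (cut L T : PSmooth n) x :=
  stdBump.nonneg

lemma cut_le_one (L T : ℝ) (x : EuclideanSpace ℝ (Fin n)) : (cut L T : PSmooth n) x ≤ 1 :=
  stdBump.le_one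

lemma cut_eq_one {L T : ℝ} (hL : 0 < L) {x : EuclideanSpace ℝ (Fin n)}
    (hx : |Real.log ‖x‖ - T| ≤ L) : (cut L T : PSmooth n) x = 1 := by
  refine stdBump.one_of_mem_closedBall ?_
  rw [mem_closedBall, dist_zero_right, Real.norm_eq_abs, abs_div, abs_of_pos hL]
  exact div_le_one_of_le₀ hx hL.le

lemma abs_lt_of_cut_ne_zero {L T : ℝ} (hL : 0 < L) {x : EuclideanSpace ℝ (Fin n)}
    (hx : (cut L T : PSmooth n) x ≠ 0) : |Real.log ‖x‖ - T| < 2 * L := by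
  by_contra! h
  refine hx (stdBump.zero_of_le_dist ?_)
  rw [dist_zero_right, Real.norm_eq_abs, abs_div, abs_of_pos hL, le_div_iff₀ hL]
  exact h

lemma euler_euler_rad_apply (h : ℝ → ℝ) (hh : ContDiff ℝ (⊤ : ℕ∞) h)
    {x : EuclideanSpace ℝ (Fin n)} (hx : x ≠ 0) :
    euler (euler (rad h hh) : PSmooth n) x = deriv (deriv h) (Real.log ‖x‖) := by
  have hd : ContDiff ℝ (⊤ : ℕ∞) (deriv h) := (contDiff_infty_iff_deriv.1 hh).2
  have e : euler (euler (rad h hh) : PSmooth n) = euler (rad (deriv h) hd) :=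
    linDer_congr _ fun y hy => by rw [euler_rad_apply h hh hy, rad_apply]
  rw [e, euler_rad_apply _ hd hx]

lemma cut_mem_annular {L : ℝ} (hL : 0 < L) (T : ℝ) : (cut L T : PSmooth n) ∈ annular n := by
  refine ⟨Real.exp (T - 2 * L), Real.exp_pos _, Real.exp (T + 2 * L), fun x hx h => ?_⟩
  have hn : 0 < ‖x‖ := norm_pos_iff.2 hx
  have h1 := abs_lt.1 (abs_lt_of_cut_ne_zero hL h)
  rw [← Real.le_log_iff_exp_le hn, ← Real.log_le_iff_le_exp hn]
  constructor <;> linarith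

lemma exists_isCutoff_cut :
    ∃ B : ℝ, 0 ≤ B ∧ ∀ {n : ℕ} (L T : ℝ), 1 ≤ L → IsCutoff (B / L) (cut L T : PSmooth n) := by
  have hρ : ContDiff ℝ (⊤ : ℕ∞) stdBump := stdBump.contDiff
  have hρ1 : ContDiff ℝ (⊤ : ℕ∞) (deriv stdBump) := (contDiff_infty_iff_deriv.1 hρ).2
  have hρ2 : ContDiff ℝ (⊤ : ℕ∞) (deriv (deriv stdBump)) := (contDiff_infty_iff_deriv.1 hρ1).2
  obtain ⟨B₁, hB₁⟩ := stdBump.hasCompactSupport.deriv.exists_bound_of_continuous hρ1.continuous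
  obtain ⟨B₂, hB₂⟩ :=
    stdBump.hasCompactSupport.deriv.deriv.exists_bound_of_continuous hρ2.continuous
  have h1 : 0 ≤ B₁ := (norm_nonneg _).trans (hB₁ 0)
  have h2 : 0 ≤ B₂ := (norm_nonneg _).trans (hB₂ 0)
  refine ⟨B₁ + B₂, by positivity, fun {n} L T hL => ⟨isRadial_rad _ _,
    cut_mem_annular (by linarith) T, fun x _ => cut_nonneg L T x, fun x _ => cut_le_one L T x,
    fun x hx => ?_, fun x hx => ?_⟩⟩
  · have hL0 : 0 < L := by linarith
    rw [cut, euler_rad_apply _ _ hx, deriv_comp_sub_div hρ, abs_mul,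
      abs_of_pos (by positivity : 0 < 1 / L), mul_one_div]
    have := hB₁ ((Real.log ‖x‖ - T) / L)
    rw [Real.norm_eq_abs] at this
    gcongr
    linarith
  · have hL0 : 0 < L := by linarith
    have e : deriv (deriv fun t => stdBump ((t - T) / L)) =
        fun t => deriv (deriv stdBump) ((t - T) / L) * (1 / L) * (1 / L) := by
      rw [deriv_comp_sub_div hρ]
      ext t
      rw [deriv_mul_const_field, deriv_comp_sub_div hρ1]
    rw [cut, euler_euler_rad_apply _ _ hx, e]
    have := hB₂ ((Real.log ‖x‖ - T) / L)
    rw [Real.norm_eq_abs] at this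
    have hL1 : 1 / L ≤ 1 := by rw [div_le_one hL0]; exact hL
    rw [abs_mul, abs_of_pos (by positivity : 0 < 1 / L), abs_mul,
      abs_of_pos (by positivity : 0 < 1 / L)]
    calc |deriv (deriv stdBump) ((Real.log ‖x‖ - T) / L)| * (1 / L) * (1 / L)
        ≤ (B₁ + B₂) * 1 * (1 / L) := by gcongr; linarith
      _ = (B₁ + B₂) / L := by ring

variable [NeZero n]

lemma pInt_cut (L T : ℝ) : pInt (cut L T : PSmooth n) = pInt (cut L 0 : PSmooth n) := by
  have h := Measure.integral_comp_smul (volume : Measure (EuclideanSpace ℝ (Fin n)))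
    (fun x => ‖x‖ ^ (-(n : ℝ)) * (cut L 0 : PSmooth n) x) (Real.exp (-T))
  have hR : 0 < Real.exp (-T) := Real.exp_pos _
  have e : (fun x : EuclideanSpace ℝ (Fin n) => ‖Real.exp (-T) • x‖ ^ (-(n : ℝ)) *
      (cut L 0 : PSmooth n) (Real.exp (-T) • x)) = fun x =>
      (Real.exp (-T)) ^ (-(n : ℝ)) * (‖x‖ ^ (-(n : ℝ)) * (cut L T : PSmooth n) x) := by
    ext x
    rw [norm_smul, Real.norm_eq_abs, abs_of_pos hR, Real.mul_rpow hR.le (norm_nonneg _)]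
    rcases eq_or_ne x 0 with rfl | hx
    · have hn : -(n : ℝ) ≠ 0 := by simpa using NeZero.ne n
      simp [Real.zero_rpow hn]
    · rw [cut_apply, cut_apply, norm_smul, Real.norm_eq_abs, abs_of_pos hR,
        Real.log_mul hR.ne' (norm_ne_zero_iff.2 hx), Real.log_exp]
      ring_nf
  rw [e, integral_const_mul, finrank_euclideanSpace_fin, abs_of_pos (by positivity),
    Real.rpow_neg hR.le, Real.rpow_natCast, smul_eq_mul] at h
  exact mul_left_cancel₀ (by positivity) h

lemma pInt_le_sum {ι : Type*} (s : Finset ι) {f : PSmooth n} (hf : f ∈ annular n)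
    {g : ι → PSmooth n} (hg : ∀ i, g i ∈ annular n) (h : ∀ x ≠ 0, f x ≤ ∑ i ∈ s, g i x) :
    pInt f ≤ ∑ i ∈ s, pInt (g i) := by
  classical
  have hs : ∀ t : Finset ι, ∑ i ∈ t, g i ∈ annular n := fun t => Ideal.sum_mem _ fun i _ => hg i
  have e : ∀ t : Finset ι, pInt (∑ i ∈ t, g i) = ∑ i ∈ t, pInt (g i) := by
    intro t
    induction t using Finset.induction_on with
    | empty => simp [pInt]
    | insert a t ha ih => rw [Finset.sum_insert ha, Finset.sum_insert ha, pInt_add (hg a) (hs t), ih]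
  rw [← e]
  exact pInt_mono hf (hs s) fun x hx => (h x hx).trans (coe_sum_apply s g x).ge

/-- If `f` is supported where `|log ‖x‖| < 2 L` and is controlled near each unit interval of
`log ‖x‖`, then its integral grows at most linearly in `L`. -/
lemma pInt_le_of_unit_bound {f : PSmooth n} (hf : f ∈ annular n) {L M : ℝ} (hL : 1 ≤ L)
    (hM : 0 ≤ M) {g : ℤ → PSmooth n} (hg : ∀ T, g T ∈ annular n) (hg0 : ∀ T, ∀ x ≠ 0, 0 ≤ g T x)
    (hgM : ∀ T, pInt (g T) ≤ M) (hsupp : ∀ x ≠ 0, f x ≠ 0 → |Real.log ‖x‖| < 2 * L)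
    (h : ∀ x ≠ 0, ∀ T : ℤ, |Real.log ‖x‖ - T| ≤ 1 → f x ≤ g T x) :
    pInt f ≤ 9 * M * L := by
  set N : ℕ := ⌈2 * L⌉₊ with hN
  have hN1 : (N : ℝ) < 2 * L + 1 := Nat.ceil_lt_add_one (by linarith)
  have hN2 : 2 * L ≤ N := Nat.le_ceil _
  refine (pInt_le_sum (Finset.Icc (-(N : ℤ)) N) hf hg fun x hx => ?_).trans ?_
  · by_cases hfx : f x = 0
    · rw [hfx]
      exact Finset.sum_nonneg fun T _ => hg0 T x hx
    · have h1 := abs_lt.1 (hsupp x hx hfx)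
      have h2 := Int.floor_le (Real.log ‖x‖)
      have h3 := Int.lt_floor_add_one (Real.log ‖x‖)
      refine (h x hx ⌊Real.log ‖x‖⌋ (abs_le.2 ⟨by linarith, by linarith⟩)).trans
        (Finset.single_le_sum (f := fun T : ℤ => g T x) (fun T _ => hg0 T x hx) ?_)
      rw [Finset.mem_Icc]
      constructor
      · rw [Int.le_floor]; push_cast; linarith
      · have : (⌊Real.log ‖x‖⌋ : ℝ) < ((N : ℤ) : ℝ) := by push_cast; linarith
        exact (Int.cast_lt.1 this).le
  · refine (Finset.sum_le_sum fun T _ => hgM T).trans ?_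
    rw [Finset.sum_const, nsmul_eq_mul, Int.card_Icc]
    have : (((N : ℤ) + 1 - -(N : ℤ)).toNat : ℝ) = 2 * N + 1 := by
      rw [show (N : ℤ) + 1 - -(N : ℤ) = ((2 * N + 1 : ℕ) : ℤ) by push_cast; ring, Int.toNat_natCast]
      push_cast; ring
    rw [this]
    nlinarith

lemma exists_pInt_cut_le : ∃ M, 0 ≤ M ∧ ∀ L : ℝ, 1 ≤ L → pInt (cut L 0 : PSmooth n) ≤ M * L := by
  have hm : ∀ T : ℝ, (cut 1 T : PSmooth n) ∈ annular n := cut_mem_annular one_pos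
  have hM : 0 ≤ pInt (cut 1 0 : PSmooth n) := pInt_nonneg (hm 0) fun x _ => cut_nonneg _ _ x
  refine ⟨9 * pInt (cut 1 0 : PSmooth n), by positivity, fun L hL => ?_⟩
  refine pInt_le_of_unit_bound (cut_mem_annular (by linarith) 0) hL hM
    (g := fun T : ℤ => cut 1 T) (fun T => hm T) (fun T x _ => cut_nonneg _ _ x)
    (fun T => (pInt_cut 1 T).le) (fun x _ hx => ?_) fun x _ T hT => ?_
  · simpa using abs_lt_of_cut_ne_zero (by linarith) hx
  · rw [cut_eq_one one_pos hT]
    exact cut_le_one _ _ x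

end PSmooth

end

noncomputable section

namespace PSmooth

variable {n : ℕ}

lemma sq_le_energy (f : PSmooth n) (x : EuclideanSpace ℝ (Fin n)) : f x ^ 2 ≤ energy f x := by
  rw [energy_apply]
  have := sphGrad_self_nonneg f x
  have := sphGrad_self_nonneg (euler f) x
  nlinarith [sq_nonneg (euler (euler f) x), sq_nonneg (sphLap f x), sq_nonneg (euler f x)]

variable [NeZero n]

lemma eq_zero_of_pInt_le_div (w : PSmooth n) {C L₁ : ℝ}
    (h : ∀ L ≥ L₁, ∃ G ∈ annular n, (∀ x ≠ 0, 0 ≤ G x) ∧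
      (∀ x ≠ 0, |Real.log ‖x‖| ≤ L → w x ^ 2 ≤ G x) ∧ pInt G ≤ C / L) :
    ∀ x ≠ 0, w x = 0 := by
  intro x hx
  set L₀ : ℝ := |Real.log ‖x‖| + 1 with hL₀
  have hL₀1 : 0 < L₀ := by positivity
  set f : PSmooth n := cut L₀ 0 * w ^ 2 with hf
  have hfm : f ∈ annular n := Ideal.mul_mem_right _ _ (cut_mem_annular hL₀1 0)
  have hf0 : ∀ y ≠ 0, 0 ≤ f y := fun y _ =>
    mul_nonneg (cut_nonneg _ _ y) (by simpa using sq_nonneg (w y))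
  have hle : ∀ L ≥ max L₁ (2 * L₀), pInt f ≤ C / L := by
    intro L hL
    obtain ⟨G, hGm, hG0, hG, hGC⟩ := h L ((le_max_left _ _).trans hL)
    refine (pInt_mono hfm hGm fun y hy => ?_).trans hGC
    by_cases hc : (cut L₀ 0 : PSmooth n) y = 0
    · have : f y = 0 := by simp [hf, hc]
      rw [this]
      exact hG0 y hy
    · have h1 := abs_lt_of_cut_ne_zero hL₀1 hc
      rw [sub_zero] at h1
      refine le_trans ?_ (hG y hy (h1.le.trans ((le_max_right _ _).trans hL)))
      simpa [hf] using mul_le_of_le_one_left (sq_nonneg (w y)) (cut_le_one L₀ 0 y)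
  have hlim : Tendsto (fun L : ℝ => C / L) atTop (𝓝 0) := tendsto_const_nhds.div_atTop tendsto_id
  have hf1 : pInt f ≤ 0 := ge_of_tendsto hlim (eventually_atTop.2 ⟨_, hle⟩)
  have := eq_zero_of_pInt_eq_zero hfm hf0 (le_antisymm hf1 (pInt_nonneg hfm hf0)) hx
  have h1 : (cut L₀ 0 : PSmooth n) x = 1 := cut_eq_one hL₀1 (by rw [sub_zero, hL₀]; linarith)
  simpa [hf, h1] using this

lemma eq_zero_of_subcritical {c p κ S : ℝ} (hc : 1 ≤ c) (hp : 1 < p) (hκ : κ ≤ 0)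
    {w F : PSmooth n} (hF : ∀ x ≠ 0, F x = |w x| ^ (p - 1) * w x)
    (hG : ∀ x ≠ 0, op (-2) (-c) (op 2 (-c) (npow (κ / 2) * w)) x = (npow (κ / 2) * F : PSmooth n) x)
    (hstab : ∀ g ∈ annular n, p * pInt (g ^ 2 * (F * w)) ≤ pInt (op 2 (-c) (g * w) ^ 2))
    (hS : ∀ x ≠ 0, ‖x‖ ≤ 1 → ((npow (κ / 2) : PSmooth n) x * w x) ^ 2 ≤ S) :
    ∀ x ≠ 0, w x = 0 := by
  obtain ⟨k', hk'⟩ := exists_nat_ge (8 / (p - 1))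
  set k := k' + 1 with hk
  have hpk : 8 / (p - 1) ≤ 2 * (k : ℝ) := by
    rw [hk]; push_cast; have : (0 : ℝ) ≤ k' := k'.cast_nonneg; linarith
  obtain ⟨C, hC0, hC⟩ := pInt_energy_mul_cutoff_le (n := n) (k := k) (by omega) hc hp hpk
  obtain ⟨B, hB0, hB⟩ := exists_isCutoff_cut
  obtain ⟨M, hM0, hM⟩ := exists_pInt_cut_le (n := n)
  set K := max 1 S with hK
  have hK0 : 0 ≤ K := zero_le_one.trans (le_max_left _ _)
  set q : PSmooth n := npow (κ / 2) with hq
  have key := eq_zero_of_pInt_le_div (q * w) (C := C * B ^ 2 * K * M * 2) (L₁ := max 1 B) ?_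
  · intro x hx
    have h1 := key x hx
    have h2 : q x ≠ 0 := (Real.rpow_pos_of_pos (norm_pos_iff.2 hx) _).ne'
    simpa [h2] using h1
  intro L hL
  have hL1 : 1 ≤ L := (le_max_left _ _).trans hL
  have hLB : B ≤ L := (le_max_right _ _).trans hL
  have hL0 : 0 < L := by linarith
  have h2m : (cut (2 * L) 0 : PSmooth n) ∈ annular n := cut_mem_annular (by linarith) 0
  have h := hC q w F (cut L 0) (K • cut (2 * L) 0) (B / L) hF hG
    (fun g hg => by
      have := hstab (g * q) (Ideal.mul_mem_right _ _ hg)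
      exact this)
    (by positivity) (div_le_one_of_le₀ hLB hL0.le) (hB L 0 hL1) (smul_mem_annular _ h2m)
    (fun x _ => mul_nonneg hK0 (cut_nonneg _ _ x)) (fun x hx hχ => by
      have h1 := abs_lt_of_cut_ne_zero hL0 hχ
      have h2 : (cut (2 * L) 0 : PSmooth n) x = 1 := cut_eq_one (by linarith) h1.le
      have h3 : (K • cut (2 * L) 0 : PSmooth n) x = K := by simp [h2]
      rw [h3]
      rcases le_total ‖x‖ 1 with hx1 | hx1
      · exact Or.inr ((hS x hx hx1).trans (le_max_right _ _))
      · refine Or.inl (le_trans ?_ (le_max_left _ _))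
        exact pow_le_one₀ (Real.rpow_nonneg (norm_nonneg _) _)
          (Real.rpow_le_one_of_one_le_of_nonpos hx1 (by linarith)))
  have hηm : (cut L 0 : PSmooth n) ^ (k + 2) ∈ annular n :=
    pow_mem_annular (cut_mem_annular hL0 0) (by omega)
  refine ⟨_, energy_mem_annular (f := cut L 0 ^ (k + 2) * (q * w)) (Ideal.mul_mem_right _ _ hηm),
    fun x _ => energy_nonneg _ x, fun x _ hxL => ?_, ?_⟩
  · refine le_trans (le_of_eq ?_) (sq_le_energy _ x)
    have h2 : (cut L 0 : PSmooth n) x = 1 := cut_eq_one hL0 (by rwa [sub_zero])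
    simp [h2]
  · have hJ : 0 ≤ pInt ((cut L 0 ^ (k + 2) * q) ^ 2 * (F * w)) := by
      refine pInt_nonneg (Ideal.mul_mem_right _ _ (pow_mem_annular
        (Ideal.mul_mem_right _ _ hηm) two_pos)) fun x hx => ?_
      have : 0 ≤ F x * w x := by
        rw [hF x hx, mul_assoc]
        exact mul_nonneg (Real.rpow_nonneg (abs_nonneg _) _) (mul_self_nonneg _)
      simp only [Subalgebra.coe_mul, Subalgebra.coe_pow, Pi.mul_apply, Pi.pow_apply]
      positivity
    rw [pInt_smul] at h
    have h4 := hM (2 * L) (by linarith)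
    calc _ ≤ C * ((B / L) ^ 2 * (K * pInt (cut (2 * L) 0))) := (le_add_of_nonneg_right hJ).trans h
      _ ≤ C * ((B / L) ^ 2 * (K * (M * (2 * L)))) := by gcongr
      _ = C * B ^ 2 * K * M * 2 / L := by field_simp

end PSmooth

end

noncomputable section

namespace PSmooth

variable {n : ℕ}

lemma linDer_eventuallyEq (A : EuclideanSpace ℝ (Fin n) →L[ℝ] EuclideanSpace ℝ (Fin n))
    {f g : PSmooth n} {x : EuclideanSpace ℝ (Fin n)} (h : f.1 =ᶠ[𝓝 x] g.1) :
    (linDer A f).1 =ᶠ[𝓝 x] (linDer A g).1 :=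
  h.eventually_nhds.mono fun y hy => by
    have e : fderiv ℝ f.1 y = fderiv ℝ g.1 y := Filter.EventuallyEq.fderiv_eq hy
    exact congrArg (fun l => l (A y)) e

lemma sphLap_apply (f : PSmooth n) (x : EuclideanSpace ℝ (Fin n)) :
    sphLap f x = 1 / 2 * ∑ i, ∑ j, rot i j (rot i j f) x := by
  rw [sphLap_eq]
  simp

lemma energy_congr {f g : PSmooth n} {x : EuclideanSpace ℝ (Fin n)} (h : f.1 =ᶠ[𝓝 x] g.1) :
    energy f x = energy g x := by
  have h1 : (euler f).1 =ᶠ[𝓝 x] (euler g).1 := linDer_eventuallyEq _ h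
  have h2 : euler (euler f) x = euler (euler g) x := (linDer_eventuallyEq _ h1).eq_of_nhds
  have hr : ∀ i j, (rot i j f).1 =ᶠ[𝓝 x] (rot i j g).1 := fun i j => linDer_eventuallyEq _ h
  have hr1 : ∀ i j, rot i j f x = rot i j g x := fun i j => (hr i j).eq_of_nhds
  have hr2 : ∀ i j, rot i j (rot i j f) x = rot i j (rot i j g) x :=
    fun i j => (linDer_eventuallyEq _ (hr i j)).eq_of_nhds
  have hr3 : ∀ i j, rot i j (euler f) x = rot i j (euler g) x :=
    fun i j => (linDer_eventuallyEq _ h1).eq_of_nhds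
  have e0 : f x = g x := h.eq_of_nhds
  have e1 : euler f x = euler g x := h1.eq_of_nhds
  rw [energy_apply, energy_apply, sphLap_apply, sphLap_apply, sphGrad_apply, sphGrad_apply,
    sphGrad_apply, sphGrad_apply, h2, e1, e0]
  simp only [hr1, hr2, hr3]

lemma cut_eventuallyEq_one {L T : ℝ} (hL : 0 < L) {x : EuclideanSpace ℝ (Fin n)} (hx : x ≠ 0)
    (h : |Real.log ‖x‖ - T| < L) : (cut L T : PSmooth n).1 =ᶠ[𝓝 x] 1 := by
  have hc : ContinuousAt (fun y : EuclideanSpace ℝ (Fin n) => |Real.log ‖y‖ - T|) x :=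
    ((continuous_norm.continuousAt.log (norm_ne_zero_iff.2 hx)).sub continuousAt_const).abs
  exact (hc.eventually_lt continuousAt_const h).mono fun y hy => cut_eq_one hL (le_of_lt hy)

lemma cut_eventuallyEq_zero {L T : ℝ} (hL : 0 < L) {x : EuclideanSpace ℝ (Fin n)} (hx : x ≠ 0)
    (h : 2 * L < |Real.log ‖x‖ - T|) : (cut L T : PSmooth n).1 =ᶠ[𝓝 x] 0 := by
  have hc : ContinuousAt (fun y : EuclideanSpace ℝ (Fin n) => |Real.log ‖y‖ - T|) x :=
    ((continuous_norm.continuousAt.log (norm_ne_zero_iff.2 hx)).sub continuousAt_const).abs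
  refine (continuousAt_const.eventually_lt hc h).mono fun y hy => ?_
  by_contra h0
  exact absurd (abs_lt_of_cut_ne_zero hL h0) (by simpa using le_of_lt hy)

lemma sphGrad_sub_smul_self_le (f g : PSmooth n) (s : ℝ) (x : EuclideanSpace ℝ (Fin n)) :
    sphGrad f f x ≤ 2 * sphGrad (f + s • g) (f + s • g) x + 2 * s ^ 2 * sphGrad g g x := by
  have h := sphGrad_self_nonneg (f + (2 * s) • g) x
  have h3 : sphGrad g f = sphGrad f g := sphGrad_comm _ _
  simp only [map_add, map_smul, LinearMap.add_apply, LinearMap.smul_apply, Subalgebra.coe_add,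
    Subalgebra.coe_smul, Pi.add_apply, Pi.smul_apply, smul_eq_mul, h3] at h ⊢
  linarith

lemma npow_sq_mul_energy_le (s : ℝ) (w : PSmooth n) (x : EuclideanSpace ℝ (Fin n)) :
    (npow s : PSmooth n) x ^ 2 * energy w x ≤
      (12 * (1 + s ^ 2) ^ 2) * energy (npow s * w) x := by
  have e1 : euler (npow s * w) = npow s * (euler w + s • w) := by
    rw [Derivation.leibniz, euler_npow]
    ext y; simp; ring
  have e2 : euler (euler (npow s * w)) =
      npow s * (euler (euler w) + (2 * s) • euler w + s ^ 2 • w) := by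
    rw [e1, Derivation.leibniz, euler_npow, map_add, Derivation.map_smul]
    ext y; simp; ring
  have hr := isRadial_npow (n := n) s
  rw [energy_apply, energy_apply, e2, e1, sphGrad_radial_mul_left hr, sphGrad_radial_mul_right hr,
    sphGrad_radial_mul_left hr, sphGrad_radial_mul_right hr, sphLap_radial_mul hr]
  have h1 := sphGrad_sub_smul_self_le (euler w) w s x
  have h2 := sphGrad_self_nonneg w x
  have h3 := sphGrad_self_nonneg (euler w + s • w) x
  simp only [Subalgebra.coe_add, Subalgebra.coe_smul, Subalgebra.coe_mul, Pi.add_apply,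
    Pi.mul_apply, Pi.smul_apply, smul_eq_mul]
  generalize sphGrad w w x = G0 at *
  generalize (sphGrad (euler w) (euler w)) x = G1 at *
  generalize (sphGrad (euler w + s • w) (euler w + s • w)) x = GA at *
  generalize (npow s : PSmooth n) x = r
  generalize euler (euler w) x = w2
  generalize euler w x = w1
  generalize w x = w0
  generalize sphLap w x = l
  have k1 : w1 ^ 2 ≤ 2 * (w1 + s * w0) ^ 2 + 2 * s ^ 2 * w0 ^ 2 := by
    nlinarith [sq_nonneg (w1 + 2 * s * w0)]
  have k2 : w2 ^ 2 ≤ 3 * (w2 + 2 * s * w1 + s ^ 2 * w0) ^ 2 + 12 * s ^ 2 * (w1 + s * w0) ^ 2 +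
      3 * s ^ 4 * w0 ^ 2 := by
    set A := w2 + 2 * s * w1 + s ^ 2 * w0 with hA
    set b := w1 + s * w0 with hb
    have : w2 = A + (-2 * s * b) + s ^ 2 * w0 := by rw [hA, hb]; ring
    rw [this]
    nlinarith [sq_nonneg (A - (-2 * s * b)), sq_nonneg (A - s ^ 2 * w0),
      sq_nonneg ((-2 * s * b) - s ^ 2 * w0)]
  have hK : 12 * (1 + s ^ 2) ^ 2 = 12 + 24 * s ^ 2 + 12 * s ^ 4 := by ring
  have hs2 := sq_nonneg s
  have hs4 : 0 ≤ s ^ 4 := by positivity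
  have key : w2 ^ 2 + G1 + l ^ 2 + w1 ^ 2 + G0 + w0 ^ 2 ≤ (12 * (1 + s ^ 2) ^ 2) *
      ((w2 + 2 * s * w1 + s ^ 2 * w0) ^ 2 + GA + l ^ 2 + (w1 + s * w0) ^ 2 + G0 + w0 ^ 2) := by
    rw [hK]
    generalize (w2 + 2 * s * w1 + s ^ 2 * w0) ^ 2 = A2, hA2 : (w2 + 2 * s * w1 + s ^ 2 * w0) ^ 2 = A2
      at *
    have := sq_nonneg (w1 + s * w0)
    have hA : 0 ≤ A2 := hA2 ▸ sq_nonneg _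
    generalize (w1 + s * w0) ^ 2 = B2 at *
    have a1 := mul_nonneg hs2 hA
    have a2 := mul_nonneg hs2 this
    have a3 := mul_nonneg hs2 h3
    have a4 := mul_nonneg hs2 h2
    have a5 := mul_nonneg hs2 (sq_nonneg w0)
    have a6 := mul_nonneg hs2 (sq_nonneg l)
    have b1 := mul_nonneg hs4 hA
    have b2 := mul_nonneg hs4 this
    have b3 := mul_nonneg hs4 h3
    have b4 := mul_nonneg hs4 h2
    have b5 := mul_nonneg hs4 (sq_nonneg w0)
    have b6 := mul_nonneg hs4 (sq_nonneg l)
    nlinarith [sq_nonneg w0, sq_nonneg l]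
  calc _ ≤ r ^ 2 * ((12 * (1 + s ^ 2) ^ 2) *
      ((w2 + 2 * s * w1 + s ^ 2 * w0) ^ 2 + GA + l ^ 2 + (w1 + s * w0) ^ 2 + G0 + w0 ^ 2)) :=
        mul_le_mul_of_nonneg_left key (sq_nonneg r)
    _ = _ := by ring

end PSmooth

end

noncomputable section

namespace PSmooth

variable {n : ℕ} [NeZero n]

lemma exists_growth_bound {c p κ : ℝ} (hc : 1 ≤ c) (hp : 1 < p) (hκ : 0 ≤ κ)
    {w F : PSmooth n} (hF : ∀ x ≠ 0, F x = |w x| ^ (p - 1) * w x)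
    (hG : ∀ x ≠ 0, op (-2) (-c) (op 2 (-c) (npow (κ / 2) * w)) x = (npow (κ / 2) * F : PSmooth n) x)
    (hstab : ∀ g ∈ annular n, p * pInt (g ^ 2 * (F * w)) ≤ pInt (op 2 (-c) (g * w) ^ 2)) :
    ∃ C, 0 ≤ C ∧ ∀ L : ℝ, 1 ≤ L → pInt (cut L 0 ^ 2 * (energy w + F * w)) ≤ C * L := by
  obtain ⟨k', hk'⟩ := exists_nat_ge (8 / (p - 1))
  set k := k' + 1 with hk
  have hpk : 8 / (p - 1) ≤ 2 * (k : ℝ) := by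
    rw [hk]; push_cast; have : (0 : ℝ) ≤ k' := k'.cast_nonneg; linarith
  obtain ⟨C, hC0, hC⟩ := pInt_energy_mul_cutoff_le (n := n) (k := k) (by omega) hc hp hpk
  obtain ⟨B, hB0, hB⟩ := exists_isCutoff_cut
  set L₀ : ℝ := max 2 B with hL₀
  have hL₀2 : 2 ≤ L₀ := le_max_left _ _
  have hL₀B : B ≤ L₀ := le_max_right _ _
  have hL₀0 : 0 < L₀ := by linarith
  have hd1 : B / L₀ ≤ 1 := div_le_one_of_le₀ hL₀B hL₀0.le
  have hd0 : 0 ≤ B / L₀ := by positivity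
  set q : PSmooth n := npow (κ / 2) with hq
  have hqx : ∀ x ≠ 0, q x ^ 2 = Real.exp (κ * Real.log ‖x‖) := fun x hx => by
    rw [hq, npow_apply, Real.rpow_def_of_pos (norm_pos_iff.2 hx), ← Real.exp_nat_mul]
    congr 1; push_cast; ring
  set Q : ℝ := pInt (cut (2 * L₀) 0 : PSmooth n) with hQ
  have h2m : ∀ T : ℝ, (cut (2 * L₀) T : PSmooth n) ∈ annular n := cut_mem_annular (by linarith)
  have hQ0 : 0 ≤ Q := pInt_nonneg (h2m 0) fun x _ => cut_nonneg _ _ x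
  have hηm : ∀ T : ℝ, (cut L₀ T : PSmooth n) ^ (k + 2) ∈ annular n := fun T =>
    pow_mem_annular (cut_mem_annular hL₀0 T) (by omega)
  set e : ℝ → PSmooth n := fun T => energy (cut L₀ T ^ (k + 2) * (q * w)) with he
  set j : ℝ → PSmooth n := fun T => (cut L₀ T ^ (k + 2) * q) ^ 2 * (F * w) with hj
  have hem : ∀ T, e T ∈ annular n := fun T => energy_mem_annular (Ideal.mul_mem_right _ _ (hηm T))
  have hjm : ∀ T, j T ∈ annular n := fun T => Ideal.mul_mem_right _ _
    (pow_mem_annular (Ideal.mul_mem_right _ _ (hηm T)) two_pos)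
  have hFw : ∀ x ≠ 0, 0 ≤ F x * w x := fun x hx => by
    rw [hF x hx, mul_assoc]
    exact mul_nonneg (Real.rpow_nonneg (abs_nonneg _) _) (mul_self_nonneg _)
  have he0 : ∀ T, ∀ x ≠ 0, 0 ≤ e T x := fun T x _ => energy_nonneg _ x
  have hj0 : ∀ T, ∀ x ≠ 0, 0 ≤ j T x := fun T x hx => by
    have := hFw x hx
    simp only [hj, Subalgebra.coe_mul, Subalgebra.coe_pow, Pi.mul_apply, Pi.pow_apply]
    positivity
  have hbound : ∀ T, pInt (e T) + pInt (j T) ≤ C * (Real.exp (κ * (T + 2 * L₀)) * Q) := fun T => by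
    have h := hC q w F (cut L₀ T) (Real.exp (κ * (T + 2 * L₀)) • cut (2 * L₀) T) (B / L₀) hF hG
      (fun g hg => hstab (g * q) (Ideal.mul_mem_right _ _ hg))
      hd0 hd1 (hB L₀ T (by linarith)) (smul_mem_annular _ (h2m T))
      (fun x _ => mul_nonneg (Real.exp_pos _).le (cut_nonneg _ _ x)) (fun x hx hχ => by
        have h1 := abs_lt_of_cut_ne_zero hL₀0 hχ
        have h2 : (cut (2 * L₀) T : PSmooth n) x = 1 := cut_eq_one (by linarith) h1.le
        have h3 : (Real.exp (κ * (T + 2 * L₀)) • cut (2 * L₀) T : PSmooth n) x =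
          Real.exp (κ * (T + 2 * L₀)) := by simp [h2]
        rw [h3, hqx x hx]
        refine Or.inl (Real.exp_le_exp.2 (mul_le_mul_of_nonneg_left ?_ hκ))
        linarith [(abs_lt.1 h1).2])
    rw [pInt_smul, pInt_cut] at h
    refine h.trans (mul_le_mul_of_nonneg_left ?_ hC0)
    exact mul_le_of_le_one_left (by positivity) (pow_le_one₀ hd0 hd1)
  set K : ℝ := 12 * (1 + (κ / 2) ^ 2) ^ 2 with hK
  have hK1 : 1 ≤ K := by nlinarith [sq_nonneg (κ / 2), sq_nonneg ((κ / 2) ^ 2)]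
  set R : ℝ := K * (C * (Real.exp (κ * (1 + 2 * L₀)) * Q)) with hR
  have hR0 : 0 ≤ R := by positivity
  refine ⟨9 * R, by positivity, fun L hL => ?_⟩
  have hL0 : 0 < L := by linarith
  set s : ℝ → ℝ := fun T => K * Real.exp (-(κ * (T - 1))) with hs
  have hs0 : ∀ T, 0 ≤ s T := fun T => by positivity
  have hE0 : ∀ x ≠ 0, 0 ≤ energy w x + F x * w x := fun x hx =>
    add_nonneg (energy_nonneg _ x) (hFw x hx)
  refine pInt_le_of_unit_bound (Ideal.mul_mem_right _ _ (pow_mem_annular (cut_mem_annular hL0 0)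
    two_pos)) hL hR0 (g := fun T : ℤ => s T • (e T + j T))
    (fun T => smul_mem_annular _ (add_mem (hem T) (hjm T)))
    (fun T x hx => mul_nonneg (hs0 T) (add_nonneg (he0 T x hx) (hj0 T x hx))) (fun T => ?_)
    (fun x hx h0 => ?_) fun x hx T hT => ?_
  · rw [pInt_smul, pInt_add (hem T) (hjm T)]
    refine (mul_le_mul_of_nonneg_left (hbound T) (hs0 T)).trans (le_of_eq ?_)
    have : Real.exp (-(κ * ((T : ℝ) - 1))) * Real.exp (κ * (T + 2 * L₀)) =
        Real.exp (κ * (1 + 2 * L₀)) := by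
      rw [← Real.exp_add]; congr 1; ring
    rw [hR, ← this, hs]
    ring
  · have : (cut L 0 : PSmooth n) x ≠ 0 := fun h => h0 (by simp [h])
    simpa using abs_lt_of_cut_ne_zero hL0 this
  · have h1 : (cut L₀ T : PSmooth n).1 =ᶠ[𝓝 x] 1 :=
      cut_eventuallyEq_one hL₀0 hx (by linarith)
    have h2 : e T x = energy (q * w) x := energy_congr (h1.mono fun y hy => by
      have hy' : (cut L₀ T : PSmooth n) y = 1 := hy
      change (cut L₀ T : PSmooth n) y ^ (k + 2) * (q * w : PSmooth n) y = (q * w : PSmooth n) y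
      rw [hy', one_pow, one_mul])
    have h3 : j T x = q x ^ 2 * (F x * w x) := by
      have hx1 : (cut L₀ T : PSmooth n) x = 1 := h1.eq_of_nhds
      simp [hj, hx1]
    have h4 : q x ^ 2 * energy w x ≤ K * energy (q * w) x := npow_sq_mul_energy_le _ _ _
    have h5 : 1 ≤ Real.exp (-(κ * ((T : ℝ) - 1))) * q x ^ 2 := by
      rw [hqx x hx, ← Real.exp_add]
      refine Real.one_le_exp ?_
      have := mul_nonneg hκ (by linarith [(abs_le.1 hT).1] : 0 ≤ Real.log ‖x‖ - T + 1)
      linarith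
    have hc1 : (cut L 0 : PSmooth n) x ^ 2 ≤ 1 :=
      pow_le_one₀ (cut_nonneg _ _ x) (cut_le_one _ _ x)
    have h6 : q x ^ 2 * (F x * w x) ≤ K * (q x ^ 2 * (F x * w x)) :=
      le_mul_of_one_le_left (mul_nonneg (sq_nonneg _) (hFw x hx)) hK1
    change (cut L 0 : PSmooth n) x ^ 2 * (energy w x + F x * w x) ≤ s T * (e T x + j T x)
    rw [h2, h3]
    calc _ ≤ 1 * (energy w x + F x * w x) := mul_le_mul_of_nonneg_right hc1 (hE0 x hx)
      _ ≤ Real.exp (-(κ * ((T : ℝ) - 1))) * q x ^ 2 * (energy w x + F x * w x) :=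
        mul_le_mul_of_nonneg_right h5 (hE0 x hx)
      _ = Real.exp (-(κ * ((T : ℝ) - 1))) * (q x ^ 2 * energy w x + q x ^ 2 * (F x * w x)) := by
        ring
      _ ≤ Real.exp (-(κ * ((T : ℝ) - 1))) * (K * energy (q * w) x +
          K * (q x ^ 2 * (F x * w x))) := by gcongr
      _ = _ := by rw [hs]; ring

end PSmooth

end

noncomputable section

namespace PSmooth

variable {n : ℕ}

lemma euler_mul_self_of_eq_rpow {p : ℝ} (hp : 1 < p) {w F : PSmooth n}
    (hF : ∀ x ≠ 0, F x = |w x| ^ (p - 1) * w x) {x : EuclideanSpace ℝ (Fin n)} (hx : x ≠ 0) :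
    euler (F * w) x = (p + 1) * (F x * euler w x) := by
  have h1 : HasFDerivAt w.1 (fderiv ℝ w.1 x) x := (differentiableAt w hx).hasFDerivAt
  have h2 := (hasDerivAt_abs_rpow (w x) (p := p + 1) (by linarith)).comp_hasFDerivAt x h1
  have h3 : (F * w : PSmooth n).1 =ᶠ[𝓝 x] (fun s : ℝ => |s| ^ (p + 1)) ∘ w.1 :=
    eventually_of_mem (isOpen_compl_singleton.mem_nhds hx) fun y hy => by
      change F y * w y = |w y| ^ (p + 1)
      have e : |w y| ^ (p + 1) = |w y| ^ (p - 1) * |w y| ^ (2 : ℝ) := by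
        rcases eq_or_ne (w y) 0 with h | h
        · rw [h, abs_zero, Real.zero_rpow (by linarith), Real.zero_rpow (by linarith), zero_mul]
        · rw [← Real.rpow_add (abs_pos.2 h)]; ring_nf
      rw [e, hF y hy, Real.rpow_two, sq_abs]
      ring
  have h4 : euler (F * w) x = fderiv ℝ (F * w : PSmooth n).1 x x := rfl
  rw [h4, h3.fderiv_eq, h2.fderiv, hF x hx]
  have h5 : euler w x = fderiv ℝ w.1 x x := rfl
  rw [h5, show p + 1 - 2 = p - 1 by ring]
  simp
  ring

lemma op_op_apply {κ b₁ b₂ : ℝ} (hb : b₂ = b₁ + 2 * κ) (w : PSmooth n)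
    (x : EuclideanSpace ℝ (Fin n)) :
    op (κ - 2) (-b₂) (op (κ + 2) (-b₁) w) x =
      euler (euler (euler (euler w))) x + 2 * κ * euler (euler (euler w)) x +
        (κ ^ 2 - 4 - (b₁ + b₂)) * euler (euler w) x - κ * (b₁ + b₂ + 4) * euler w x +
        2 * sphLap (euler (euler w)) x + 2 * κ * sphLap (euler w) x + sphLap (sphLap w) x -
        (b₁ + b₂) * sphLap w x + b₁ * b₂ * w x := by
  subst hb
  simp only [op_eq, map_add, map_smul, euler_sphLap]
  simp
  ring

lemma euler_mul_apply (f g : PSmooth n) (x : EuclideanSpace ℝ (Fin n)) :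
    euler (f * g) x = euler f x * g x + f x * euler g x := by
  rw [Derivation.leibniz]
  simp
  ring

lemma euler_sq_apply (f : PSmooth n) (x : EuclideanSpace ℝ (Fin n)) :
    euler (f ^ 2) x = 2 * (f x * euler f x) := by
  rw [pow_two, euler_mul_apply]
  ring

lemma euler_sphGrad_self_apply (f : PSmooth n) (x : EuclideanSpace ℝ (Fin n)) :
    euler (sphGrad f f) x = 2 * sphGrad f (euler f) x := by
  rw [euler_sphGrad, sphGrad_comm (euler f) f]
  change sphGrad f (euler f) x + sphGrad f (euler f) x = _
  ring

lemma sphGrad_radial_mul_left_apply {g : PSmooth n} (hg : IsRadial g) (f h : PSmooth n)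
    (x : EuclideanSpace ℝ (Fin n)) : sphGrad (g * f) h x = g x * sphGrad f h x := by
  rw [sphGrad_radial_mul_left hg]
  rfl

lemma sphGrad_radial_mul_right_apply {g : PSmooth n} (hg : IsRadial g) (f h : PSmooth n)
    (x : EuclideanSpace ℝ (Fin n)) : sphGrad f (g * h) x = g x * sphGrad f h x := by
  rw [sphGrad_radial_mul_right hg]
  rfl

lemma sphLap_radial_mul_apply {g : PSmooth n} (hg : IsRadial g) (f : PSmooth n)
    (x : EuclideanSpace ℝ (Fin n)) : sphLap (g * f) x = g x * sphLap f x := by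
  rw [sphLap_radial_mul hg]
  rfl

lemma mul_mul_le_abs {C M e s t : ℝ} (hs : |s| ≤ M) (ht : |t| ≤ e) :
    C * (s * t) ≤ |C| * (M * e) := by
  calc C * (s * t) ≤ |C * (s * t)| := le_abs_self _
    _ = |C| * (|s| * |t|) := by rw [abs_mul, abs_mul]
    _ ≤ |C| * (M * e) := by
      have : 0 ≤ M := (abs_nonneg s).trans hs
      gcongr

/-- The quadratic expressions in the derivatives of `f` which are dominated by `energy f`. -/
lemma abs_le_energy (f : PSmooth n) (x : EuclideanSpace ℝ (Fin n)) :
    |f x ^ 2| ≤ energy f x ∧ |euler f x ^ 2| ≤ energy f x ∧ |euler (euler f) x ^ 2| ≤ energy f x ∧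
      |sphLap f x ^ 2| ≤ energy f x ∧ |sphGrad f f x| ≤ energy f x ∧
      |sphGrad (euler f) (euler f) x| ≤ energy f x ∧ |sphGrad f (euler f) x| ≤ energy f x ∧
      |f x * euler f x| ≤ energy f x ∧ |f x * euler (euler f) x| ≤ energy f x ∧
      |euler f x * euler (euler f) x| ≤ energy f x := by
  have h0 := sphGrad_self_nonneg f x
  have h1 := sphGrad_self_nonneg (euler f) x
  have h2 := abs_sphGrad_le f (euler f) x
  have hm : ∀ a b : ℝ, |a * b| ≤ a ^ 2 + b ^ 2 := fun a b => by
    rw [abs_le]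
    constructor <;> nlinarith [sq_nonneg (a + b), sq_nonneg (a - b), sq_nonneg a, sq_nonneg b]
  have m1 := hm (f x) (euler f x)
  have m2 := hm (f x) (euler (euler f) x)
  have m3 := hm (euler f x) (euler (euler f) x)
  have s0 := sq_nonneg (f x)
  have s1 := sq_nonneg (euler f x)
  have s2 := sq_nonneg (euler (euler f) x)
  have s3 := sq_nonneg (sphLap f x)
  rw [energy_apply, abs_of_nonneg s0, abs_of_nonneg s1, abs_of_nonneg s2, abs_of_nonneg s3,
    abs_of_nonneg h0, abs_of_nonneg h1]
  refine ⟨?_, ?_, ?_, ?_, ?_, ?_, ?_, ?_, ?_, ?_⟩ <;> linarith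

variable [NeZero n]

set_option maxHeartbeats 2000000 in
lemma exists_translation_bound {κ b₁ b₂ p : ℝ} (hκ : 0 < κ) (hb : b₂ = b₁ + 2 * κ)
    (hb0 : 0 ≤ b₁ + b₂) (hp : 1 < p) :
    ∃ C, 0 ≤ C ∧ ∀ (w F φ ψ : PSmooth n) (d : ℝ),
      (∀ x ≠ 0, F x = |w x| ^ (p - 1) * w x) →
      (∀ x ≠ 0, op (κ - 2) (-b₂) (op (κ + 2) (-b₁) w) x = F x) →
      IsRadial φ → φ ∈ annular n → ψ ∈ annular n → (∀ x ≠ 0, 0 ≤ φ x) →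
      (∀ x ≠ 0, |euler φ x| ≤ d * ψ x) → (∀ x ≠ 0, |euler (euler φ) x| ≤ d * ψ x) →
      pInt (φ * (euler (euler w) ^ 2 + euler w ^ 2 + sphGrad (euler w) (euler w))) ≤
        C * (d * pInt (ψ * (energy w + F * w))) := by
  set C : ℝ := |3 / 2| + |1| + |-2 * κ| + |-(1 / 2) * (κ ^ 2 - 4 - (b₁ + b₂))| + |1| + |-(1 / 2)| +
    |-((b₁ + b₂) / 2)| + |-(b₁ * b₂ / 2)| + |1 / (p + 1)| with hC
  have hC0 : 0 ≤ C := by positivity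
  refine ⟨C / κ, by positivity, fun w F φ ψ d hF hEq hφr hφ hψ hφ0 hφ1 hφ2 => ?_⟩
  have hφ1m := euler_mem_annular hφ
  have hr (g : PSmooth n) : φ * g ∈ annular n := Ideal.mul_mem_right _ _ hφ
  have hr1 (g : PSmooth n) : euler φ * g ∈ annular n := Ideal.mul_mem_right _ _ hφ1m
  have n1 := euler_mem_null (hr (euler w * euler (euler (euler w))))
  have n2 := euler_mem_null (hr (euler (euler w) ^ 2))
  have n3 := euler_mem_null (hr1 (euler w * euler (euler w)))
  have n4 := euler_mem_null (hr (euler w * euler (euler w)))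
  have n5 := euler_mem_null (hr (euler w ^ 2))
  have n6 := mul_sphLap_add_sphGrad_mem_null (hr (euler w)) (euler (euler w))
  have n6' := euler_mem_null (hr (sphGrad (euler w) (euler w)))
  have n7 := mul_sphLap_add_sphGrad_mem_null (hr (euler w)) (euler w)
  have n8 := mul_sphLap_add_sphGrad_mem_null (hr (euler w)) (sphLap w)
  have n8' := mul_sphLap_add_sphGrad_mem_null' (sphLap w) (hr (euler w))
  have n8'' := euler_mem_null (hr (sphLap w ^ 2))
  have n9 := mul_sphLap_add_sphGrad_mem_null (hr (euler w)) w
  have n9' := euler_mem_null (hr (sphGrad w w))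
  have n10 := euler_mem_null (hr (w ^ 2))
  have n11 := euler_mem_null (hr (F * w))
  have hz : _ ∈ null n := sub_mem (add_mem (sub_mem (add_mem (add_mem (sub_mem (add_mem (add_mem
    (add_mem (sub_mem (sub_mem n1 (Submodule.smul_mem _ (1 / 2 : ℝ) n2)) n3)
      (Submodule.smul_mem _ (2 * κ) n4))
      (Submodule.smul_mem _ (1 / 2 * (κ ^ 2 - 4 - (b₁ + b₂))) n5))
      (Submodule.smul_mem _ (2 : ℝ) n6)) n6')
      (Submodule.smul_mem _ (2 * κ) n7))
      (add_mem (sub_mem n8 n8') (Submodule.smul_mem _ (1 / 2 : ℝ) n8'')))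
      (Submodule.smul_mem _ (b₁ + b₂) (sub_mem n9 (Submodule.smul_mem _ (1 / 2 : ℝ) n9'))))
      (Submodule.smul_mem _ (1 / 2 * (b₁ * b₂)) n10))
      (Submodule.smul_mem _ (1 / (p + 1)) n11)
  have key := pInt_le_of_le_add_null
    (f := κ • (φ * (euler (euler w) ^ 2 + euler w ^ 2 + sphGrad (euler w) (euler w))))
    (g := (C * d) • (ψ * (energy w + F * w))) (smul_mem_annular _ (hr _))
    (smul_mem_annular _ (Ideal.mul_mem_right _ _ hψ)) hz fun x hx => ?_
  · rw [pInt_smul, pInt_smul] at key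
    rw [div_mul_eq_mul_div, le_div_iff₀ hκ]
    linarith
  have hp1 : p + 1 ≠ 0 := by linarith
  have hE := hEq x hx
  rw [op_op_apply hb] at hE
  have hFw := euler_mul_self_of_eq_rpow hp hF hx
  have hFw0 : 0 ≤ F x * w x := by
    rw [hF x hx, mul_assoc]
    exact mul_nonneg (Real.rpow_nonneg (abs_nonneg _) _) (mul_self_nonneg _)
  obtain ⟨t1, t2, t3, t4, t5, t6, t7, t8, t9, t10⟩ := abs_le_energy w x
  have hE0 := energy_nonneg w x
  have hle : energy w x ≤ energy w x + F x * w x := by linarith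
  have hA := sphGrad_self_nonneg (euler w) x
  rw [euler_mul_apply] at hFw
  simp only [Subalgebra.coe_add, Subalgebra.coe_smul, Subalgebra.coe_mul, Subalgebra.coe_pow,
    AddSubgroupClass.coe_sub, Pi.add_apply, Pi.sub_apply, Pi.mul_apply, Pi.pow_apply,
    Pi.smul_apply, smul_eq_mul, euler_mul_apply, euler_sq_apply, euler_sphGrad_self_apply,
    sphGrad_radial_mul_left_apply hφr, sphGrad_radial_mul_right_apply hφr,
    sphLap_radial_mul_apply hφr, euler_sphLap, sphGrad_comm (sphLap w) (euler w),
    sphGrad_comm (euler w) w]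
  have k1 := mul_mul_le_abs (C := 3 / 2) (hφ1 x hx) (t3.trans hle)
  have k2 := mul_mul_le_abs (C := 1) (hφ2 x hx) (t10.trans hle)
  have k3 := mul_mul_le_abs (C := -2 * κ) (hφ1 x hx) (t10.trans hle)
  have k4 := mul_mul_le_abs (C := -(1 / 2) * (κ ^ 2 - 4 - (b₁ + b₂))) (hφ1 x hx) (t2.trans hle)
  have k5 := mul_mul_le_abs (C := 1) (hφ1 x hx) (t6.trans hle)
  have k6 := mul_mul_le_abs (C := -(1 / 2)) (hφ1 x hx) (t4.trans hle)
  have k7 := mul_mul_le_abs (C := -((b₁ + b₂) / 2)) (hφ1 x hx) (t5.trans hle)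
  have k8 := mul_mul_le_abs (C := -(b₁ * b₂ / 2)) (hφ1 x hx) (t1.trans hle)
  have k9 := mul_mul_le_abs (C := 1 / (p + 1)) (hφ1 x hx)
    ((abs_of_nonneg hFw0).le.trans (by linarith : F x * w x ≤ energy w x + F x * w x))
  have hgood : κ * (φ x * (euler (euler w) x ^ 2 + euler w x ^ 2 +
      sphGrad (euler w) (euler w) x)) ≤ κ * (φ x * (2 * euler (euler w) x ^ 2 +
      (b₁ + b₂ + 4) * euler w x ^ 2 + 2 * sphGrad (euler w) (euler w) x)) := by
    have := hφ0 x hx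
    gcongr κ * (φ x * ?_)
    nlinarith [sq_nonneg (euler (euler w) x), sq_nonneg (euler w x)]
  refine hgood.trans ?_
  have hCsum : C * d * (ψ x * (energy w x + F x * w x)) = C * (d * ψ x * (energy w x + F x * w x)) :=
    by ring
  rw [hCsum, hC]
  have hFw' : F x * euler w x = 1 / (p + 1) * (euler F x * w x + F x * euler w x) := by
    rw [hFw]; field_simp
  linear_combination k1 + k2 + k3 + k4 + k5 + k6 + k7 + k8 + k9 - (φ x * euler w x) * hE -
    φ x * hFw'

end PSmooth

end

noncomputable section

namespace PSmooth

variable {n : ℕ} [NeZero n]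

set_option maxHeartbeats 2000000 in
lemma exists_test_bound {κ b₁ b₂ p : ℝ} (hb : b₂ = b₁ + 2 * κ) :
    ∃ C, 0 ≤ C ∧ ∀ (w F φ ψ : PSmooth n) (d : ℝ),
      (∀ x ≠ 0, F x = |w x| ^ (p - 1) * w x) →
      (∀ x ≠ 0, op (κ - 2) (-b₂) (op (κ + 2) (-b₁) w) x = F x) →
      IsRadial φ → φ ∈ annular n → ψ ∈ annular n → (∀ x ≠ 0, 0 ≤ φ x) →
      (∀ x ≠ 0, |euler φ x| ≤ d * ψ x) → (∀ x ≠ 0, |euler (euler φ) x| ≤ d * ψ x) →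
      pInt (φ * sphLap w ^ 2 + (b₁ + b₂) • (φ * sphGrad w w) + (b₁ * b₂) • (φ * w ^ 2)) ≤
        pInt (φ * (F * w)) +
          C * pInt (φ * (euler (euler w) ^ 2 + euler w ^ 2 + sphGrad (euler w) (euler w))) +
          C * (d * pInt (ψ * (energy w + F * w))) := by
  set C₁ : ℝ := |-2| + |-1| + |2 * κ| + |-κ| + |κ ^ 2 - 4 - (b₁ + b₂)| +
    |-(1 / 2) * (κ * (b₁ + b₂ + 4))| + |-2| + |-κ| with hC₁
  have hC₁0 : 0 ≤ C₁ := by positivity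
  set C₂ : ℝ := |κ ^ 2 - 4 - (b₁ + b₂)| with hC₂
  have hC₂0 : 0 ≤ C₂ := abs_nonneg _
  have hC₂C₁ : C₂ ≤ C₁ := by
    have : C₁ = C₂ + (|-2| + |-1| + |2 * κ| + |-κ| +
      |-(1 / 2) * (κ * (b₁ + b₂ + 4))| + |-2| + |-κ|) := by rw [hC₁, hC₂]; ring
    rw [this]
    exact le_add_of_nonneg_right (by positivity)
  refine ⟨C₁, hC₁0, fun w F φ ψ d hF hEq hφr hφ hψ hφ0 hφ1 hφ2 => ?_⟩
  have hφ1m := euler_mem_annular hφ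
  have hr (g : PSmooth n) : φ * g ∈ annular n := Ideal.mul_mem_right _ _ hφ
  have hr1 (g : PSmooth n) : euler φ * g ∈ annular n := Ideal.mul_mem_right _ _ hφ1m
  have n1 := euler_mem_null (hr (w * euler (euler (euler w))))
  have n2 := euler_mem_null (hr (euler w * euler (euler w)))
  have n3 := euler_mem_null (hr1 (w * euler (euler w)))
  have n4 := euler_mem_null (hr (w * euler (euler w)))
  have n5 := euler_mem_null (hr (euler w ^ 2))
  have n6 := euler_mem_null (hr (w * euler w))
  have n7 := euler_mem_null (hr (w ^ 2))
  have n8 := mul_sphLap_add_sphGrad_mem_null (hr w) (euler (euler w))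
  have n9 := euler_mem_null (hr (sphGrad w (euler w)))
  have n10 := mul_sphLap_add_sphGrad_mem_null (hr w) (euler w)
  have n11 := euler_mem_null (hr (sphGrad w w))
  have n12 := mul_sphLap_add_sphGrad_mem_null (hr w) (sphLap w)
  have n13 := mul_sphLap_add_sphGrad_mem_null' (sphLap w) (hr w)
  have n14 := mul_sphLap_add_sphGrad_mem_null (hr w) w
  have hz : _ ∈ null n := neg_mem (sub_mem (add_mem (sub_mem (add_mem (sub_mem (add_mem (sub_mem
    (add_mem (sub_mem (add_mem (sub_mem (sub_mem n1 n2) n3)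
      (Submodule.smul_mem _ (2 * κ) n4)) (Submodule.smul_mem _ κ n5))
      (Submodule.smul_mem _ (κ ^ 2 - 4 - (b₁ + b₂)) n6))
      (Submodule.smul_mem _ (1 / 2 * (κ * (b₁ + b₂ + 4))) n7))
      (Submodule.smul_mem _ (2 : ℝ) n8)) (Submodule.smul_mem _ (2 : ℝ) n9))
      (Submodule.smul_mem _ (2 * κ) n10)) (Submodule.smul_mem _ κ n11))
      (sub_mem n12 n13)) (Submodule.smul_mem _ (b₁ + b₂) n14))
  set A : PSmooth n := φ * (euler (euler w) ^ 2 + euler w ^ 2 + sphGrad (euler w) (euler w)) with hA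
  set R : PSmooth n := ψ * (energy w + F * w) with hR
  have hAm : A ∈ annular n := hr _
  have hRm : R ∈ annular n := Ideal.mul_mem_right _ _ hψ
  have hgm : φ * (F * w) + C₁ • A ∈ annular n := add_mem (hr _) (smul_mem_annular _ hAm)
  have hfm : φ * sphLap w ^ 2 + (b₁ + b₂) • (φ * sphGrad w w) + (b₁ * b₂) • (φ * w ^ 2) ∈
    annular n := add_mem (add_mem (hr _) (smul_mem_annular _ (hr _))) (smul_mem_annular _ (hr _))
  have key := pInt_le_of_le_add_null (g := φ * (F * w) + C₁ • A + (C₁ * d) • R) hfm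
    (add_mem hgm (smul_mem_annular _ hRm)) hz fun x hx => ?_
  · rw [pInt_add hgm (smul_mem_annular _ hRm), pInt_add (hr _) (smul_mem_annular _ hAm), pInt_smul,
      pInt_smul] at key
    linarith
  have hE := hEq x hx
  rw [op_op_apply hb] at hE
  have hFw0 : 0 ≤ F x * w x := by
    rw [hF x hx, mul_assoc]
    exact mul_nonneg (Real.rpow_nonneg (abs_nonneg _) _) (mul_self_nonneg _)
  obtain ⟨t1, t2, t3, t4, t5, t6, t7, t8, t9, t10⟩ := abs_le_energy w x
  have hle : energy w x ≤ energy w x + F x * w x := by linarith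
  have hG := sphGrad_self_nonneg (euler w) x
  rw [hA, hR]
  simp only [Subalgebra.coe_add, Subalgebra.coe_smul, Subalgebra.coe_mul, Subalgebra.coe_pow,
    AddSubgroupClass.coe_sub, Pi.add_apply, Pi.sub_apply, Pi.mul_apply, Pi.pow_apply,
    Pi.smul_apply, smul_eq_mul, euler_mul_apply, euler_sq_apply,
    sphGrad_radial_mul_left_apply hφr, sphGrad_radial_mul_right_apply hφr,
    sphLap_radial_mul_apply hφr, euler_sphGrad, sphGrad_comm (sphLap w) w,
    sphGrad_comm (euler w) w, NegMemClass.coe_neg, Pi.neg_apply]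
  have k1 := mul_mul_le_abs (C := -2) (hφ1 x hx) (t10.trans hle)
  have k2 := mul_mul_le_abs (C := -1) (hφ2 x hx) (t9.trans hle)
  have k3 := mul_mul_le_abs (C := 2 * κ) (hφ1 x hx) (t9.trans hle)
  have k4 := mul_mul_le_abs (C := -κ) (hφ1 x hx) (t2.trans hle)
  have k5 := mul_mul_le_abs (C := κ ^ 2 - 4 - (b₁ + b₂)) (hφ1 x hx) (t8.trans hle)
  have k6 := mul_mul_le_abs (C := -(1 / 2) * (κ * (b₁ + b₂ + 4))) (hφ1 x hx) (t1.trans hle)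
  have k7 := mul_mul_le_abs (C := -2) (hφ1 x hx) (t7.trans hle)
  have k8 := mul_mul_le_abs (C := -κ) (hφ1 x hx) (t5.trans hle)
  have hgood : (κ ^ 2 - 4 - (b₁ + b₂)) * (φ x * euler w x ^ 2) - φ x * euler (euler w) x ^ 2 -
      2 * (φ x * sphGrad (euler w) (euler w) x) ≤
      C₁ * (φ x * (euler (euler w) x ^ 2 + euler w x ^ 2 + sphGrad (euler w) (euler w) x)) := by
    have h0 := hφ0 x hx
    have a1 : (κ ^ 2 - 4 - (b₁ + b₂)) * (φ x * euler w x ^ 2) ≤ C₁ * (φ x * euler w x ^ 2) :=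
      mul_le_mul_of_nonneg_right ((le_abs_self _).trans hC₂C₁) (by positivity)
    have a2 : 0 ≤ φ x * euler (euler w) x ^ 2 := by positivity
    have a3 := mul_nonneg h0 hG
    have a4 := mul_nonneg hC₁0 a2
    have a5 := mul_nonneg hC₁0 a3
    linarith
  have hCsum : C₁ * d * (ψ x * (energy w x + F x * w x)) =
      C₁ * (d * ψ x * (energy w x + F x * w x)) := by ring
  rw [hCsum]
  have hCsum' : C₁ * (d * ψ x * (energy w x + F x * w x)) = (|-2| + |-1| + |2 * κ| + |-κ| +
    |κ ^ 2 - 4 - (b₁ + b₂)| + |-(1 / 2) * (κ * (b₁ + b₂ + 4))| + |-2| + |-κ|) *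
    (d * ψ x * (energy w x + F x * w x)) := by rw [hC₁]
  rw [hCsum']
  linear_combination k1 + k2 + k3 + k4 + k5 + k6 + k7 + k8 + hgood + (φ x * w x) * hE

end PSmooth

end

noncomputable section

namespace PSmooth

variable {n : ℕ}

lemma sphGrad_add_self_le (f g : PSmooth n) (x : EuclideanSpace ℝ (Fin n)) :
    sphGrad (f + g) (f + g) x ≤ 2 * sphGrad f f x + 2 * sphGrad g g x := by
  have h := sphGrad_self_nonneg (f - g) x
  have h3 : sphGrad g f = sphGrad f g := sphGrad_comm _ _
  simp only [map_add, map_sub, LinearMap.add_apply, LinearMap.sub_apply, Subalgebra.coe_add,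
    AddSubgroupClass.coe_sub, Pi.add_apply, Pi.sub_apply, h3] at h ⊢
  linarith

variable [NeZero n]

lemma pInt_op_radial_mul_le {c d : ℝ} (hc : 0 ≤ c) {w η ψ : PSmooth n} (hη : IsRadial η)
    (hηm : η ∈ annular n) (hψm : ψ ∈ annular n) (hd0 : 0 ≤ d) (hd1 : d ≤ 1)
    (hψ1 : ∀ x ≠ 0, ψ x ≤ 1)
    (hη1 : ∀ x ≠ 0, |euler η x| ≤ d * ψ x) (hη2 : ∀ x ≠ 0, |euler (euler η) x| ≤ d * ψ x) :
    pInt (op 2 (-c) (η * w) ^ 2) ≤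
      pInt (η ^ 2 * sphLap w ^ 2) + 2 * c * pInt (η ^ 2 * sphGrad w w) +
        c ^ 2 * pInt (η ^ 2 * w ^ 2) +
        (4 * c + 24) *
          pInt (η ^ 2 * (euler (euler w) ^ 2 + euler w ^ 2 + sphGrad (euler w) (euler w))) +
        (4 * c + 24) * (d * pInt (ψ * energy w)) := by
  have hf : η * w ∈ annular n := Ideal.mul_mem_right _ _ hηm
  have hf1 := euler_mem_annular hf
  have hf2 := euler_mem_annular hf1
  have hr (g : PSmooth n) : η ^ 2 * g ∈ annular n :=
    Ideal.mul_mem_right _ _ (pow_mem_annular hηm two_pos)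
  have hR : ψ * energy w ∈ annular n := Ideal.mul_mem_right _ _ hψm
  set A : PSmooth n :=
    η ^ 2 * (euler (euler w) ^ 2 + euler w ^ 2 + sphGrad (euler w) (euler w)) with hA
  have hm1 := add_mem (hr (sphLap w ^ 2)) (smul_mem_annular (2 * c) (hr (sphGrad w w)))
  have hm2 := add_mem hm1 (smul_mem_annular (c ^ 2) (hr (w ^ 2)))
  have hm3 := add_mem hm2 (smul_mem_annular (4 * c + 24) (show A ∈ annular n from hr _))
  rw [pInt_op_sq hf]
  refine (pInt_mono (add_mem (add_mem (add_mem (add_mem (add_mem (pow_mem_annular hf2 two_pos)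
      (smul_mem_annular _ (sphGrad_mem_annular hf1 _)))
      (pow_mem_annular (sphLap_mem_annular hf) two_pos))
      (smul_mem_annular _ (pow_mem_annular hf1 two_pos)))
      (smul_mem_annular _ (sphGrad_mem_annular hf _)))
      (smul_mem_annular _ (pow_mem_annular hf two_pos)))
      (add_mem hm3 (smul_mem_annular ((4 * c + 24) * d) hR)) fun x hx => ?_).trans_eq ?_
  · have e1 : euler (η * w) = euler η * w + η * euler w := by
      rw [Derivation.leibniz, smul_eq_mul, smul_eq_mul]; ring
    have hG := sphGrad_add_self_le (euler η * w) (η * euler w) x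
    rw [← e1] at hG
    have e2 : euler (euler (η * w)) x =
        euler (euler η) x * w x + 2 * (euler η x * euler w x) + η x * euler (euler w) x := by
      rw [e1]
      simp only [map_add, Subalgebra.coe_add, Pi.add_apply, euler_mul_apply]
      ring
    have h1 := hη1 x hx
    have h2 := hη2 x hx
    have h00 := sphGrad_self_nonneg w x
    have h11 := sphGrad_self_nonneg (euler w) x
    simp only [hA, Subalgebra.coe_add, Subalgebra.coe_smul, Subalgebra.coe_mul, Subalgebra.coe_pow,
      Pi.add_apply, Pi.mul_apply, Pi.pow_apply, Pi.smul_apply, smul_eq_mul, e2, euler_mul_apply,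
      sphGrad_radial_mul_left_apply hη, sphGrad_radial_mul_right_apply hη,
      sphGrad_radial_mul_left_apply hη.euler, sphGrad_radial_mul_right_apply hη.euler,
      sphLap_radial_mul_apply hη, energy_apply] at hG ⊢
    have hψ0 : 0 ≤ d * ψ x := (abs_nonneg _).trans h1
    have hdψ : d * ψ x ≤ 1 :=
      (mul_le_of_le_one_right hd0 (hψ1 x hx)).trans hd1
    have q1 : euler η x ^ 2 ≤ d * ψ x := by
      rw [← sq_abs]; exact (pow_le_pow_left₀ (abs_nonneg _) h1 2).trans (by nlinarith)
    have q2 : euler (euler η) x ^ 2 ≤ d * ψ x := by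
      rw [← sq_abs]; exact (pow_le_pow_left₀ (abs_nonneg _) h2 2).trans (by nlinarith)
    generalize sphGrad (euler (η * w)) (euler (η * w)) x = GG at *
    generalize sphGrad (euler w) (euler w) x = G11 at *
    generalize sphGrad w w x = G00 at *
    generalize euler (euler η) x = y2 at *
    generalize euler η x = y1 at *
    generalize η x = y0 at *
    generalize euler (euler w) x = w2 at *
    generalize euler w x = w1 at *
    generalize w x = w0 at *
    generalize sphLap w x = l at *
    have hE : (4 * c + 24) * d * (ψ x * (w2 ^ 2 + G11 + l ^ 2 + w1 ^ 2 + G00 + w0 ^ 2)) =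
      (4 * c + 24) * ((d * ψ x) * (w2 ^ 2 + G11 + l ^ 2 + w1 ^ 2 + G00 + w0 ^ 2)) := by ring
    rw [hE]
    generalize d * ψ x = e at *
    have s1 : (y2 * w0 + 2 * (y1 * w1) + y0 * w2) ^ 2 ≤
        3 * (y2 ^ 2 * w0 ^ 2 + 4 * (y1 ^ 2 * w1 ^ 2) + y0 ^ 2 * w2 ^ 2) := by
      linarith [sq_nonneg (y2 * w0 - 2 * (y1 * w1)), sq_nonneg (y2 * w0 - y0 * w2),
        sq_nonneg (2 * (y1 * w1) - y0 * w2)]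
    have s2 : (2 * c + 4) * (y1 * w0 + y0 * w1) ^ 2 ≤
        (2 * c + 4) * (2 * (y1 ^ 2 * w0 ^ 2 + y0 ^ 2 * w1 ^ 2)) :=
      mul_le_mul_of_nonneg_left (by linarith [sq_nonneg (y1 * w0 - y0 * w1)]) (by linarith)
    have m1 : y2 ^ 2 * w0 ^ 2 ≤ e * w0 ^ 2 := by gcongr
    have m2 : y1 ^ 2 * w1 ^ 2 ≤ e * w1 ^ 2 := by gcongr
    have m3 : (4 * c + 8) * (y1 ^ 2 * w0 ^ 2) ≤ (4 * c + 8) * (e * w0 ^ 2) := by gcongr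
    have m4 : y1 ^ 2 * G00 ≤ e * G00 := by gcongr
    have p1 : 0 ≤ e * w2 ^ 2 := by positivity
    have p2 : 0 ≤ e * G11 := by positivity
    have p3 : 0 ≤ e * l ^ 2 := by positivity
    have p4 : 0 ≤ e * w1 ^ 2 := by positivity
    have p5 : 0 ≤ e * G00 := by positivity
    have p6 : 0 ≤ e * w0 ^ 2 := by positivity
    have p7 : 0 ≤ y0 ^ 2 * w2 ^ 2 := by positivity
    have p8 : 0 ≤ y0 ^ 2 * w1 ^ 2 := by positivity
    have p9 : 0 ≤ y0 ^ 2 * G11 := by positivity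
    have r1 := mul_nonneg hc p1
    have r2 := mul_nonneg hc p2
    have r3 := mul_nonneg hc p3
    have r4 := mul_nonneg hc p4
    have r5 := mul_nonneg hc p5
    have r6 := mul_nonneg hc p6
    have r7 := mul_nonneg hc p7
    have r8 := mul_nonneg hc p8
    have r9 := mul_nonneg hc p9
    linarith
  · rw [pInt_add hm3 (smul_mem_annular _ hR), pInt_add hm2 (smul_mem_annular _ (hr _)),
      pInt_add hm1 (smul_mem_annular _ (hr _)), pInt_add (hr _) (smul_mem_annular _ (hr _)),
      pInt_smul, pInt_smul, pInt_smul, pInt_smul]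
    ring

lemma exists_pInt_sq_mul_energy_le {c p κ b₁ b₂ : ℝ} (hc : 0 ≤ c) (hp : 1 < p) (hκ : 0 < κ)
    (hb : b₂ = b₁ + 2 * κ) (h₁ : 2 * c < p * (b₁ + b₂)) (h₂ : c ^ 2 < p * (b₁ * b₂))
    {w F : PSmooth n} (hF : ∀ x ≠ 0, F x = |w x| ^ (p - 1) * w x)
    (hEq : ∀ x ≠ 0, op (κ - 2) (-b₂) (op (κ + 2) (-b₁) w) x = F x)
    (hstab : ∀ g ∈ annular n, p * pInt (g ^ 2 * (F * w)) ≤ pInt (op 2 (-c) (g * w) ^ 2)) :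
    ∃ C, 0 ≤ C ∧ ∀ (η ψ : PSmooth n) (d : ℝ), IsRadial η → η ∈ annular n → ψ ∈ annular n →
      0 ≤ d → d ≤ 1 → (∀ x ≠ 0, 0 ≤ η x) → (∀ x ≠ 0, η x ≤ 1) →
      (∀ x ≠ 0, 0 ≤ ψ x) → (∀ x ≠ 0, ψ x ≤ 1) →
      (∀ x ≠ 0, |euler η x| ≤ d * ψ x) → (∀ x ≠ 0, |euler (euler η) x| ≤ d * ψ x) →
      pInt (η ^ 2 * (energy w + F * w)) ≤ C * (d * pInt (ψ * (energy w + F * w))) := by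
  have hb0 : 0 ≤ b₁ + b₂ := by
    by_contra! h
    nlinarith
  obtain ⟨Ca, hCa0, hCa⟩ := exists_translation_bound (n := n) hκ hb hb0 hp
  obtain ⟨Cb, hCb0, hCb⟩ := exists_test_bound (n := n) (p := p) hb
  set δ : ℝ := min (p - 1) (min (p * (b₁ + b₂) - 2 * c) (p * (b₁ * b₂) - c ^ 2)) with hδ
  have hδ0 : 0 < δ := lt_min (by linarith) (lt_min (by linarith) (by linarith))
  have hδ1 : δ ≤ p - 1 := min_le_left _ _
  have hδ2 : δ ≤ p * (b₁ + b₂) - 2 * c := (min_le_right _ _).trans (min_le_left _ _)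
  have hδ3 : δ ≤ p * (b₁ * b₂) - c ^ 2 := (min_le_right _ _).trans (min_le_right _ _)
  set M : ℝ := 1 + 2 * c + c ^ 2 with hM
  set P : ℝ := p * Cb * (4 * Ca) + p * Cb * 4 + (4 * c + 24) * (4 * Ca) + (4 * c + 24) with hP
  have hP0 : 0 ≤ P := by positivity
  refine ⟨4 * Ca + P / δ + (M * (P / δ) + P), by positivity,
    fun η ψ d hη hηm hψm hd0 hd1 hη0 hη1 hψ0 hψ1 hηd hηdd => ?_⟩
  have hφm := pow_mem_annular hηm two_pos
  have hφ1 : ∀ x ≠ 0, |euler (η ^ 2) x| ≤ 4 * d * ψ x := fun x hx => by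
    rw [euler_pow_apply _ 1, abs_mul, abs_of_nonneg (by have := hη0 x hx; positivity)]
    have := hηd x hx
    have h0 := hη0 x hx
    have h1 := hη1 x hx
    have h2 := abs_nonneg (euler η x)
    push_cast
    nlinarith
  have hφ2 : ∀ x ≠ 0, |euler (euler (η ^ 2)) x| ≤ 4 * d * ψ x := fun x hx => by
    rw [euler_euler_pow_apply _ 0]
    have i1 := hηd x hx
    have i2 := hηdd x hx
    have h0 := hη0 x hx
    have h1 := hη1 x hx
    have hdψ : d * ψ x ≤ 1 :=
      (mul_le_of_le_one_right hd0 (hψ1 x hx)).trans hd1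
    have j1 : euler η x ^ 2 ≤ d * ψ x := by
      rw [← sq_abs]; exact (pow_le_pow_left₀ (abs_nonneg _) i1 2).trans (by
        nlinarith [mul_nonneg hd0 (hψ0 x hx)])
    have j2 : |η x * euler (euler η) x| ≤ d * ψ x := by
      rw [abs_mul, abs_of_nonneg h0]
      nlinarith [abs_nonneg (euler (euler η) x)]
    rw [abs_le] at j2 ⊢
    push_cast
    constructor <;> nlinarith [sq_nonneg (euler η x)]
  have hr (g : PSmooth n) : η ^ 2 * g ∈ annular n := Ideal.mul_mem_right _ _ hφm
  have hφ0 : ∀ x ≠ 0, 0 ≤ (η ^ 2 : PSmooth n) x := fun x _ => by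
    simpa using sq_nonneg (η x)
  have ka := hCa w F (η ^ 2) ψ (4 * d) hF hEq (hη.pow 2) hφm hψm hφ0 hφ1 hφ2
  have kb := hCb w F (η ^ 2) ψ (4 * d) hF hEq (hη.pow 2) hφm hψm hφ0 hφ1 hφ2
  have ks := (hstab η hηm).trans (pInt_op_radial_mul_le hc hη hηm hψm hd0 hd1 hψ1 hηd hηdd)
  have hRm (g : PSmooth n) : ψ * g ∈ annular n := Ideal.mul_mem_right _ _ hψm
  have hFw : ∀ x ≠ 0, 0 ≤ F x * w x := fun x hx => by
    rw [hF x hx, mul_assoc]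
    exact mul_nonneg (Real.rpow_nonneg (abs_nonneg _) _) (mul_self_nonneg _)
  have hER : pInt (ψ * energy w) ≤ pInt (ψ * (energy w + F * w)) :=
    pInt_mono (hRm _) (hRm _) fun x hx =>
      mul_le_mul_of_nonneg_left (le_add_of_nonneg_right (hFw x hx)) (hψ0 x hx)
  have hR0 : 0 ≤ pInt (ψ * energy w) := pInt_nonneg (hRm _) fun x hx =>
    mul_nonneg (hψ0 x hx) (energy_nonneg w x)
  have hX2 : 0 ≤ pInt (η ^ 2 * sphLap w ^ 2) := pInt_nonneg (hr _) fun x hx =>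
    mul_nonneg (hφ0 x hx) (sq_nonneg (sphLap w x))
  have hXG : 0 ≤ pInt (η ^ 2 * sphGrad w w) := pInt_nonneg (hr _) fun x hx =>
    mul_nonneg (hφ0 x hx) (sphGrad_self_nonneg w x)
  have hX0 : 0 ≤ pInt (η ^ 2 * w ^ 2) := pInt_nonneg (hr _) fun x hx =>
    mul_nonneg (hφ0 x hx) (sq_nonneg (w x))
  have hJ : 0 ≤ pInt (η ^ 2 * (F * w)) := pInt_nonneg (hr _) fun x hx =>
    mul_nonneg (hφ0 x hx) (hFw x hx)
  have hsum : pInt (η ^ 2 * (energy w + F * w)) =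
      pInt (η ^ 2 * (euler (euler w) ^ 2 + euler w ^ 2 + sphGrad (euler w) (euler w))) +
        pInt (η ^ 2 * sphLap w ^ 2) + pInt (η ^ 2 * sphGrad w w) + pInt (η ^ 2 * w ^ 2) +
        pInt (η ^ 2 * (F * w)) := by
    rw [← pInt_add (hr _) (hr _), ← pInt_add (add_mem (hr _) (hr _)) (hr _),
      ← pInt_add (add_mem (add_mem (hr _) (hr _)) (hr _)) (hr _),
      ← pInt_add (add_mem (add_mem (add_mem (hr _) (hr _)) (hr _)) (hr _)) (hr _), energy]
    congr 1
    ring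
  rw [pInt_add (add_mem (hr _) (smul_mem_annular _ (hr _))) (smul_mem_annular _ (hr _)),
    pInt_add (hr _) (smul_mem_annular _ (hr _)), pInt_smul, pInt_smul] at kb
  rw [hsum]
  generalize pInt (η ^ 2 * (euler (euler w) ^ 2 + euler w ^ 2 + sphGrad (euler w) (euler w))) = A
    at *
  generalize pInt (η ^ 2 * sphLap w ^ 2) = X2 at *
  generalize pInt (η ^ 2 * sphGrad w w) = XG at *
  generalize pInt (η ^ 2 * w ^ 2) = X0 at *
  generalize pInt (η ^ 2 * (F * w)) = J at *
  have hER' : d * pInt (ψ * energy w) ≤ d * pInt (ψ * (energy w + F * w)) := by gcongr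
  have hdR0 : 0 ≤ d * pInt (ψ * energy w) := by positivity
  rw [mul_assoc 4 d] at ka kb
  generalize d * pInt (ψ * energy w) = E at *
  generalize d * pInt (ψ * (energy w + F * w)) = R at *
  have hR : 0 ≤ R := by linarith
  have hA1 : p * Cb * A ≤ p * Cb * (4 * Ca * R) := by gcongr; linarith
  have hA2 : (4 * c + 24) * A ≤ (4 * c + 24) * (4 * Ca * R) := by gcongr; linarith
  have hE2 : (4 * c + 24) * E ≤ (4 * c + 24) * R := by gcongr
  have kb' := mul_le_mul_of_nonneg_left kb (show 0 ≤ p by linarith)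
  have hX : δ * (X2 + XG + X0) ≤ P * R := by
    have i1 := mul_le_mul_of_nonneg_right hδ1 hX2
    have i2 := mul_le_mul_of_nonneg_right hδ2 hXG
    have i3 := mul_le_mul_of_nonneg_right hδ3 hX0
    rw [hP]
    linarith
  have hX' : X2 + XG + X0 ≤ P / δ * R := by
    rw [div_mul_eq_mul_div, le_div_iff₀ hδ0]
    linarith
  have hMX : X2 + 2 * c * XG + c ^ 2 * X0 ≤ M * (P / δ * R) := by
    have i0 : M * (X2 + XG + X0) ≤ M * (P / δ * R) := by gcongr
    have : 0 ≤ 2 * c * X2 + c ^ 2 * X2 + XG + c ^ 2 * XG + X0 + 2 * c * X0 := by positivity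
    rw [hM] at i0 ⊢
    linarith
  have hJp : J ≤ p * J := le_mul_of_one_le_left hJ hp.le
  have hPR : (4 * c + 24) * (4 * Ca * R) + (4 * c + 24) * R ≤ P * R := by
    have : 0 ≤ (p * Cb * (4 * Ca) + p * Cb * 4) * R := by positivity
    rw [hP]
    linarith
  linarith

end PSmooth

end

noncomputable section

namespace PSmooth

variable {n : ℕ}

lemma abs_le_mul_cut_sq {f : PSmooth n} {B L : ℝ} (hL : 0 < L) {x : EuclideanSpace ℝ (Fin n)}
    (hB : |f x| ≤ B) (hf : 2 * L < |Real.log ‖x‖ - 0| → f x = 0) (hB0 : 0 ≤ B) :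
    |f x| ≤ B * (cut (2 * L) 0 ^ 2 : PSmooth n) x := by
  rcases le_or_gt |Real.log ‖x‖ - 0| (2 * L) with h | h
  · have : (cut (2 * L) 0 ^ 2 : PSmooth n) x = 1 := by
      rw [Subalgebra.coe_pow, Pi.pow_apply, cut_eq_one (by linarith) h, one_pow]
    rwa [this, mul_one]
  · rw [hf h, abs_zero]
    exact mul_nonneg hB0 (by simpa using sq_nonneg ((cut (2 * L) 0 : PSmooth n) x))

variable [NeZero n]

lemma eq_zero_of_supercritical {c p κ b₁ b₂ : ℝ} (hc : 1 ≤ c) (hp : 1 < p) (hκ : 0 < κ)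
    (hb : b₂ = b₁ + 2 * κ) (h₁ : 2 * c < p * (b₁ + b₂)) (h₂ : c ^ 2 < p * (b₁ * b₂))
    {w F : PSmooth n} (hF : ∀ x ≠ 0, F x = |w x| ^ (p - 1) * w x)
    (hEq : ∀ x ≠ 0, op (κ - 2) (-b₂) (op (κ + 2) (-b₁) w) x = F x)
    (hG : ∀ x ≠ 0, op (-2) (-c) (op 2 (-c) (npow (κ / 2) * w)) x = (npow (κ / 2) * F : PSmooth n) x)
    (hstab : ∀ g ∈ annular n, p * pInt (g ^ 2 * (F * w)) ≤ pInt (op 2 (-c) (g * w) ^ 2)) :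
    ∀ x ≠ 0, w x = 0 := by
  obtain ⟨C, hC0, hC⟩ := exists_growth_bound hc hp hκ.le hF hG hstab
  obtain ⟨K, hK0, hK⟩ :=
    exists_pInt_sq_mul_energy_le (by linarith) hp hκ hb h₁ h₂ hF hEq hstab
  obtain ⟨B, hB0, hB⟩ := exists_isCutoff_cut
  set Y : ℝ → ℝ := fun L => pInt (cut L 0 ^ 2 * (energy w + F * w)) with hY
  have hstep : ∀ L, max 1 B ≤ L → Y L ≤ K * (B / L * Y (2 * L)) := fun L hL => by
    have hL1 : 1 ≤ L := (le_max_left _ _).trans hL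
    have hLB : B ≤ L := (le_max_right _ _).trans hL
    have hL0 : 0 < L := by linarith
    have hcut := hB (n := n) L 0 hL1
    have hd0 : 0 ≤ B / L := by positivity
    refine hK (cut L 0) (cut (2 * L) 0 ^ 2) (B / L) hcut.isRadial hcut.mem_annular
      (pow_mem_annular (cut_mem_annular (by linarith) 0) two_pos) hd0
      (div_le_one_of_le₀ hLB hL0.le) hcut.nonneg hcut.le_one
      (fun x _ => by simpa using sq_nonneg ((cut (2 * L) 0 : PSmooth n) x))
      (fun x _ => by
        rw [Subalgebra.coe_pow, Pi.pow_apply]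
        exact pow_le_one₀ (cut_nonneg _ _ x) (cut_le_one _ _ x))
      (fun x hx => abs_le_mul_cut_sq hL0 (hcut.abs_euler_le x hx) (fun h => ?_) hd0)
      (fun x hx => abs_le_mul_cut_sq hL0 (hcut.abs_euler_euler_le x hx) (fun h => ?_) hd0)
    all_goals
      have h0 : (cut L 0 : PSmooth n).1 =ᶠ[𝓝 x] (0 : PSmooth n).1 := cut_eventuallyEq_zero hL0 hx h
      have h1 : (euler (cut L 0) : PSmooth n).1 =ᶠ[𝓝 x] (euler (0 : PSmooth n)).1 :=
        linDer_eventuallyEq _ h0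
      rw [map_zero] at h1
    · exact h1.eq_of_nhds
    · have h2 : (euler (euler (cut L 0)) : PSmooth n).1 =ᶠ[𝓝 x] (euler (0 : PSmooth n)).1 :=
        linDer_eventuallyEq _ h1
      rw [map_zero] at h2
      exact h2.eq_of_nhds
  have hFw : ∀ x ≠ 0, 0 ≤ F x * w x := fun x hx => by
    rw [hF x hx, mul_assoc]
    exact mul_nonneg (Real.rpow_nonneg (abs_nonneg _) _) (mul_self_nonneg _)
  refine eq_zero_of_pInt_le_div w (C := 2 * K ^ 2 * B ^ 2 * C) (L₁ := max 1 B) fun L hL => ?_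
  have hL1 : 1 ≤ L := (le_max_left _ _).trans hL
  have hL0 : 0 < L := by linarith
  refine ⟨cut L 0 ^ 2 * (energy w + F * w), Ideal.mul_mem_right _ _
    (pow_mem_annular (cut_mem_annular hL0 0) two_pos), fun x hx => ?_, fun x hx h => ?_, ?_⟩
  · exact mul_nonneg (sq_nonneg ((cut L 0 : PSmooth n) x))
      (add_nonneg (energy_nonneg w x) (hFw x hx))
  · have e : (cut L 0 ^ 2 * (energy w + F * w) : PSmooth n) x =
        (cut L 0 : PSmooth n) x ^ 2 * (energy w x + F x * w x) := rfl
    rw [e, cut_eq_one hL0 (by simpa using h), one_pow, one_mul]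
    linarith [sq_le_energy w x, hFw x hx]
  · calc Y L ≤ K * (B / L * Y (2 * L)) := hstep L hL
      _ ≤ K * (B / L * (K * (B / (2 * L) * Y (2 * (2 * L))))) := by
        gcongr; exact hstep _ (by linarith)
      _ ≤ K * (B / L * (K * (B / (2 * L) * (C * (2 * (2 * L)))))) := by
        gcongr; exact hC _ (by linarith)
      _ = 2 * K ^ 2 * B ^ 2 * C / L := by field_simp

end PSmooth

end

noncomputable section

namespace PSmooth

variable {n : ℕ}

lemma op_op_npow_mul_eq_of_isSolutionOn {a p β : ℝ} (hβ : β * (p - 1) = 4 + a) {U : PSmooth n}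
    (hsol : IsSolutionOn n a p U.1 univ) {x : EuclideanSpace ℝ (Fin n)} (hx : x ≠ 0) :
    op (n - 6 - 2 * β) (-((β + 2) * (n - 4 - β)))
        (op (n - 2 - 2 * β) (-(β * (n - 2 - β))) (npow β * U)) x =
      |(npow β * U : PSmooth n) x| ^ (p - 1) * (npow β * U : PSmooth n) x := by
  have hn : 0 < ‖x‖ := norm_pos_iff.2 hx
  have h : (npow (-β) * (npow β * U) : PSmooth n).1 =ᶠ[𝓝 x] U.1 :=
    eventually_of_mem (isOpen_compl_singleton.mem_nhds hx) fun y hy => by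
      change ‖y‖ ^ (-β) * (‖y‖ ^ β * U y) = U y
      rw [← mul_assoc, ← Real.rpow_add (norm_pos_iff.2 hy), neg_add_cancel, Real.rpow_zero, one_mul]
  have h1 := lap_lap_npow_mul β (npow β * U) hx
  rw [lap_congr (h.eventually_nhds.mono fun y hy => lap_congr hy), hsol x (mem_univ x)] at h1
  set V : PSmooth n := op (n - 6 - 2 * β) (-((β + 2) * (n - 4 - β)))
    (op (n - 2 - 2 * β) (-(β * (n - 2 - β))) (npow β * U))
  change ‖x‖ ^ a * |U x| ^ (p - 1) * U x = ‖x‖ ^ (-(β + 4)) * V x at h1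
  change V x = |‖x‖ ^ β * U x| ^ (p - 1) * (‖x‖ ^ β * U x)
  have e1 : V x = ‖x‖ ^ (β + 4) * (‖x‖ ^ (-(β + 4)) * V x) := by
    rw [← mul_assoc, ← Real.rpow_add hn, add_neg_cancel, Real.rpow_zero, one_mul]
  have e2 : |‖x‖ ^ β * U x| ^ (p - 1) = ‖x‖ ^ (4 + a) * |U x| ^ (p - 1) := by
    rw [abs_mul, abs_of_pos (Real.rpow_pos_of_pos hn _), Real.mul_rpow
      (Real.rpow_nonneg hn.le _) (abs_nonneg _), ← Real.rpow_mul hn.le, hβ]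
  rw [e1, ← h1, e2, Real.rpow_add hn, Real.rpow_add hn]
  ring

lemma op_op_npow_half_mul {c κ b₁ b₂ : ℝ} (h₁ : c - κ - (κ / 2) ^ 2 = b₁)
    (h₂ : c + κ - (κ / 2) ^ 2 = b₂) (w : PSmooth n) :
    op (-2) (-c) (op 2 (-c) (npow (κ / 2) * w)) =
      npow (κ / 2) * op (κ - 2) (-b₂) (op (κ + 2) (-b₁) w) := by
  rw [op_npow_mul, op_npow_mul, show -2 + 2 * (κ / 2) = κ - 2 by ring,
    show 2 + 2 * (κ / 2) = κ + 2 by ring, show -c + -2 * (κ / 2) + (κ / 2) ^ 2 = -b₂ by linarith,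
    show -c + 2 * (κ / 2) + (κ / 2) ^ 2 = -b₁ by linarith]

lemma pInt_le_pInt_op_sq_of_stableOn [NeZero n] {a p β m c : ℝ} (hβ : β * (p - 1) = 4 + a)
    (hm : 0 < m) (hmn : 2 * m = n - 4) (hcm : c = m * (m + 2)) {U F : PSmooth n}
    (hstab : StableOn n a p U.1 univ)
    (hF : ∀ x ≠ 0, F x = |(npow β * U : PSmooth n) x| ^ (p - 1) * (npow β * U : PSmooth n) x)
    {g : PSmooth n} (hg : g ∈ annular n) :
    p * pInt (g ^ 2 * (F * (npow β * U))) ≤ pInt (op 2 (-c) (g * (npow β * U)) ^ 2) := by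
  set w : PSmooth n := npow β * U with hw
  set ψ : PSmooth n := npow (-m) * (g * w) with hψ
  have hψm : ψ ∈ annular n := Ideal.mul_mem_left _ _ (Ideal.mul_mem_right _ _ hg)
  have hψ0 : ψ 0 = 0 := by
    change ‖(0 : EuclideanSpace ℝ (Fin n))‖ ^ (-m) * (g * w : PSmooth n) 0 = 0
    rw [norm_zero, Real.zero_rpow (by linarith), zero_mul]
  have h := hstab ψ.1 (contDiff_of_mem_annular hψm hψ0) (hasCompactSupport_of_mem_annular hψm)
    (subset_univ _)
  have hae : ∀ᵐ x : EuclideanSpace ℝ (Fin n), x ≠ 0 :=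
    compl_mem_ae_iff.2 (measure_singleton _)
  have e1 : pInt (g ^ 2 * (F * w)) = ∫ x, ‖x‖ ^ a * |U x| ^ (p - 1) * ψ x ^ 2 := by
    refine integral_congr_ae (hae.mono fun x hx => ?_)
    have hn : 0 < ‖x‖ := norm_pos_iff.2 hx
    change ‖x‖ ^ (-(n : ℝ)) * (g x ^ 2 * (F x * w x)) =
      ‖x‖ ^ a * |U x| ^ (p - 1) * (‖x‖ ^ (-m) * (g x * w x)) ^ 2
    have e2 : |w x| ^ (p - 1) = ‖x‖ ^ (4 + a) * |U x| ^ (p - 1) := by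
      change |‖x‖ ^ β * U x| ^ (p - 1) = _
      rw [abs_mul, abs_of_pos (Real.rpow_pos_of_pos hn _), Real.mul_rpow
        (Real.rpow_nonneg hn.le _) (abs_nonneg _), ← Real.rpow_mul hn.le, hβ]
    have e3 : (‖x‖ ^ (-m)) ^ 2 = ‖x‖ ^ (-(n : ℝ)) * ‖x‖ ^ (4 : ℝ) := by
      rw [← Real.rpow_natCast, ← Real.rpow_mul hn.le, ← Real.rpow_add hn]
      congr 1
      push_cast
      linarith
    rw [hF x hx, e2, mul_pow, e3, Real.rpow_add hn]
    ring
  have e4 : pInt (op 2 (-c) (g * w) ^ 2) = ∫ x, lap n ψ.1 x ^ 2 := by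
    refine integral_congr_ae (hae.mono fun x hx => ?_)
    have hn : 0 < ‖x‖ := norm_pos_iff.2 hx
    have h1 := lap_npow_mul m (g * w) hx
    rw [show (n : ℝ) - 2 - 2 * m = 2 by linarith,
      show m * ((n : ℝ) - 2 - m) = c by rw [hcm]; congr 1; linarith] at h1
    change _ = ‖x‖ ^ (-(m + 2)) * op 2 (-c) (g * w) x at h1
    change ‖x‖ ^ (-(n : ℝ)) * op 2 (-c) (g * w) x ^ 2 = lap n ψ.1 x ^ 2
    have e3 : (‖x‖ ^ (-(m + 2))) ^ 2 = ‖x‖ ^ (-(n : ℝ)) := by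
      rw [← Real.rpow_natCast, ← Real.rpow_mul hn.le]
      congr 1
      push_cast
      linarith
    rw [hψ, h1, mul_pow, e3]
  rw [e1, e4]
  exact h

end PSmooth

end

/-- Theorem 1.1: Liouville theorem for smooth stable solutions of
`Δ²u = |x|^a |u|^(p-1) u` on `ℝⁿ` for `1 < p < p_a(n)`. -/
theorem stmt0 (n : ℕ) (hn : 5 ≤ n) (a p : ℝ) (ha : 0 ≤ a) (hp : 1 < p)
    (hrange : p ≤ ((n : ℝ) + 4 + 2 * a) / ((n : ℝ) - 4) ∨
      (((n : ℝ) + 4 + 2 * a) / ((n : ℝ) - 4) < p ∧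
        p * ell1 n a p > (n : ℝ) * ((n : ℝ) - 4) / 2 ∧
        p * ell2 n a p > (n : ℝ) ^ 2 * ((n : ℝ) - 4) ^ 2 / 16))
    (u : EuclideanSpace ℝ (Fin n) → ℝ) (hu : ContDiff ℝ (⊤ : ℕ∞) u)
    (hsol : IsSolutionOn n a p u Set.univ)
    (hstab : StableOn n a p u Set.univ) :
    ∀ x, u x = 0 := by
  have hn0 : NeZero n := ⟨by omega⟩
  have hn5 : (5 : ℝ) ≤ n := by exact_mod_cast hn
  have hp1 : 0 < p - 1 := by linarith
  obtain ⟨β, hβdef⟩ : ∃ β : ℝ, β = (4 + a) / (p - 1) := ⟨_, rfl⟩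
  have hβ : β * (p - 1) = 4 + a := by rw [hβdef]; field_simp
  obtain ⟨c, hc⟩ : ∃ c : ℝ, c = n * (n - 4) / 4 := ⟨_, rfl⟩
  have hc1 : 1 ≤ c := by rw [hc]; nlinarith
  obtain ⟨κ, hκ⟩ : ∃ κ : ℝ, κ = n - 4 - 2 * β := ⟨_, rfl⟩
  obtain ⟨b₁, hb₁⟩ : ∃ b : ℝ, b = β * (n - 2 - β) := ⟨_, rfl⟩
  obtain ⟨b₂, hb₂⟩ : ∃ b : ℝ, b = (β + 2) * (n - 4 - β) := ⟨_, rfl⟩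
  let U : PSmooth n := ⟨u, hu.contDiffOn⟩
  let w : PSmooth n := PSmooth.npow β * U
  let F : PSmooth n := PSmooth.op (κ - 2) (-b₂) (PSmooth.op (κ + 2) (-b₁) w)
  have hF : ∀ x ≠ 0, F x = |w x| ^ (p - 1) * w x := fun x hx => by
    have h := PSmooth.op_op_npow_mul_eq_of_isSolutionOn (U := U) hβ hsol hx
    rwa [← hb₁, ← hb₂, show (n : ℝ) - 6 - 2 * β = κ - 2 by rw [hκ]; ring,
      show (n : ℝ) - 2 - 2 * β = κ + 2 by rw [hκ]; ring] at h
  have hG : ∀ x ≠ 0, PSmooth.op (-2) (-c) (PSmooth.op 2 (-c) (PSmooth.npow (κ / 2) * w)) x =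
      (PSmooth.npow (κ / 2) * F : PSmooth n) x := fun x _ => by
    rw [PSmooth.op_op_npow_half_mul (b₁ := b₁) (b₂ := b₂) (by rw [hc, hκ, hb₁]; ring)
      (by rw [hc, hκ, hb₂]; ring)]
  have hst : ∀ g ∈ PSmooth.annular n,
      p * PSmooth.pInt (g ^ 2 * (F * w)) ≤ PSmooth.pInt (PSmooth.op 2 (-c) (g * w) ^ 2) :=
    fun g hg => PSmooth.pInt_le_pInt_op_sq_of_stableOn (m := (n - 4) / 2) hβ (by linarith)
      (by ring) (by rw [hc]; ring) hstab hF hg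
  have hw : ∀ x ≠ 0, w x = 0 := by
    rcases hrange with h | ⟨h, h₁, h₂⟩
    · rw [le_div_iff₀ (by linarith)] at h
      have hκ0 : κ ≤ 0 := by
        have : 0 ≤ -κ * (p - 1) := by rw [hκ]; linarith
        linarith [nonneg_of_mul_nonneg_left this hp1]
      obtain ⟨S, hS⟩ := (isCompact_closedBall (0 : EuclideanSpace ℝ (Fin n)) 1).bddAbove_image
        (hu.continuous.pow 2).continuousOn
      refine PSmooth.eq_zero_of_subcritical (S := S) hc1 hp hκ0 hF hG hst fun x hx hx1 => ?_
      have hS' : u x ^ 2 ≤ S := hS ⟨x, by simpa using hx1, rfl⟩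
      refine le_trans ?_ hS'
      have hn : 0 < ‖x‖ := norm_pos_iff.2 hx
      change (‖x‖ ^ (κ / 2) * (‖x‖ ^ β * u x)) ^ 2 ≤ u x ^ 2
      rw [← mul_assoc, ← Real.rpow_add hn, mul_pow]
      refine mul_le_of_le_one_left (sq_nonneg _) (pow_le_one₀ (Real.rpow_nonneg hn.le _)
        (Real.rpow_le_one hn.le hx1 ?_))
      rw [hκ]
      linarith
    · rw [div_lt_iff₀ (by linarith)] at h
      have hκ0 : 0 < κ := by
        have : 0 < κ * (p - 1) := by rw [hκ]; linarith
        exact pos_of_mul_pos_left this hp1.le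
      have e1 : ell1 n a p = b₁ + b₂ := by rw [ell1, hb₁, hb₂, hβdef]; ring
      have e2 : ell2 n a p = b₁ * b₂ := by rw [ell2, hb₁, hb₂, hβdef]; ring
      rw [e1] at h₁
      rw [e2] at h₂
      exact PSmooth.eq_zero_of_supercritical hc1 hp hκ0 (by rw [hb₁, hb₂, hκ]; ring)
        (by rw [hc]; linarith) (by rw [hc]; linarith) hF (fun _ _ => rfl) hG hst
  have hu0 : ∀ x ∈ ({0}ᶜ : Set (EuclideanSpace ℝ (Fin n))), u x = 0 := fun x hx =>
    (mul_eq_zero.1 (hw x hx)).resolve_left (Real.rpow_pos_of_pos (norm_pos_iff.2 hx) _).ne'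
  have : Nontrivial (EuclideanSpace ℝ (Fin n)) := inferInstance
  have : (𝓝[≠] (0 : EuclideanSpace ℝ (Fin n))).NeBot := Module.punctured_nhds_neBot ℝ _ 0
  exact congrFun (Continuous.ext_on (dense_compl_singleton 0) hu.continuous continuous_const hu0)
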